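/- Let α₁,…,α_u and β₁,…,β_v be positive integers. The mixed sum Φ = α₁P₄(x₁)+⋯+α_uP₄(x_u)+β₁P₈(y₁)+⋯+β_vP₈(y_v) of generalized 4- and 8-gonal numbers is universal if and only if Φ represents each of the integers 1, 2, 3, 4, 5, 6, 7, 8, 9, 10, 12, 13, 14, 15, 18, 20, 30, 60, and 61. -/

import Mathlib

/-- The mixed sum with square coefficients `a` and generalized octagonal
coefficients `b` represents the integer `N`. -/
def mixedRepresents (a b : List ℤ) (N : ℤ) : Prop :=
  ∃ x y : List ℤ, x.length = a.length ∧ y.length = b.length ∧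
    (List.zipWith (fun c t => c * t ^ 2) a x).sum +
      (List.zipWith (fun c t => c * (3 * t ^ 2 - 2 * t)) b y).sum = N

/-- The mixed sum of generalized 4- and 8-gonal numbers is universal. -/
def mixedUniversal (a b : List ℤ) : Prop :=
  ∀ N : ℤ, 0 ≤ N → mixedRepresents a b N

/-- The ternary form `a x² + b y² + c z² + r y z + s x z + t x y`. -/
def ternaryForm (a b c r s t x y z : ℤ) : ℤ :=
  a * x ^ 2 + b * y ^ 2 + c * z ^ 2 + r * (y * z) + s * (x * z) + t * (x * y)

/-- Half the discriminant of `ternaryForm`. -/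
def halfDisc (a b c r s t : ℤ) : ℤ :=
  4 * a * b * c + r * s * t - a * r ^ 2 - b * s ^ 2 - c * t ^ 2

/-- A class of functions on `ℤ³` closed under generators of the unimodular group. -/
structure UnimodularClosed (C : (ℤ → ℤ → ℤ → ℤ) → Prop) : Prop where
  swap₁₂ : ∀ f, C f → C fun x y z => f y x z
  swap₂₃ : ∀ f, C f → C fun x y z => f x z y
  neg : ∀ f, C f → C fun x y z => f (-x) y z
  shear : ∀ f, C f → C fun x y z => f (x + y) y z

theorem UnimodularClosed.and {C D : (ℤ → ℤ → ℤ → ℤ) → Prop} (hC : UnimodularClosed C)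
    (hD : UnimodularClosed D) : UnimodularClosed fun f => C f ∧ D f :=
  ⟨fun f h => ⟨hC.1 f h.1, hD.1 f h.2⟩, fun f h => ⟨hC.2 f h.1, hD.2 f h.2⟩,
    fun f h => ⟨hC.3 f h.1, hD.3 f h.2⟩, fun f h => ⟨hC.4 f h.1, hD.4 f h.2⟩⟩

theorem two_mul_mul_mul_le_halfDisc {a b c r s t : ℤ} (ha : 0 < a) (hab : a ≤ b) (hbc : b ≤ c)
    (ht : |t| ≤ a) (hs : |s| ≤ a) (hr : |r| ≤ b)
    (h₁ : 0 ≤ a + b + t + s + r) (h₂ : 0 ≤ a + b - t + s - r) (h₃ : 0 ≤ a + b - t - s + r)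
    (h₄ : 0 ≤ a + b + t - s - r) : 2 * (a * b * c) ≤ halfDisc a b c r s t := by
  have key : ∀ r s t : ℤ, 0 ≤ r → 0 ≤ s → 0 ≤ t → r ≤ b → s ≤ a → t ≤ a →
      0 ≤ 2 * (a * b * c) + r * s * t - a * r ^ 2 - b * s ^ 2 - c * t ^ 2 := by
    intro r s t hr hs ht hr' hs' ht'
    have e1 : 0 ≤ (c - b) * (2 * a * b - t ^ 2) :=
      mul_nonneg (by linarith) (by nlinarith)
    have e2 : 0 ≤ 2 * (a * b * b) + r * s * t - a * r ^ 2 - b * s ^ 2 - b * t ^ 2 := by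
      have h0 : 0 ≤ 2 * a * b - s ^ 2 - t ^ 2 := by nlinarith
      have hb : 0 ≤ a * b + s * t - s ^ 2 - t ^ 2 := by
        rcases le_total s t with h | h <;> nlinarith
      have := mul_nonneg (sub_nonneg.2 hr') h0
      have := mul_nonneg hr hb
      have := mul_nonneg (mul_nonneg ha.le hr) (sub_nonneg.2 hr')
      nlinarith
    nlinarith
  have key2 : ∀ r s t : ℤ, 0 ≤ r → 0 ≤ s → 0 ≤ t → r ≤ b → s ≤ a → t ≤ a → r + s + t ≤ a + b →
      0 ≤ 2 * (a * b * c) - r * s * t - a * r ^ 2 - b * s ^ 2 - c * t ^ 2 := by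
    intro r s t hr hs ht hr' hs' ht' hsum
    have e1 : 0 ≤ (c - b) * (2 * a * b - t ^ 2) :=
      mul_nonneg (by linarith) (by nlinarith)
    have e2 : 0 ≤ 2 * (a * b * b) - r * s * t - a * r ^ 2 - b * s ^ 2 - b * t ^ 2 := by
      have hst := mul_nonneg hs ht
      have hmono : ∀ r' : ℤ, r ≤ r' → r * s * t + a * r ^ 2 ≤ r' * s * t + a * r' ^ 2 := by
        intro r' h
        have := mul_nonneg (sub_nonneg.2 h) hst
        have := mul_nonneg (mul_nonneg (sub_nonneg.2 h) (by linarith : 0 ≤ r + r')) ha.le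
        nlinarith
      rcases le_total (s + t) a with h | h
      · have := hmono b hr'
        have h3 : 0 ≤ a * b - s * t - s ^ 2 - t ^ 2 := by nlinarith
        have := mul_nonneg (by linarith : 0 ≤ b) h3
        nlinarith
      · have := hmono (a + b - s - t) (by linarith)
        have hk : 0 ≤ s + t - a := by linarith
        have h4 : 0 ≤ (a - s) * (a - t) := mul_nonneg (by linarith) (by linarith)
        have h5 := mul_nonneg (by linarith : 0 ≤ b + (s + t - a)) h4
        have h6 : 0 ≤ b * (s + t - a) * (a - (s + t - a)) :=
          mul_nonneg (mul_nonneg (by linarith) hk) (by linarith)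
        have h7 : 0 ≤ a * b * (b - a) :=
          mul_nonneg (mul_nonneg ha.le (by linarith)) (by linarith)
        nlinarith
    nlinarith
  unfold halfDisc
  rcases abs_cases t with ⟨e, ht0⟩ | ⟨e, ht0⟩ <;> rcases abs_cases s with ⟨e', hs0⟩ | ⟨e', hs0⟩ <;>
    rcases abs_cases r with ⟨e'', hr0⟩ | ⟨e'', hr0⟩ <;> rw [e] at ht <;> rw [e'] at hs <;>
    rw [e''] at hr
  · nlinarith [key r s t hr0 hs0 ht0 hr hs ht]
  · nlinarith [key2 (-r) s t (by linarith) hs0 ht0 hr hs ht (by linarith)]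
  · nlinarith [key2 r (-s) t hr0 (by linarith) ht0 hr hs ht (by linarith)]
  · nlinarith [key (-r) (-s) t (by linarith) (by linarith) ht0 hr hs ht]
  · nlinarith [key2 r s (-t) hr0 hs0 (by linarith) hr hs ht (by linarith)]
  · nlinarith [key (-r) s (-t) (by linarith) hs0 (by linarith) hr hs ht]
  · nlinarith [key r (-s) (-t) hr0 (by linarith) (by linarith) hr hs ht]
  · nlinarith [key2 (-r) (-s) (-t) (by linarith) (by linarith) (by linarith) hr hs ht
      (by linarith)]

/-- A form in the class `C` of half-discriminant `H`. -/
def FormIn (C : (ℤ → ℤ → ℤ → ℤ) → Prop) (H a b c r s t : ℤ) : Prop :=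
  C (ternaryForm a b c r s t) ∧ halfDisc a b c r s t = H

section Moves

variable {C : (ℤ → ℤ → ℤ → ℤ) → Prop} {H a b c r s t : ℤ}

theorem FormIn.swap₁₂ (hC : UnimodularClosed C) (h : FormIn C H a b c r s t) :
    FormIn C H b a c s r t := by
  refine ⟨?_, by rw [← h.2]; unfold halfDisc; ring⟩
  convert hC.swap₁₂ _ h.1 using 1
  funext x y z; unfold ternaryForm; ring

theorem FormIn.swap₂₃ (hC : UnimodularClosed C) (h : FormIn C H a b c r s t) :
    FormIn C H a c b r t s := by
  refine ⟨?_, by rw [← h.2]; unfold halfDisc; ring⟩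
  convert hC.swap₂₃ _ h.1 using 1
  funext x y z; unfold ternaryForm; ring

theorem FormIn.neg (hC : UnimodularClosed C) (h : FormIn C H a b c r s t) :
    FormIn C H a b c r (-s) (-t) := by
  refine ⟨?_, by rw [← h.2]; unfold halfDisc; ring⟩
  convert hC.neg _ h.1 using 1
  funext x y z; unfold ternaryForm; ring

theorem FormIn.shear (hC : UnimodularClosed C) (h : FormIn C H a b c r s t) :
    FormIn C H a (a + b + t) c (r + s) s (t + 2 * a) := by
  refine ⟨?_, by rw [← h.2]; unfold halfDisc; ring⟩
  convert hC.shear _ h.1 using 1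
  funext x y z; unfold ternaryForm; ring

/-- The basis change `e₃ ↦ e₃ + e₁`. -/
theorem FormIn.shear₁₃ (hC : UnimodularClosed C) (h : FormIn C H a b c r s t) :
    FormIn C H a b (a + c + s) (r + t) (s + 2 * a) t :=
  ((h.swap₂₃ hC).shear hC).swap₂₃ hC

/-- The basis change `e₃ ↦ e₃ + e₂`. -/
theorem FormIn.shear₂₃ (hC : UnimodularClosed C) (h : FormIn C H a b c r s t) :
    FormIn C H a b (b + c + r) (r + 2 * b) (s + t) t :=
  ((h.swap₁₂ hC).shear₁₃ hC).swap₁₂ hC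

end Moves

/-- Every class of positive ternary forms contains a reduced form. -/
theorem exists_reduced_form {C : (ℤ → ℤ → ℤ → ℤ) → Prop} (hC : UnimodularClosed C)
    (hpos : ∀ f, C f → 0 < f 1 0 0) {H a₀ b₀ c₀ r₀ s₀ t₀ : ℤ}
    (h₀ : C (ternaryForm a₀ b₀ c₀ r₀ s₀ t₀)) (hH : halfDisc a₀ b₀ c₀ r₀ s₀ t₀ = H) :
    ∃ a b c r s t : ℤ, C (ternaryForm a b c r s t) ∧ halfDisc a b c r s t = H ∧
      0 < a ∧ a ≤ b ∧ b ≤ c ∧ |t| ≤ a ∧ |s| ≤ a ∧ |r| ≤ b ∧ 2 * (a * b * c) ≤ H := by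
  classical
  have pos₁ : ∀ {a b c r s t : ℤ}, FormIn C H a b c r s t → 0 < a := by
    intro a b c r s t h
    simpa [ternaryForm] using hpos _ h.1
  have pos₂ : ∀ {a b c r s t : ℤ}, FormIn C H a b c r s t → 0 < b :=
    fun h => pos₁ (h.swap₁₂ hC)
  have pos₃ : ∀ {a b c r s t : ℤ}, FormIn C H a b c r s t → 0 < c :=
    fun h => pos₂ (h.swap₂₃ hC)
  have hex : ∃ k : ℕ, ∃ a b c r s t : ℤ, FormIn C H a b c r s t ∧ a + b + c = k :=
    ⟨(a₀ + b₀ + c₀).toNat, a₀, b₀, c₀, r₀, s₀, t₀, ⟨h₀, hH⟩, by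
      have h : FormIn C H a₀ b₀ c₀ r₀ s₀ t₀ := ⟨h₀, hH⟩
      have := pos₁ h; have := pos₂ h; have := pos₃ h; omega⟩
  obtain ⟨a, b, c, r, s, t, h, hk⟩ := Nat.find_spec hex
  have hmin : ∀ a' b' c' r' s' t' : ℤ, FormIn C H a' b' c' r' s' t' → a + b + c ≤ a' + b' + c' := by
    intro a' b' c' r' s' t' h'
    have := pos₁ h'; have := pos₂ h'; have := pos₃ h'
    have := Nat.find_min' hex ⟨a', b', c', r', s', t', h',
      (Int.toNat_of_nonneg (by linarith : 0 ≤ a' + b' + c')).symm⟩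
    omega
  have hsort : ∃ a' b' c' r' s' t', FormIn C H a' b' c' r' s' t' ∧ a' + b' + c' = a + b + c ∧
      a' ≤ b' ∧ b' ≤ c' := by
    rcases le_total a b with h1 | h1 <;> rcases le_total b c with h2 | h2 <;>
      rcases le_total a c with h3 | h3
    · exact ⟨_, _, _, _, _, _, h, rfl, h1, h2⟩
    · exact ⟨_, _, _, _, _, _, h, rfl, h1, h2⟩
    · exact ⟨_, _, _, _, _, _, h.swap₂₃ hC, by ring, h3, h2⟩
    · exact ⟨_, _, _, _, _, _, (h.swap₂₃ hC).swap₁₂ hC, by ring, h3, h1⟩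
    · exact ⟨_, _, _, _, _, _, h.swap₁₂ hC, by ring, h1, h3⟩
    · exact ⟨_, _, _, _, _, _, (h.swap₁₂ hC).swap₂₃ hC, by ring, h2, h3⟩
    · exact ⟨_, _, _, _, _, _, ((h.swap₁₂ hC).swap₂₃ hC).swap₁₂ hC, by ring, h2, h1⟩
    · exact ⟨_, _, _, _, _, _, ((h.swap₁₂ hC).swap₂₃ hC).swap₁₂ hC, by ring, h2, h1⟩
  clear hk h
  obtain ⟨a', b', c', r, s, t, h, hs, hab, hbc⟩ := hsort
  rw [← hs] at hmin
  clear hs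
  have ha := pos₁ h
  have t1 := hmin _ _ _ _ _ _ (h.shear hC)
  have t2 := hmin _ _ _ _ _ _ ((h.neg hC).shear hC)
  have s1 := hmin _ _ _ _ _ _ (h.shear₁₃ hC)
  have s2 := hmin _ _ _ _ _ _ ((h.neg hC).shear₁₃ hC)
  have hn := ((h.swap₁₂ hC).neg hC).swap₁₂ hC
  have r1 := hmin _ _ _ _ _ _ (h.shear₂₃ hC)
  have r2 := hmin _ _ _ _ _ _ (hn.shear₂₃ hC)
  have q1 := hmin _ _ _ _ _ _ ((h.shear₁₃ hC).shear₂₃ hC)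
  have q2 := hmin _ _ _ _ _ _ (((h.neg hC).shear₁₃ hC).shear₂₃ hC)
  have q3 := hmin _ _ _ _ _ _ ((hn.shear₁₃ hC).shear₂₃ hC)
  have q4 := hmin _ _ _ _ _ _ (((hn.neg hC).shear₁₃ hC).shear₂₃ hC)
  have ht : |t| ≤ a' := abs_le.2 ⟨by linarith, by linarith⟩
  have hs : |s| ≤ a' := abs_le.2 ⟨by linarith, by linarith⟩
  have hr : |r| ≤ b' := abs_le.2 ⟨by linarith, by linarith⟩
  exact ⟨a', b', c', r, s, t, h.1, h.2, ha, hab, hbc, ht, hs, hr, by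
    rw [← h.2]
    exact two_mul_mul_mul_le_halfDisc ha hab hbc ht hs hr (by linarith) (by linarith)
      (by linarith) (by linarith)⟩

/-- Positive definiteness. -/
def PosOn (f : ℤ → ℤ → ℤ → ℤ) : Prop := ∀ x y z, (x ≠ 0 ∨ y ≠ 0 ∨ z ≠ 0) → 0 < f x y z

theorem unimodularClosed_posOn : UnimodularClosed PosOn where
  swap₁₂ f h x y z hx := h y x z (by tauto)
  swap₂₃ f h x y z hx := h x z y (by tauto)
  neg f h x y z hx := h (-x) y z (by simpa using hx)
  shear f h x y z hx := h (x + y) y z (by by_contra hc; push Not at hc; omega)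

theorem posOn_ternaryForm {a b c r s t : ℤ} (ha : 0 < a) (hD : 0 < 4 * a * b - t ^ 2)
    (hh : 0 < halfDisc a b c r s t) : PosOn (ternaryForm a b c r s t) := by
  intro x y z hx
  have key : 4 * a * (4 * a * b - t ^ 2) * ternaryForm a b c r s t x y z =
      (4 * a * b - t ^ 2) * (2 * a * x + t * y + s * z) ^ 2 +
      ((4 * a * b - t ^ 2) * y + (2 * a * r - t * s) * z) ^ 2 +
      4 * a * halfDisc a b c r s t * z ^ 2 := by
    unfold ternaryForm halfDisc; ring
  have h4 : 0 < 4 * a * (4 * a * b - t ^ 2) := by positivity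
  refine pos_of_mul_pos_right ?_ h4.le
  rw [key]
  rcases eq_or_ne z 0 with rfl | hz
  · rcases eq_or_ne y 0 with rfl | hy
    · have : x ≠ 0 := by simpa using hx
      simp only [mul_zero, add_zero]
      positivity
    · simp only [mul_zero, add_zero]
      have := mul_nonneg hD.le (sq_nonneg (2 * a * x + t * y))
      have : (4 * a * b - t ^ 2) * y ≠ 0 := mul_ne_zero hD.ne' hy
      positivity
  · have := mul_nonneg hD.le (sq_nonneg (2 * a * x + t * y + s * z))
    positivity

/-- The coordinates have no common divisor. -/
def Primitive₃ (x y z : ℤ) : Prop := ∀ k : ℤ, k ∣ x → k ∣ y → k ∣ z → k ∣ 1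

/-- `f` takes the value `n` at a primitive vector. -/
def PrimRep (n : ℤ) (f : ℤ → ℤ → ℤ → ℤ) : Prop := ∃ x y z, f x y z = n ∧ Primitive₃ x y z

theorem unimodularClosed_primRep (n : ℤ) : UnimodularClosed (PrimRep n) where
  swap₁₂ f := fun ⟨x, y, z, h, hp⟩ => ⟨y, x, z, h, fun k h1 h2 h3 => hp k h2 h1 h3⟩
  swap₂₃ f := fun ⟨x, y, z, h, hp⟩ => ⟨x, z, y, h, fun k h1 h2 h3 => hp k h1 h3 h2⟩
  neg f := fun ⟨x, y, z, h, hp⟩ => ⟨-x, y, z, by simpa using h, fun k h1 h2 h3 =>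
    hp k (by simpa using h1) h2 h3⟩
  shear f := fun ⟨x, y, z, h, hp⟩ => ⟨x - y, y, z, by simpa using h, fun k h1 h2 h3 =>
    hp k (by simpa using dvd_add h1 h2) h2 h3⟩

/-- The polar form is even. -/
def EvenPolar (f : ℤ → ℤ → ℤ → ℤ) : Prop :=
  ∀ x y z u v w, 2 ∣ f (x + u) (y + v) (z + w) - f x y z - f u v w

theorem unimodularClosed_evenPolar : UnimodularClosed EvenPolar where
  swap₁₂ f h x y z u v w := h y x z v u w
  swap₂₃ f h x y z u v w := h x z y u w v
  neg f h x y z u v w := by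
    have := h (-x) y z (-u) v w
    simpa only [neg_add] using this
  shear f h x y z u v w := by
    have := h (x + y) y z (u + v) v w
    rwa [add_add_add_comm] at this

theorem primRep_ternaryForm (a b c r s t : ℤ) : PrimRep a (ternaryForm a b c r s t) :=
  ⟨1, 0, 0, by simp [ternaryForm], fun _ h _ _ => h⟩

open scoped NumberTheorySymbols

theorem jacobiSym_congr {a : ℤ} {b b' : ℕ} (hb : Odd b) (hb' : Odd b')
    (h : b ≡ b' [MOD 4 * a.natAbs]) : J(a | b) = J(a | b') := by
  rw [jacobiSym.mod_right a hb, jacobiSym.mod_right a hb', h]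

theorem odd_of_modEq {a b M : ℕ} (h : a ≡ b [MOD M]) (hM : 2 ∣ M) (hb : Odd b) : Odd a := by
  rw [Nat.odd_iff] at hb ⊢
  exact Eq.trans (h.of_dvd hM) hb

theorem exists_dvd_add_mul_sq {p : ℕ} (hp : p.Prime) {m k : ℤ} (h : J(-(m * k) | p) = 1) :
    ∃ r : ℤ, (p : ℤ) ∣ k + m * r ^ 2 := by
  have := Fact.mk hp
  obtain ⟨y, hy⟩ := ZMod.isSquare_of_jacobiSym_eq_one h
  have hm : (m : ZMod p) ≠ 0 := by
    intro hm
    rw [← jacobiSym.legendreSym.to_jacobiSym] at h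
    have : ((-(m * k) : ℤ) : ZMod p) = 0 := by push_cast; rw [hm]; ring
    rw [(legendreSym.eq_zero_iff p _).2 this] at h
    exact zero_ne_one h
  refine ⟨((y / m : ZMod p)).val, ?_⟩
  rw [← ZMod.intCast_zmod_eq_zero_iff_dvd]
  push_cast at hy ⊢
  rw [ZMod.natCast_zmod_val, div_pow, mul_div_assoc', sq y, ← hy]
  field_simp
  ring

/-- A reduced form of half-discriminant `H` representing the positive integer `n`. -/
theorem exists_reduced_primRep {n b c r s H : ℤ} (hn : 0 < n) (hb : 0 < b) (hH : 0 < H)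
    (h : halfDisc n b c r s 0 = H) :
    ∃ a b c r s t : ℤ, PrimRep n (ternaryForm a b c r s t) ∧ halfDisc a b c r s t = H ∧
      0 < a ∧ a ≤ b ∧ b ≤ c ∧ |t| ≤ a ∧ |s| ≤ a ∧ |r| ≤ b ∧ 2 * (a * b * c) ≤ H := by
  obtain ⟨a, b, c, r, s, t, h1, h2⟩ := exists_reduced_form
    (unimodularClosed_posOn.and (unimodularClosed_primRep n)) (fun f hf => hf.1 1 0 0 (by simp))
    ⟨posOn_ternaryForm hn (by simp; positivity) (h ▸ hH), primRep_ternaryForm n b c r s 0⟩ h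
  exact ⟨a, b, c, r, s, t, h1.2, h2⟩

theorem exists_sum_three_squares_aux {n b c r : ℤ} (hn : 0 < n) (hb : 0 < b)
    (h : b * (n * c - 1) = 1 + n * r ^ 2) : PrimRep n fun x y z => x ^ 2 + y ^ 2 + z ^ 2 := by
  have hh : halfDisc n b c (2 * r) 2 0 = 4 := by unfold halfDisc; linear_combination 4 * h
  obtain ⟨a, b, c, r, s, t, ⟨⟨-, hrep⟩, hev⟩, hd, ha, hab, hbc, ht, hs, hr, habc⟩ :=
    exists_reduced_form
    ((unimodularClosed_posOn.and (unimodularClosed_primRep n)).and unimodularClosed_evenPolar)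
    (fun f hf => hf.1.1 1 0 0 (by simp))
    ⟨⟨posOn_ternaryForm hn (by simp; positivity) (hh ▸ by norm_num),
      primRep_ternaryForm n b c (2 * r) 2 0⟩, fun x y z u v w => by
        unfold ternaryForm
        exact ⟨n * x * u + b * y * v + c * z * w + r * (y * w + v * z) + x * w + u * z, by ring⟩⟩ hh
  have hte : 2 ∣ t := by have := hev 1 0 0 0 1 0; simp [ternaryForm] at this; omega
  have hse : 2 ∣ s := by have := hev 1 0 0 0 0 1; simp [ternaryForm] at this; omega
  have hre : 2 ∣ r := by have := hev 0 1 0 0 0 1; simp [ternaryForm] at this; omega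
  have ha1 : a = 1 := by
    by_contra hne
    have : 2 ≤ a := by omega
    have : 2 * 2 * 2 ≤ a * b * c := by
      have : 2 ≤ b := by omega
      have : 2 ≤ c := by omega
      gcongr
    omega
  subst ha1
  have hb1 : b = 1 := by
    by_contra hne
    have : 1 * 2 * 2 ≤ 1 * b * c := by
      have : 2 ≤ b := by omega
      have : 2 ≤ c := by omega
      gcongr
    omega
  subst hb1
  rw [abs_le] at ht hs hr
  obtain rfl : t = 0 := by omega
  obtain rfl : s = 0 := by omega
  obtain rfl : r = 0 := by omega
  obtain rfl : c = 1 := by unfold halfDisc at hd; omega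
  convert hrep using 4
  unfold ternaryForm; ring

/-- **Three squares**, with a primitive representation. -/
theorem exists_sum_three_squares {n : ℕ} (hn : 0 < n) (h4 : n % 4 ≠ 0) (h8 : n % 8 ≠ 7) :
    PrimRep n fun x y z => x ^ 2 + y ^ 2 + z ^ 2 := by
  have hnz : (0 : ℤ) < n := by exact_mod_cast hn
  by_cases h2 : n % 4 = 2
  · have hodd : Odd (n - 1) := by rw [Nat.odd_iff]; omega
    have hcop : (n - 1).Coprime (4 * n) := by
      refine Nat.Coprime.mul_right ?_ ?_
      · exact (Nat.coprime_two_right.2 hodd).pow_right 2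
      · exact (Nat.coprime_self_sub_left (by omega)).2 (Nat.coprime_one_left n)
    obtain ⟨p, -, hp, hpm⟩ := Nat.forall_exists_prime_gt_and_modEq 2 (by omega) hcop
    have hpo : Odd p := odd_of_modEq hpm (by omega) hodd
    obtain ⟨c, hc⟩ : (n : ℤ) ∣ p + 1 := by
      have h1 := (Nat.modEq_iff_dvd.1 hpm.symm)
      have h2 : (n : ℤ) ∣ p - (n - 1 : ℕ) := dvd_trans ⟨4, by push_cast; ring⟩ h1
      have := dvd_add h2 (dvd_refl (n : ℤ))
      rwa [show (p : ℤ) - (n - 1 : ℕ) + n = p + 1 by omega] at this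
    have hJ : J(-(n * 1) | p) = 1 := by
      rw [jacobiSym_congr hpo hodd (by simpa using hpm),
        jacobiSym.mod_left' (show (-((n : ℤ) * 1)) % (n - 1 : ℕ) = (-1) % (n - 1 : ℕ) from
          Int.ModEq.symm (Int.modEq_iff_dvd.2 ⟨-1, by push_cast [show 1 ≤ n from hn]; ring⟩)),
        jacobiSym.at_neg_one hodd]
      exact ZMod.χ₄_nat_one_mod_four (by omega)
    obtain ⟨r, b, hb⟩ := exists_dvd_add_mul_sq hp hJ
    have hp0 : (0 : ℤ) < p := by exact_mod_cast hp.pos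
    have hb0 : 0 < b := pos_of_mul_pos_right (hb ▸ by positivity) hp0.le
    exact exists_sum_three_squares_aux hnz hb0 (c := c) (r := r) (by rw [← hc, hb]; ring)
  · obtain ⟨p₀, c₀, hp₀, hpodd, hJ⟩ : ∃ p₀ c₀ : ℕ, 2 * p₀ + 1 = c₀ * n ∧ Odd p₀ ∧
        J(-(n * 1) | p₀) = 1 := by
      by_cases h3 : n % 8 = 3
      · have hodd : Odd ((n - 1) / 2) := by rw [Nat.odd_iff]; omega
        refine ⟨(n - 1) / 2, 1, by omega, hodd, ?_⟩
        rw [jacobiSym.mod_left' (show (-((n : ℤ) * 1)) % ((n - 1) / 2 : ℕ) =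
          (-1) % ((n - 1) / 2 : ℕ) from Int.ModEq.symm (Int.modEq_iff_dvd.2 ⟨-2, by omega⟩)),
          jacobiSym.at_neg_one hodd]
        exact ZMod.χ₄_nat_one_mod_four (by omega)
      · have hodd : Odd ((3 * n - 1) / 2) := by rw [Nat.odd_iff]; omega
        refine ⟨(3 * n - 1) / 2, 3, by omega, hodd, ?_⟩
        have h1 : J(3 | (3 * n - 1) / 2) * J(-(n * 1) | (3 * n - 1) / 2) =
            ZMod.χ₄ ((3 * n - 1) / 2 : ℕ) := by
          rw [← jacobiSym.mul_left, jacobiSym.mod_left' (show (3 * -((n : ℤ) * 1)) %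
            ((3 * n - 1) / 2 : ℕ) = (-1) % ((3 * n - 1) / 2 : ℕ) from
            Int.ModEq.symm (Int.modEq_iff_dvd.2 ⟨-2, by omega⟩)), jacobiSym.at_neg_one hodd]
        by_cases h5 : n % 8 = 1
        · rw [ZMod.χ₄_nat_one_mod_four (by omega), jacobiSym.mod_right _ hodd,
            show (3 * n - 1) / 2 % (4 * Int.natAbs 3) = 1 by simp; omega,
            jacobiSym.one_right, one_mul] at h1
          exact h1
        · rw [ZMod.χ₄_nat_three_mod_four (by omega), jacobiSym.mod_right _ hodd,
            show (3 * n - 1) / 2 % (4 * Int.natAbs 3) = 7 by simp; omega,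
            show J(3 | 7) = -1 by norm_num] at h1
          linarith
    have hcop : p₀.Coprime (4 * n) := by
      refine Nat.Coprime.mul_right ((Nat.coprime_two_right.2 hpodd).pow_right 2) ?_
      rw [← Nat.isCoprime_iff_coprime]
      exact ⟨-2, c₀, by linarith [(by exact_mod_cast hp₀ : (2 * p₀ + 1 : ℤ) = c₀ * n)]⟩
    obtain ⟨p, -, hp, hpm⟩ := Nat.forall_exists_prime_gt_and_modEq 2 (by omega) hcop
    have hpo : Odd p := odd_of_modEq hpm (by omega) hpodd
    obtain ⟨c, hc⟩ : (n : ℤ) ∣ 2 * p + 1 := by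
      have h1 := (Nat.modEq_iff_dvd.1 hpm.symm)
      have h2 : (n : ℤ) ∣ p - p₀ := dvd_trans ⟨4, by push_cast; ring⟩ h1
      have := dvd_add (h2.mul_left 2) (Dvd.intro_left (c₀ : ℤ) rfl : (n : ℤ) ∣ c₀ * n)
      rwa [← (by exact_mod_cast hp₀ : (2 * p₀ + 1 : ℤ) = c₀ * n),
        show (2 : ℤ) * (p - p₀) + (2 * p₀ + 1) = 2 * p + 1 by ring] at this
    obtain ⟨r, hr⟩ := exists_dvd_add_mul_sq hp ((jacobiSym_congr hpo hpodd
      (by simpa using hpm)).trans hJ)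
    obtain ⟨r', hr', hrodd⟩ : ∃ r' : ℤ, (p : ℤ) ∣ 1 + n * r' ^ 2 ∧ r' % 2 = 1 := by
      by_cases hr2 : r % 2 = 1
      · exact ⟨r, hr, hr2⟩
      · refine ⟨r + p, ?_, by obtain ⟨k, rfl⟩ := hpo; omega⟩
        rw [show 1 + (n : ℤ) * (r + p) ^ 2 = 1 + n * r ^ 2 + p * (n * (2 * r + p)) by ring]
        exact dvd_add hr (dvd_mul_right _ _)
    obtain ⟨b, hb⟩ : (2 * p : ℤ) ∣ 1 + n * r' ^ 2 := by
      refine IsCoprime.mul_dvd ?_ ?_ hr'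
      · exact_mod_cast (Nat.isCoprime_iff_coprime (m := 2)).2 (Nat.coprime_two_left.2 hpo)
      · have : (n : ℤ) % 2 = 1 := by omega
        have : ((n : ℤ) * r' ^ 2) % 2 = 1 := by simp [pow_two, Int.mul_emod, this, hrodd]
        omega
    have hp0 : (0 : ℤ) < 2 * p := by exact_mod_cast (by linarith [hp.pos] : 0 < 2 * p)
    have hb0 : 0 < b := pos_of_mul_pos_right (hb ▸ by positivity) hp0.le
    exact exists_sum_three_squares_aux hnz hb0 (c := c) (r := r') (by rw [← hc, hb]; ring)

/-- For primes `D ≡ -k (mod 4 m)` one can solve `b D = q + m r²`. -/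
theorem exists_prime_mul_eq {m k M : ℕ} {q : ℤ} (D₀ : ℕ) (hm : 0 < m) (hM : 0 < M)
    (hD : (m : ℤ) * 4 ∣ D₀ + k) (hmM : 4 * m ∣ M) (hcop : D₀.Coprime M)
    (hJ : ∀ D : ℕ, D ≡ D₀ [MOD M] → J(-(m * q) | D) = 1) (hq : 0 < q) :
    ∃ b c r : ℤ, 0 < b ∧ b * (4 * m * c - k) = q + m * r ^ 2 := by
  obtain ⟨p, -, hp, hpm⟩ := Nat.forall_exists_prime_gt_and_modEq 2 hM.ne' hcop
  obtain ⟨r, b, hb⟩ := exists_dvd_add_mul_sq hp (hJ p hpm)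
  have hp0 : (0 : ℤ) < p := by exact_mod_cast hp.pos
  have hb0 : 0 < b := pos_of_mul_pos_right (hb ▸ by positivity) hp0.le
  obtain ⟨c, hc⟩ : (m : ℤ) * 4 ∣ p + k := by
    have h1 : (m : ℤ) * 4 ∣ p - D₀ := by
      refine dvd_trans ?_ (Nat.modEq_iff_dvd.1 hpm.symm)
      rw [mul_comm]
      exact_mod_cast hmM
    have := dvd_add h1 hD
    rwa [show (p : ℤ) - D₀ + (D₀ + k) = p + k by ring] at this
  exact ⟨b, c, r, hb0, by rw [show 4 * (m : ℤ) * c - k = p by linarith, hb]; ring⟩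

theorem jacobiSym_four_mul_sub_one {m D : ℕ} (hm : 0 < m) (h : D ≡ 4 * m - 1 [MOD 4 * m]) :
    J(m | D) = 1 := by
  have ho : Odd (4 * m - 1) := by rw [Nat.odd_iff]; omega
  have hD : Odd D := odd_of_modEq h (by omega) ho
  rw [jacobiSym_congr hD ho (by simpa using h)]
  have h1 : J(4 * m | 4 * m - 1) = 1 := by
    rw [jacobiSym.mod_left' (a₂ := 1), jacobiSym.one_left]
    exact Int.ModEq.symm (Int.modEq_iff_dvd.2 ⟨1, by push_cast [show 1 ≤ 4 * m by omega]; ring⟩)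
  rwa [jacobiSym.mul_left, jacobiSym.at_four ho, one_mul] at h1

theorem jacobiSym_four_mul_sub {m k D : ℕ} (hk : k < 4 * m) (hk' : Odd k)
    (h : D ≡ 4 * m - k [MOD 4 * m]) : J(-(m * 1) | D) = J(-k | 4 * m - k) := by
  have ho : Odd (4 * m - k) := by rw [Nat.odd_iff] at *; omega
  have hD : Odd D := odd_of_modEq h (by omega) ho
  rw [jacobiSym_congr hD ho (by simpa using h)]
  have h1 : J(4 * -(m * 1) | 4 * m - k) = J(-k | 4 * m - k) := by
    apply jacobiSym.mod_left'
    exact Int.ModEq.symm (Int.modEq_iff_dvd.2 ⟨-1, by push_cast [hk.le]; ring⟩)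
  rwa [jacobiSym.mul_left, jacobiSym.at_four ho, one_mul] at h1

/-- For `q ∈ {3, 5}` and `n` prime to `q`, a form of half-discriminant `q` represents `n`. -/
theorem exists_halfDisc_eq_of_coprime {n q e : ℕ} (hn : 0 < n) (hq : 1 < q) (hq2 : Odd q)
    (hcop : q.Coprime n) (hqe : q.Coprime e)
    (hJ : ∀ D : ℕ, D % 4 = 3 → D % q = e % q → J(-q | D) = 1) :
    ∃ b c r : ℤ, 0 < b ∧ halfDisc n b c r 1 0 = q := by
  have hc4 : (4 * n).Coprime q :=
    Nat.Coprime.mul_left ((Nat.coprime_two_left.2 hq2).pow_left 2) hcop.symm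
  obtain ⟨D₀, hD₀, hD₀'⟩ := Nat.chineseRemainder hc4 (4 * n - 1) e
  have hodd : Odd D₀ := odd_of_modEq hD₀ (by omega) (by rw [Nat.odd_iff]; omega)
  have hcop' : D₀.Coprime (4 * n * q) := by
    refine Nat.Coprime.mul_right ?_ ?_
    · rw [Nat.coprime_iff_gcd_eq_one, hD₀.gcd_eq]
      exact (Nat.coprime_self_sub_left (by omega)).2 (Nat.coprime_one_left _)
    · rw [Nat.coprime_iff_gcd_eq_one, hD₀'.gcd_eq]
      exact hqe.symm
  obtain ⟨b, c, r, hb, h⟩ := exists_prime_mul_eq (m := n) (k := 1) (M := 4 * n * q) (q := q) D₀ hn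
    (by positivity) (by
      have := Nat.modEq_iff_dvd.1 hD₀.symm
      push_cast [show 1 ≤ 4 * n by omega] at this ⊢
      have := dvd_add this (dvd_refl (4 * (n : ℤ)))
      rw [mul_comm]
      rwa [show (D₀ : ℤ) - (4 * n - 1) + 4 * n = D₀ + 1 by ring] at this) (dvd_mul_right _ _) hcop' (by
      intro D hD
      have h1 := (hD.of_dvd (dvd_mul_right (4 * n) q)).trans hD₀
      have h2 := (hD.of_dvd (dvd_mul_left q (4 * n))).trans hD₀'
      rw [show -((n : ℤ) * q) = n * (-q) by ring, jacobiSym.mul_left,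
        jacobiSym_four_mul_sub_one hn h1, one_mul]
      refine hJ D ?_ h2
      have := h1.of_dvd (dvd_mul_right 4 n)
      unfold Nat.ModEq at this
      omega) (by omega)
  exact ⟨b, c, r, hb, by unfold halfDisc; push_cast at h; linear_combination h⟩

/-- A form of half-discriminant `q` representing `q m`. -/
theorem exists_halfDisc_eq_of_dvd {m q : ℕ} (hm : 0 < m) (hq : q < 4 * m) (hq2 : Odd q)
    (hcop : q.Coprime m) (hJ : J(-q | 4 * m - q) = 1) :
    ∃ b c r : ℤ, 0 < b ∧ halfDisc (q * m) b c r q 0 = q := by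
  have hodd : Odd (4 * m - q) := by rw [Nat.odd_iff] at *; omega
  obtain ⟨b, c, r, hb, h⟩ := exists_prime_mul_eq (m := m) (k := q) (M := 4 * m) (q := 1)
    (4 * m - q) hm (by positivity) ⟨1, by push_cast [hq.le]; ring⟩ (dvd_refl _)
    ((Nat.coprime_self_sub_left hq.le).2
      (Nat.Coprime.mul_right ((Nat.coprime_two_right.2 hq2).pow_right 2) hcop))
    (fun D hD => (jacobiSym_four_mul_sub hq hq2 hD).trans hJ) one_pos
  exact ⟨b, c, r, hb, by unfold halfDisc; linear_combination (q : ℤ) * h⟩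

theorem exists_one_one_three_of_loeschian {n x y z : ℤ} (h : x ^ 2 + x * y + y ^ 2 + z ^ 2 = n)
    (hp : Primitive₃ x y z) : PrimRep n fun x y z => x ^ 2 + y ^ 2 + 3 * z ^ 2 := by
  have key : ∀ x w z : ℤ, x ^ 2 + x * (2 * w) + (2 * w) ^ 2 + z ^ 2 = n → Primitive₃ x (2 * w) z →
      PrimRep n fun x y z => x ^ 2 + y ^ 2 + 3 * z ^ 2 := fun x w z h hp =>
    ⟨x + w, z, w, by linear_combination h, fun k h1 h2 h3 =>
      hp k ((Int.dvd_add_left h3).1 h1) (h3.mul_left 2) h2⟩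
  rcases Int.even_or_odd' y with ⟨w, rfl | hy⟩
  · exact key x w z h hp
  · rcases Int.even_or_odd' x with ⟨v, rfl | hx⟩
    · exact key y v z (by linear_combination h) fun k h1 h2 h3 => hp k h2 h1 h3
    · refine key (-y) (v + w + 1) z (by rw [← h, hx, hy]; ring) fun k h1 h2 h3 => ?_
      have h2' : k ∣ x + y := by rwa [show x + y = 2 * (v + w + 1) by rw [hx, hy]; ring]
      rw [dvd_neg] at h1
      exact hp k ((Int.dvd_add_left h1).1 h2') h1 h3

/-- Primitive representations by `x² + y² + 3 z²`. -/
theorem exists_one_one_three {n : ℕ} (hn : 0 < n)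
    (h : n % 3 ≠ 0 ∨ n % 9 = 3) : PrimRep n fun x y z => x ^ 2 + y ^ 2 + 3 * z ^ 2 := by
  have hnz : (0 : ℤ) < n := by exact_mod_cast hn
  obtain ⟨b, c, r, s, hb, hd⟩ : ∃ b c r s : ℤ, 0 < b ∧ halfDisc n b c r s 0 = 3 := by
    by_cases h3 : n % 3 = 0
    · obtain ⟨m, rfl⟩ := Nat.dvd_of_mod_eq_zero h3
      obtain ⟨b, c, r, h⟩ := exists_halfDisc_eq_of_dvd (m := m) (q := 3) (by omega) (by omega)
        (by decide) (by rw [Nat.prime_three.coprime_iff_not_dvd]; omega) (by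
          rw [jacobiSym.mod_right _ (by rw [Nat.odd_iff]; omega),
            show (4 * m - 3) % (4 * Int.natAbs (-(3 : ℕ))) = 1 by simp; omega,
            jacobiSym.one_right])
      exact ⟨b, c, r, 3, by exact_mod_cast h⟩
    · obtain ⟨b, c, r, h⟩ := exists_halfDisc_eq_of_coprime (n := n) (q := 3) (e := 1) hn (by omega)
        (by decide) (by rw [Nat.prime_three.coprime_iff_not_dvd]; omega) (by decide) (by
          intro D h1 h2
          rw [jacobiSym.mod_right _ (by rw [Nat.odd_iff]; omega),
            show D % (4 * Int.natAbs (-(3 : ℕ))) = 7 by simp; omega]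
          norm_num)
      exact ⟨b, c, r, 1, by exact_mod_cast h⟩
  obtain ⟨a, b, c, r, s, t, ⟨x, y, z, hrep, hp⟩, hd, ha, hab, hbc, ht, hs, hr, habc⟩ :=
    exists_reduced_primRep hnz hb (by norm_num) hd
  have hc1 : c = 1 := by
    by_contra hne
    have : 1 * 1 * 2 ≤ a * b * c := by
      have : 1 ≤ b := by omega
      have : 2 ≤ c := by omega
      gcongr
      omega
    omega
  obtain rfl : b = 1 := by omega
  obtain rfl : a = 1 := by omega
  subst hc1
  rw [abs_le] at ht hs hr
  obtain ⟨t1, t2⟩ := ht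
  obtain ⟨s1, s2⟩ := hs
  obtain ⟨r1, r2⟩ := hr
  have hpn : Primitive₃ x (-y) z := fun k h1 h2 h3 => hp k h1 (by simpa using h2) h3
  have hpx : Primitive₃ (-x) y z := fun k h1 h2 h3 => hp k (by simpa using h1) h2 h3
  unfold ternaryForm at hrep
  unfold halfDisc at hd
  interval_cases t <;> interval_cases s <;> interval_cases r <;> norm_num at hd
  · exact exists_one_one_three_of_loeschian (by linear_combination hrep) hpx
  · exact exists_one_one_three_of_loeschian (x := -x) (y := z) (z := y)
      (by linear_combination hrep) fun k h1 h2 h3 => hpx k h1 h3 h2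
  · exact exists_one_one_three_of_loeschian (x := -y) (y := z) (z := x)
      (by linear_combination hrep) fun k h1 h2 h3 => hpn k h3 h1 h2
  · exact exists_one_one_three_of_loeschian (x := y) (y := z) (z := x)
      (by linear_combination hrep) fun k h1 h2 h3 => hp k h3 h1 h2
  · exact exists_one_one_three_of_loeschian (x := x) (y := z) (z := y)
      (by linear_combination hrep) fun k h1 h2 h3 => hp k h1 h3 h2
  · exact exists_one_one_three_of_loeschian (by linear_combination hrep) hp

/-- Primitive representations by `x² + y² + 2 z² + x y + y z + x z`. -/
theorem exists_halfDisc_five {n : ℕ} (hn : 0 < n)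
    (h : n % 5 ≠ 0 ∨ n % 25 = 10 ∨ n % 25 = 15) :
    PrimRep n fun x y z => x ^ 2 + y ^ 2 + 2 * z ^ 2 + x * y + y * z + x * z := by
  have hnz : (0 : ℤ) < n := by exact_mod_cast hn
  obtain ⟨b, c, r, s, hb, hd⟩ : ∃ b c r s : ℤ, 0 < b ∧ halfDisc n b c r s 0 = 5 := by
    by_cases h5 : n % 5 = 0
    · obtain ⟨m, rfl⟩ := Nat.dvd_of_mod_eq_zero h5
      obtain ⟨b, c, r, h⟩ := exists_halfDisc_eq_of_dvd (m := m) (q := 5) (by omega) (by omega)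
        (by decide) (by rw [Nat.prime_five.coprime_iff_not_dvd]; omega) (by
          rw [jacobiSym.mod_right _ (by rw [Nat.odd_iff]; omega)]
          rcases (by simp; omega : (4 * m - 5) % (4 * Int.natAbs (-(5 : ℕ))) = 3 ∨
            (4 * m - 5) % (4 * Int.natAbs (-(5 : ℕ))) = 7) with h | h <;> rw [h] <;> norm_num)
      exact ⟨b, c, r, 5, by exact_mod_cast h⟩
    · obtain ⟨b, c, r, h⟩ := exists_halfDisc_eq_of_coprime (n := n) (q := 5) (e := 2) hn (by omega)
        (by decide) (by rw [Nat.prime_five.coprime_iff_not_dvd]; omega) (by decide) (by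
          intro D h1 h2
          rw [jacobiSym.mod_right _ (by rw [Nat.odd_iff]; omega),
            show D % (4 * Int.natAbs (-(5 : ℕ))) = 7 by simp; omega]
          norm_num)
      exact ⟨b, c, r, 1, by exact_mod_cast h⟩
  obtain ⟨a, b, c, r, s, t, ⟨x, y, z, hrep, hp⟩, hd, ha, hab, hbc, ht, hs, hr, habc⟩ :=
    exists_reduced_primRep hnz hb (by norm_num) hd
  have hb1 : b = 1 := by
    by_contra hne
    have : 1 * 2 * 2 ≤ a * b * c := by
      have : 2 ≤ b := by omega
      have : 2 ≤ c := by omega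
      gcongr
      omega
    omega
  subst hb1
  obtain rfl : a = 1 := by omega
  have hc2 : c ≤ 2 := by omega
  rw [abs_le] at ht hs hr
  obtain ⟨t1, t2⟩ := ht
  obtain ⟨s1, s2⟩ := hs
  obtain ⟨r1, r2⟩ := hr
  unfold ternaryForm at hrep
  unfold halfDisc at hd
  have key : ∀ u v w : ℤ, u ^ 2 + v ^ 2 + 2 * w ^ 2 + u * v + v * w + u * w = n →
      (∀ k : ℤ, k ∣ u → k ∣ v → k ∣ w → k ∣ x ∧ k ∣ y ∧ k ∣ z) →
      PrimRep n fun x y z => x ^ 2 + y ^ 2 + 2 * z ^ 2 + x * y + y * z + x * z :=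
    fun u v w h1 h2 => ⟨u, v, w, h1, fun k ha hb hc =>
      hp k (h2 k ha hb hc).1 (h2 k ha hb hc).2.1 (h2 k ha hb hc).2.2⟩
  interval_cases c <;> interval_cases t <;> interval_cases s <;> interval_cases r <;>
    norm_num at hd
  · exact key (-x + z) y (-z) (by linear_combination hrep) fun k ⟨d, h1⟩ ⟨e, h2⟩ ⟨f, h3⟩ =>
      ⟨⟨-d - f, by linarith⟩, ⟨e, by linarith⟩, ⟨-f, by linarith⟩⟩
  · exact key (-x) y z (by linear_combination hrep) fun k ⟨d, h1⟩ ⟨e, h2⟩ ⟨f, h3⟩ =>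
      ⟨⟨-d, by linarith⟩, ⟨e, by linarith⟩, ⟨f, by linarith⟩⟩
  · exact key (-x) (y - z) z (by linear_combination hrep) fun k ⟨d, h1⟩ ⟨e, h2⟩ ⟨f, h3⟩ =>
      ⟨⟨-d, by linarith⟩, ⟨e + f, by linarith⟩, ⟨f, by linarith⟩⟩
  · exact key (-x) (y + z) (-z) (by linear_combination hrep) fun k ⟨d, h1⟩ ⟨e, h2⟩ ⟨f, h3⟩ =>
      ⟨⟨-d, by linarith⟩, ⟨e + f, by linarith⟩, ⟨-f, by linarith⟩⟩
  · exact key (-x) y (-z) (by linear_combination hrep) fun k ⟨d, h1⟩ ⟨e, h2⟩ ⟨f, h3⟩ =>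
      ⟨⟨-d, by linarith⟩, ⟨e, by linarith⟩, ⟨-f, by linarith⟩⟩
  · exact key (-x - z) y z (by linear_combination hrep) fun k ⟨d, h1⟩ ⟨e, h2⟩ ⟨f, h3⟩ =>
      ⟨⟨-d - f, by linarith⟩, ⟨e, by linarith⟩, ⟨f, by linarith⟩⟩
  · exact key (-x) (-y) z (by linear_combination hrep) fun k ⟨d, h1⟩ ⟨e, h2⟩ ⟨f, h3⟩ =>
      ⟨⟨-d, by linarith⟩, ⟨-e, by linarith⟩, ⟨f, by linarith⟩⟩
  · exact key (-x - y) y z (by linear_combination hrep) fun k ⟨d, h1⟩ ⟨e, h2⟩ ⟨f, h3⟩ =>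
      ⟨⟨-d - e, by linarith⟩, ⟨e, by linarith⟩, ⟨f, by linarith⟩⟩
  · exact key (-x - y) x z (by linear_combination hrep) fun k ⟨d, h1⟩ ⟨e, h2⟩ ⟨f, h3⟩ =>
      ⟨⟨e, by linarith⟩, ⟨-d - e, by linarith⟩, ⟨f, by linarith⟩⟩
  · exact key (-x - y) x (-z) (by linear_combination hrep) fun k ⟨d, h1⟩ ⟨e, h2⟩ ⟨f, h3⟩ =>
      ⟨⟨e, by linarith⟩, ⟨-d - e, by linarith⟩, ⟨-f, by linarith⟩⟩
  · exact key (-x - y) y (-z) (by linear_combination hrep) fun k ⟨d, h1⟩ ⟨e, h2⟩ ⟨f, h3⟩ =>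
      ⟨⟨-d - e, by linarith⟩, ⟨e, by linarith⟩, ⟨-f, by linarith⟩⟩
  · exact key (-x) (-y) (-z) (by linear_combination hrep) fun k ⟨d, h1⟩ ⟨e, h2⟩ ⟨f, h3⟩ =>
      ⟨⟨-d, by linarith⟩, ⟨-e, by linarith⟩, ⟨-f, by linarith⟩⟩

/-- A term of a mixed sum: its coefficient, and whether it is octagonal (rather than a square). -/
abbrev MixedTerm := ℕ × Bool

/-- The value of the generalized polygonal number of a term. -/
def polyVal (k : Bool) (x : ℤ) : ℤ := if k then 3 * x ^ 2 - 2 * x else x ^ 2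

/-- The mixed sum with the given terms represents `n`. -/
def TermsRep : List MixedTerm → ℤ → Prop
  | [], n => n = 0
  | q :: l, n => ∃ x : ℤ, TermsRep l (n - q.1 * polyVal q.2 x)

/-- The coefficient of a term after completing squares. -/
def sqCoeff (q : MixedTerm) : ℕ := if q.2 then q.1 else 3 * q.1

/-- The sum of the octagonal coefficients. -/
def octSum (l : List MixedTerm) : ℕ := (l.map fun q => if q.2 then q.1 else 0).sum

/-- Representation of `A` by the diagonal form obtained by completing squares, where the
variables coming from octagonal terms are prime to `3`. -/
def RepSq : List MixedTerm → ℤ → Prop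
  | [], A => A = 0
  | q :: l, A => ∃ z : ℤ, (q.2 = true → ¬ 3 ∣ z) ∧ RepSq l (A - sqCoeff q * z ^ 2)

theorem rep_iff_repSq (l : List MixedTerm) (n : ℤ) : TermsRep l n ↔ RepSq l (3 * n + octSum l) := by
  induction l generalizing n with
  | nil => simp [TermsRep, RepSq, octSum]
  | cons q l ih =>
    obtain ⟨c, k⟩ := q
    have hS : (octSum ((c, k) :: l) : ℤ) = (if k then c else 0 : ℕ) + octSum l := by
      simp [octSum]
    simp only [TermsRep, RepSq, hS]
    cases k with
    | false =>
      refine exists_congr fun x => ?_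
      rw [ih]
      simp only [polyVal, sqCoeff, Bool.false_eq_true, if_false, false_imp_iff, true_and]
      rw [show 3 * (n - (c : ℤ) * x ^ 2) + (octSum l : ℤ) =
        3 * n + (((0 : ℕ) : ℤ) + octSum l) - (3 * c : ℕ) * x ^ 2 by push_cast; ring]
    | true =>
      simp only [polyVal, sqCoeff, if_true, true_imp_iff]
      have key : ∀ x : ℤ, 3 * (n - (c : ℤ) * (3 * x ^ 2 - 2 * x)) + (octSum l : ℤ) =
          3 * n + ((c : ℤ) + octSum l) - c * (3 * x - 1) ^ 2 := fun x => by ring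
      constructor
      · rintro ⟨x, hx⟩
        exact ⟨3 * x - 1, by omega, by rwa [ih, key] at hx⟩
      · rintro ⟨z, hz, h⟩
        obtain ⟨x, hx⟩ : ∃ x, z = 3 * x - 1 ∨ z = -(3 * x - 1) := by
          rcases (by omega : z % 3 = 1 ∨ z % 3 = 2) with h | h
          · exact ⟨(1 - z) / 3, by omega⟩
          · exact ⟨(z + 1) / 3, by omega⟩
        refine ⟨x, ?_⟩
        rw [ih, key]
        rcases hx with rfl | rfl
        · exact h
        · rwa [neg_sq] at h

theorem TermsRep.perm {l l' : List MixedTerm} (h : l.Perm l') : ∀ {n : ℤ}, TermsRep l n → TermsRep l' n := by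
  induction h with
  | nil => exact id
  | cons x _ ih => exact fun ⟨y, hy⟩ => ⟨y, ih hy⟩
  | swap x y l => exact fun ⟨a, b, h⟩ => ⟨b, a, by rwa [sub_right_comm]⟩
  | trans _ _ ih₁ ih₂ => exact fun h => ih₂ (ih₁ h)

theorem RepSq.perm {l l' : List MixedTerm} (h : l.Perm l') :
    ∀ {n : ℤ}, RepSq l n → RepSq l' n := by
  induction h with
  | nil => exact id
  | cons x _ ih => exact fun ⟨y, h, hy⟩ => ⟨y, h, ih hy⟩
  | swap x y l => exact fun ⟨a, ha, b, hb, h⟩ => ⟨b, hb, a, ha, by rwa [sub_right_comm]⟩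
  | trans _ _ ih₁ ih₂ => exact fun h => ih₂ (ih₁ h)

theorem rep_zero (l : List MixedTerm) : TermsRep l 0 := by
  induction l with
  | nil => rfl
  | cons q l ih => exact ⟨0, by cases h : q.2 <;> simpa [polyVal, h] using ih⟩

theorem rep_append {p r : List MixedTerm} {n : ℤ} :
    TermsRep (p ++ r) n ↔ ∃ k, TermsRep p (n - k) ∧ TermsRep r k := by
  induction p generalizing n with
  | nil => exact ⟨fun h => ⟨n, by simp [TermsRep], h⟩, fun ⟨k, h, hk⟩ => by
      obtain rfl : n = k := by simpa [TermsRep, sub_eq_zero] using h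
      exact hk⟩
  | cons q p ih =>
    simp only [List.cons_append, TermsRep, ih]
    constructor
    · rintro ⟨x, k, h, hk⟩
      exact ⟨k, ⟨x, by rwa [sub_right_comm]⟩, hk⟩
    · rintro ⟨k, ⟨x, h⟩, hk⟩
      exact ⟨x, k, by rwa [sub_right_comm], hk⟩

theorem TermsRep.append {p : List MixedTerm} {n : ℤ} (h : TermsRep p n) (r : List MixedTerm) :
    TermsRep (p ++ r) n := rep_append.2 ⟨0, by simpa using h, rep_zero r⟩

theorem polyVal_nonneg (k : Bool) (x : ℤ) : 0 ≤ polyVal k x := by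
  unfold polyVal
  split_ifs
  · rcases le_or_gt x 0 with h | h <;> nlinarith
  · positivity

theorem TermsRep.nonneg {l : List MixedTerm} : ∀ {n : ℤ}, TermsRep l n → 0 ≤ n := by
  induction l with
  | nil => exact fun h => h.ge
  | cons q l ih =>
    rintro n ⟨x, h⟩
    have := ih h
    have := mul_nonneg (Int.natCast_nonneg q.1) (polyVal_nonneg q.2 x)
    linarith

theorem TermsRep.eq_zero_of_lt {l : List MixedTerm} : ∀ {n : ℤ}, TermsRep l n → (∀ q ∈ l, n < (q.1 : ℤ)) →
    n = 0 := by
  induction l with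
  | nil => exact fun h _ => h
  | cons q l ih =>
    rintro n ⟨x, h⟩ hl
    have h1 := h.nonneg
    have h2 := polyVal_nonneg q.2 x
    have h3 := hl q (by simp)
    have h4 : polyVal q.2 x = 0 := by
      by_contra hne
      have : 1 ≤ polyVal q.2 x := by omega
      nlinarith
    rw [h4, mul_zero, sub_zero] at h
    exact ih h fun r hr => hl r (by simp [hr])

theorem RepSq.mul_sq {l : List MixedTerm} {k : ℤ} (hk : ¬ 3 ∣ k ∨ ∀ q ∈ l, q.2 = false) :
    ∀ {A : ℤ}, RepSq l A → RepSq l (k ^ 2 * A) := by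
  induction l with
  | nil => rintro A rfl; simp [RepSq]
  | cons q l ih =>
    rintro A ⟨z, hz, h⟩
    refine ⟨k * z, fun hq => ?_, ?_⟩
    · rcases hk with hk | hk
      · exact fun hd => (Int.prime_three.dvd_or_dvd hd).elim hk (hz hq)
      · exact absurd (hk q (by simp)) (by simp [hq])
    · rw [show k ^ 2 * A - sqCoeff q * (k * z) ^ 2 = k ^ 2 * (A - sqCoeff q * z ^ 2) by ring]
      exact ih (hk.imp_right fun h r hr => h r (by simp [hr])) h

/-- The mixed sum represents every nonnegative integer. -/
def UniversalTerms (l : List MixedTerm) : Prop := ∀ n : ℕ, TermsRep l n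

theorem UniversalTerms.append {p : List MixedTerm} (h : UniversalTerms p) (r : List MixedTerm) :
    UniversalTerms (p ++ r) := fun n => (h n).append r

/-- Descent on square factors: it suffices to represent small numbers, and large numbers whose
associated value is not divisible by `4`, `25` (and `27` if there are no octagonal terms). -/
theorem universalTerms_of_large {l : List MixedTerm} (T : ℕ) (hT : 9 * octSum l ≤ T)
    (hsmall : ∀ n ≤ T, TermsRep l n)
    (hlarge : ∀ A : ℕ, 3 * T < A → A % 3 = octSum l % 3 → A % 4 ≠ 0 → A % 25 ≠ 0 →
      (octSum l = 0 → A % 27 ≠ 0) → RepSq l A) (hno : octSum l = 0 → ∀ q ∈ l, q.2 = false) :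
    UniversalTerms l := by
  have key : ∀ A : ℕ, octSum l ≤ A → A % 3 = octSum l % 3 → RepSq l A := by
    intro A
    induction A using Nat.strong_induction_on with
    | _ A ih =>
    intro hA hmod
    by_cases hs : A ≤ 3 * T + octSum l
    · have := hsmall ((A - octSum l) / 3) (by omega)
      rw [rep_iff_repSq] at this
      convert this using 1
      omega
    · by_cases h4 : A % 4 = 0
      · have := (ih (A / 4) (by omega) (by omega) (by omega)).mul_sq (k := 2) (Or.inl (by decide))
        convert this using 1
        push_cast; omega
      · by_cases h25 : A % 25 = 0
        · have := (ih (A / 25) (by omega) (by omega) (by omega)).mul_sq (k := 5)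
            (Or.inl (by decide))
          convert this using 1
          push_cast; omega
        · by_cases h27 : octSum l = 0 ∧ A % 27 = 0
          · have := (ih (A / 9) (by omega) (by omega) (by omega)).mul_sq (k := 3)
              (Or.inr (hno h27.1))
            convert this using 1
            push_cast; omega
          · exact hlarge A (by omega) hmod h4 h25 fun h h' => h27 ⟨h, h'⟩
  intro n
  rw [rep_iff_repSq]
  exact_mod_cast key (3 * n + octSum l) (by omega) (by omega)

/-! ### The escalator tree -/

/-- The numbers that have to be tested. -/
def criticalNumbers : List ℕ := [1, 2, 3, 4, 5, 6, 7, 8, 9, 10, 12, 13, 14, 15, 18, 20, 30, 60, 61]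

/-- The polygonal numbers up to `61`. -/
def smallPolyVals (k : Bool) : List ℕ :=
  if k then [0, 1, 5, 8, 16, 21, 33, 40, 56] else [0, 1, 4, 9, 16, 25, 36, 49]

theorem polyVal_mem_smallPolyVals {k : Bool} {x : ℤ} (h : polyVal k x ≤ 61) :
    ∃ v ∈ smallPolyVals k, polyVal k x = (v : ℤ) := by
  have hx : -7 ≤ x ∧ x ≤ 7 := by
    cases k <;> simp only [polyVal, Bool.false_eq_true, if_true, if_false] at h <;>
      constructor <;> nlinarith
  obtain ⟨h1, h2⟩ := hx
  cases k <;> simp only [polyVal, Bool.false_eq_true, if_true, if_false] at h ⊢ <;>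
    interval_cases x <;> simp_all [smallPolyVals]

/-- Union of the shifts of a bit set. -/
def orShift (E c : ℕ) : List ℕ → ℕ
  | [] => 0
  | v :: vs => orShift E c vs ||| E <<< (c * v)

theorem testBit_orShift {E c i : ℕ} {vs : List ℕ} :
    (orShift E c vs).testBit i ↔ ∃ v ∈ vs, c * v ≤ i ∧ E.testBit (i - c * v) := by
  induction vs with
  | nil => simp [orShift]
  | cons v vs ih => simp [orShift, ih, Nat.testBit_shiftLeft, or_comm]

/-- Bit set of represented numbers, correct up to `61`. -/
def repMask : List MixedTerm → ℕ
  | [] => 1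
  | q :: l => orShift (repMask l) q.1 (smallPolyVals q.2)

theorem TermsRep.testBit_repMask {l : List MixedTerm} (hl : ∀ q ∈ l, 0 < q.1) :
    ∀ {n : ℕ}, n ≤ 61 → TermsRep l n → (repMask l).testBit n := by
  induction l with
  | nil =>
    intro n _ h
    have h' : (n : ℤ) = 0 := h
    obtain rfl : n = 0 := by exact_mod_cast h'
    rfl
  | cons q l ih =>
    rintro n hn ⟨x, h⟩
    have h1 := h.nonneg
    have h2 := polyVal_nonneg q.2 x
    have hq : (1 : ℤ) ≤ q.1 := by exact_mod_cast hl q (by simp)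
    obtain ⟨v, hv, he⟩ := polyVal_mem_smallPolyVals (k := q.2) (x := x)
      (by have : (n : ℤ) ≤ 61 := by exact_mod_cast hn
          nlinarith)
    rw [he] at h h1
    have hle : q.1 * v ≤ n := by
      have : ((q.1 * v : ℕ) : ℤ) ≤ n := by push_cast; linarith
      exact_mod_cast this
    refine testBit_orShift.2 ⟨v, hv, hle, ih (fun r hr => hl r (by simp [hr])) (by omega) ?_⟩
    rwa [Nat.cast_sub hle, Nat.cast_mul]

/-- Terms are ordered by coefficient, squares first. -/
def MixedTerm.le (q r : MixedTerm) : Bool := q.1 < r.1 || (q.1 == r.1 && (!q.2 || r.2))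

/-- Test all numbers below `n`. -/
def allBelow : ℕ → (ℕ → Bool) → Bool
  | 0, _ => true
  | n + 1, f => f n && allBelow n f

theorem allBelow_iff {n : ℕ} {f : ℕ → Bool} : allBelow n f = true ↔ ∀ i < n, f i = true := by
  induction n with
  | zero => simp [allBelow]
  | succ n ih =>
    simp only [allBelow, Bool.and_eq_true, ih]
    exact ⟨fun h i hi => (Nat.lt_succ_iff_lt_or_eq.1 hi).elim (h.2 i) fun e => e ▸ h.1,
      fun h => ⟨h n (by omega), fun i hi => h i (by omega)⟩⟩

/-- Depth-first traversal of the escalator tree, testing its leaves. -/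
def escalate (leaf : List MixedTerm → Bool) : ℕ → List MixedTerm → Bool
  | 0, _ => false
  | f + 1, p =>
    match criticalNumbers.find? fun t => !(repMask p).testBit t with
    | none => leaf p
    | some t => allBelow t fun c => [false, true].all fun k =>
        !(p.all fun q => MixedTerm.le q (c + 1, k)) || escalate leaf f (p ++ [(c + 1, k)])

theorem criticalNumbers_le {t : ℕ} (h : t ∈ criticalNumbers) : t ≤ 61 := by
  revert t; decide

theorem universalTerms_of_escalate {leaf : List MixedTerm → Bool}
    (hleaf : ∀ p, leaf p = true → UniversalTerms p) {f : ℕ} {p r : List MixedTerm}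
    (h : escalate leaf f p = true) (hpos : ∀ q ∈ p ++ r, 0 < q.1)
    (hsort : (p ++ r).Pairwise fun q q' => MixedTerm.le q q' = true)
    (hrep : ∀ t ∈ criticalNumbers, TermsRep (p ++ r) (t : ℕ)) : UniversalTerms (p ++ r) := by
  induction f generalizing p r with
  | zero => simp [escalate] at h
  | succ f ih =>
    rw [escalate] at h
    split at h
    · exact (hleaf p h).append r
    · next t ht =>
      have hmem := List.mem_of_find?_eq_some ht
      have hnot : ¬ TermsRep p (t : ℕ) := fun hr => by
        have := hr.testBit_repMask (fun q hq => hpos q (by simp [hq])) (criticalNumbers_le hmem)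
        have h2 := List.find?_some ht
        simp [this] at h2
      obtain ⟨k, hk, hk'⟩ := rep_append.1 (hrep t hmem)
      cases r with
      | nil => exact absurd (by simpa using hrep t hmem) hnot
      | cons q r =>
        obtain ⟨c, b⟩ := q
        have hcpos : 0 < c := hpos (c, b) (by simp)
        have hct : c ≤ t := by
          by_contra hlt
          have hk0 : k = 0 := by
            refine hk'.eq_zero_of_lt fun q hq => ?_
            have h1 : k ≤ t := by have := hk.nonneg; linarith
            have h2 : c ≤ q.1 := by
              rcases List.mem_cons.1 hq with rfl | hq
              · exact le_rfl
              · have := (List.pairwise_cons.1 (List.pairwise_append.1 hsort).2.1).1 q hq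
                simp only [MixedTerm.le, Bool.or_eq_true, Bool.and_eq_true, decide_eq_true_eq,
                  beq_iff_eq] at this
                omega
            have : (t : ℤ) < q.1 := by exact_mod_cast (by omega : t < q.1)
            linarith
          rw [hk0, sub_zero] at hk
          exact hnot hk
        rw [allBelow_iff] at h
        have h1 := h (c - 1) (by omega)
        rw [List.all_eq_true] at h1
        have h2 := h1 b (by cases b <;> simp)
        rw [show c - 1 + 1 = c by omega] at h2
        have h3 : (p.all fun q => MixedTerm.le q (c, b)) = true :=
          List.all_eq_true.2 fun q hq => (List.pairwise_append.1 hsort).2.2 q hq (c, b) (by simp)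
        rw [h3, Bool.not_true, Bool.false_or] at h2
        have := ih (p := p ++ [(c, b)]) (r := r) h2 (by simpa using hpos) (by simpa using hsort)
          (by simpa using hrep)
        simpa using this

/-! ### Covering residue classes by bit sets -/

/-- Periodic extension of a bit set of width `w` to at least `L` bits (`n` doublings at most). -/
def expandMask (L : ℕ) : ℕ → ℕ → ℕ → ℕ
  | 0, x, _ => x
  | n + 1, x, w => if L ≤ w then x else expandMask L n (x ||| x <<< w) (2 * w)

theorem testBit_of_expandMask {L P mask : ℕ} {n x w i : ℕ} (hw : P ∣ w)
    (hx : ∀ i, x.testBit i → mask.testBit (i % P)) (h : (expandMask L n x w).testBit i) :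
    mask.testBit (i % P) := by
  induction n generalizing x w with
  | zero => exact hx i h
  | succ n ih =>
    rw [expandMask] at h
    split_ifs at h
    · exact hx i h
    · refine ih (hw.mul_left 2) (fun j hj => ?_) h
      rw [Nat.testBit_or, Nat.testBit_shiftLeft, Bool.or_eq_true, Bool.and_eq_true,
        decide_eq_true_eq] at hj
      rcases hj with hj | ⟨hj, hj'⟩
      · exact hx j hj
      · have := hx _ hj'
        obtain ⟨k, rfl⟩ := hw
        rwa [show j - P * k = j - P * k from rfl, ← Nat.add_mul_mod_self_left (j - P * k) P k,
          Nat.sub_add_cancel hj] at this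

/-- Periodic extension of a bit set of period `P` to at least `L` bits. -/
def periodicMask (L P mask : ℕ) : ℕ := expandMask L 20 (mask % 2 ^ P) P

theorem testBit_of_periodicMask {L P mask i : ℕ} (h : (periodicMask L P mask).testBit i) :
    mask.testBit (i % P) := by
  refine testBit_of_expandMask dvd_rfl (fun j hj => ?_) h
  rw [Nat.testBit_mod_two_pow, Bool.and_eq_true, decide_eq_true_eq] at hj
  rw [Nat.mod_eq_of_lt hj.1]
  exact hj.2

/-- Union of the bit sets `f i` for `i < n`. -/
def orBelow : ℕ → (ℕ → ℕ) → ℕ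
  | 0, _ => 0
  | n + 1, f => Nat.lor (f n) (orBelow n f)

theorem testBit_orBelow {n i : ℕ} {f : ℕ → ℕ} (h : (orBelow n f).testBit i) :
    ∃ v < n, (f v).testBit i := by
  induction n with
  | zero => simp [orBelow] at h
  | succ n ih =>
    rw [orBelow] at h
    change (f n ||| orBelow n f).testBit i = true at h
    rw [Nat.testBit_or, Bool.or_eq_true] at h
    rcases h with h | h
    · exact ⟨n, by omega, h⟩
    · obtain ⟨v, hv, h⟩ := ih h
      exact ⟨v, by omega, h⟩

/-- Every number exceeding `b` in a residue class of `E` modulo `L` is represented by `l`. -/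
def CoverSound (L b : ℕ) (l : List MixedTerm) (E : ℕ) : Prop :=
  ∀ j, E.testBit j → ∀ A : ℕ, A % L = j % L → b < A → RepSq l A

/-- Residue classes represented after adding a term whose variable is at most `B`. -/
def addTermMask (L B E : ℕ) (q : MixedTerm) : ℕ :=
  orBelow (B + 1) (fun v => if q.2 && v % 3 == 0 then 0 else
    (E ||| E <<< L) >>> (L - sqCoeff q * v ^ 2 % L)) % 2 ^ L

theorem CoverSound.addTerm {L b : ℕ} {l : List MixedTerm} {E : ℕ} (h : CoverSound L b l E)
    (hL : 0 < L) (B : ℕ) (q : MixedTerm) :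
    CoverSound L (b + sqCoeff q * B ^ 2) (q :: l) (addTermMask L B E q) := by
  intro j hj A hA hb
  rw [addTermMask, Nat.testBit_mod_two_pow, Bool.and_eq_true] at hj
  obtain ⟨v, hv, hj⟩ := testBit_orBelow hj.2
  split_ifs at hj with h3
  · simp at hj
  have hle : sqCoeff q * v ^ 2 ≤ sqCoeff q * B ^ 2 := by gcongr; omega
  have hlt := Nat.mod_lt (sqCoeff q * v ^ 2) hL
  have hdm := Nat.mod_add_div (sqCoeff q * v ^ 2) L
  have hmod : (A - sqCoeff q * v ^ 2) % L = (j + (L - sqCoeff q * v ^ 2 % L)) % L := by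
    have : A - sqCoeff q * v ^ 2 ≡ j + (L - sqCoeff q * v ^ 2 % L) [MOD L] := by
      refine Nat.ModEq.add_right_cancel' (sqCoeff q * v ^ 2) ?_
      rw [Nat.sub_add_cancel (by omega)]
      refine Nat.ModEq.trans hA ?_
      have : j + (L - sqCoeff q * v ^ 2 % L) + sqCoeff q * v ^ 2 =
          j + L * (1 + sqCoeff q * v ^ 2 / L) := by
        rw [mul_add, mul_one]; omega
      rw [this]
      simp [Nat.ModEq]
    exact this
  refine ⟨v, fun hq => ?_, ?_⟩
  · have : v % 3 ≠ 0 := by simpa [hq] using h3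
    omega
  · rw [Nat.testBit_shiftRight, Nat.testBit_or, Nat.testBit_shiftLeft, Bool.or_eq_true,
      Bool.and_eq_true, decide_eq_true_eq] at hj
    have hcast : (A : ℤ) - sqCoeff q * (v : ℤ) ^ 2 = ((A - sqCoeff q * v ^ 2 : ℕ) : ℤ) := by
      push_cast [show sqCoeff q * v ^ 2 ≤ A by omega]; ring
    rw [hcast]
    rw [add_comm j] at hmod
    rcases hj with hj | ⟨hj, hj'⟩
    · exact h _ hj _ hmod (by omega)
    · refine h _ hj' _ ?_ (by omega)
      rw [hmod, ← Nat.add_mod_right (_ - L) L, Nat.sub_add_cancel hj]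

/-- Residue classes represented after adding several terms. -/
def addTermsMask (L B : ℕ) : ℕ → List MixedTerm → ℕ
  | E, [] => E
  | E, q :: r => addTermsMask L B (addTermMask L B E q) r

theorem CoverSound.addTerms {L B : ℕ} (hL : 0 < L) {r : List MixedTerm} :
    ∀ {b : ℕ} {l : List MixedTerm} {E : ℕ}, CoverSound L b l E →
      CoverSound L (b + (r.map fun q => sqCoeff q * B ^ 2).sum) (r.reverse ++ l)
        (addTermsMask L B E r) := by
  induction r with
  | nil => intro b l E h; simpa [addTermsMask] using h
  | cons q r ih =>
    intro b l E h
    have := ih (h.addTerm hL B q)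
    simpa [addTermsMask, add_assoc] using this

theorem CoverSound.mono {L b b' E : ℕ} {l : List MixedTerm} (h : CoverSound L b l E)
    (hb : b ≤ b') : CoverSound L b' l E := fun j hj A hA hlt => h j hj A hA (by omega)

theorem CoverSound.perm {L b E : ℕ} {l l' : List MixedTerm} (h : CoverSound L b l E)
    (hp : l.Perm l') : CoverSound L b l' E := fun j hj A hA hlt => (h j hj A hA hlt).perm hp

theorem CoverSound.or {L b E E' : ℕ} {l : List MixedTerm} (h : CoverSound L b l E)
    (h' : CoverSound L b l E') : CoverSound L b l (E ||| E') := fun j hj => by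
  rw [Nat.testBit_or, Bool.or_eq_true] at hj
  exact hj.elim (h j) (h' j)

theorem coverSound_zero (L b : ℕ) (l : List MixedTerm) : CoverSound L b l 0 := fun j hj => by
  simp at hj

/-- All ways to choose `k` entries of a list, with the remaining entries. -/
def splits {α : Type} : List α → ℕ → List (List α × List α)
  | l, 0 => [([], l)]
  | [], _ + 1 => []
  | x :: xs, k + 1 => (splits xs k).map (fun s => (x :: s.1, s.2)) ++
      (splits xs (k + 1)).map fun s => (s.1, x :: s.2)

theorem perm_of_mem_splits {α : Type} {l : List α} : ∀ {k : ℕ} {s : List α × List α},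
    s ∈ splits l k → (s.1 ++ s.2).Perm l := by
  induction l with
  | nil =>
    intro k s h
    cases k with
    | zero => simp [splits] at h; simp [h]
    | succ k => simp [splits] at h
  | cons x xs ih =>
    intro k s h
    cases k with
    | zero => simp [splits] at h; simp [h]
    | succ k =>
      rw [splits, List.mem_append, List.mem_map, List.mem_map] at h
      rcases h with ⟨t, ht, rfl⟩ | ⟨t, ht, rfl⟩
      · exact (ih ht).cons x
      · exact List.perm_middle.trans ((ih ht).cons x)

/-- Terms that represent every large number in the residue classes of a bit set. -/
structure MaskEntry where
  terms : List MixedTerm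
  period : ℕ
  mask : ℕ

/-- The defining property of a `MaskEntry`. -/
def MaskEntry.Sound (e : MaskEntry) : Prop :=
  ∀ m : ℕ, 10000 < m → e.mask.testBit (m % e.period) → RepSq e.terms m

/-- A numerical code of a list of terms, for quick comparison. -/
def termsKey (l : List MixedTerm) : ℕ := l.foldl (fun a q => 256 * a + 2 * q.1 + q.2.toNat) 0

/-- A search tree of entries, ordered by `termsKey`. -/
inductive MaskTree
  | nil : MaskTree
  | node (k : ℕ) (es : List MaskEntry) (l r : MaskTree) : MaskTree

/-- Insertion of an entry with key `k`. -/
def MaskTree.insert (e : MaskEntry) (k : ℕ) : MaskTree → MaskTree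
  | .nil => .node k [e] .nil .nil
  | .node k' es l r => bif Nat.beq k k' then .node k' (e :: es) l r else
      bif Nat.ble k k' then .node k' es (l.insert e k) r else .node k' es l (r.insert e k)

/-- The entries with key `k`. -/
def MaskTree.find (k : ℕ) : MaskTree → List MaskEntry
  | .nil => []
  | .node k' es l r => bif Nat.beq k k' then es else bif Nat.ble k k' then l.find k else r.find k

/-- The search tree of a list of entries. -/
def MaskTree.ofList : List MaskEntry → MaskTree
  | [] => .nil
  | e :: es => (ofList es).insert e (termsKey e.terms)

theorem MaskTree.mem_of_mem_find_insert {e e' : MaskEntry} {k k' : ℕ} {t : MaskTree}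
    (h : e' ∈ (t.insert e k).find k') : e' = e ∨ e' ∈ t.find k' := by
  induction t with
  | nil =>
    simp only [insert, find, Bool.cond_eq_ite] at h
    split_ifs at h <;> simp_all
  | node k₁ es l r ihl ihr =>
    simp only [insert, Bool.cond_eq_ite] at h
    split_ifs at h <;> simp only [find, Bool.cond_eq_ite] at h ⊢ <;> split_ifs at h ⊢ <;> simp_all

theorem MaskTree.mem_of_mem_find {e : MaskEntry} {k : ℕ} {es : List MaskEntry}
    (h : e ∈ (ofList es).find k) : e ∈ es := by
  induction es with
  | nil => simp [ofList, find] at h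
  | cons e' es ih =>
    rcases mem_of_mem_find_insert h with rfl | h
    · simp
    · simp [ih h]

/-- Residue classes modulo `L` represented by `l` according to a list of entries. -/
def tableMask (L : ℕ) (l : List MixedTerm) : List MaskEntry → ℕ
  | [] => 0
  | e :: es => bif e.terms == l && L % e.period == 0 then
      periodicMask L e.period e.mask ||| tableMask L l es else tableMask L l es

theorem coverSound_tableMask {L : ℕ} {l : List MixedTerm} {es : List MaskEntry}
    (h : ∀ e ∈ es, e.Sound) : CoverSound L 10000 l (tableMask L l es) := by
  induction es with
  | nil => exact coverSound_zero _ _ _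
  | cons e es ih =>
    have ih := ih fun e he => h e (by simp [he])
    rw [tableMask, Bool.cond_eq_ite]
    split_ifs with hc
    · refine CoverSound.or (fun j hj A hA hlt => ?_) ih
      rw [Bool.and_eq_true, beq_iff_eq, beq_iff_eq] at hc
      rw [← hc.1]
      refine h e (by simp) A hlt ?_
      have hd := Nat.dvd_of_mod_eq_zero hc.2
      rw [← Nat.mod_mod_of_dvd A hd, hA, Nat.mod_mod_of_dvd j hd]
      exact testBit_of_periodicMask hj
    · exact ih

/-- Residue classes represented by `l` through a three-term subsum in the table. -/
def coverMask (L B : ℕ) (es : List MaskEntry) : List (List MixedTerm × List MixedTerm) → ℕ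
  | [] => 0
  | s :: ss => (match tableMask L s.1 ((MaskTree.ofList es).find (termsKey s.1)) with
      | 0 => 0
      | E + 1 => addTermsMask L B (E + 1) s.2) ||| coverMask L B es ss

theorem coverSound_coverMask {L B : ℕ} (hL : 0 < L) {es : List MaskEntry}
    (h : ∀ e ∈ es, e.Sound) {l : List MixedTerm} {ss : List (List MixedTerm × List MixedTerm)}
    (hs : ∀ s ∈ ss, (s.1 ++ s.2).Perm l) :
    CoverSound L (10000 + (l.map fun q => sqCoeff q * B ^ 2).sum) l (coverMask L B es ss) := by
  induction ss with
  | nil => exact coverSound_zero _ _ _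
  | cons s ss ih =>
    refine CoverSound.or ?_ (ih fun s hs' => hs s (by simp [hs']))
    split
    · exact coverSound_zero _ _ _
    · next E hE =>
      have h1 := coverSound_tableMask (L := L) (l := s.1)
        (es := (MaskTree.ofList es).find (termsKey s.1))
        fun e he => h e (MaskTree.mem_of_mem_find he)
      rw [hE] at h1
      have h2 := h1.addTerms hL (B := B) (r := s.2)
      have hp := hs s (by simp)
      refine (h2.perm ?_).mono ?_
      · exact ((List.reverse_perm s.2).append_right s.1).trans (List.perm_append_comm.trans hp)
      · have := (hp.map fun q => sqCoeff q * B ^ 2).sum_eq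
        rw [List.map_append, List.sum_append] at this
        omega

/-- Residue classes that need not be covered: wrong class modulo `3`, or square factors. -/
def excludedMask (L S : ℕ) : ℕ :=
  periodicMask L 4 1 ||| periodicMask L 25 1 ||| periodicMask L 3 (7 - 2 ^ (S % 3)) |||
    if S == 0 then periodicMask L 27 1 else 0

theorem testBit_one_iff {i : ℕ} : Nat.testBit 1 i = true ↔ i = 0 := by
  cases i <;> simp [Nat.testBit_succ]

theorem of_testBit_excludedMask {L S A : ℕ} (h : (excludedMask L S).testBit (A % L))
    (hL : 300 ∣ L) (hL' : S = 0 → 27 ∣ L) (h3 : A % 3 = S % 3) (h4 : A % 4 ≠ 0)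
    (h25 : A % 25 ≠ 0) (h27 : S = 0 → A % 27 ≠ 0) : False := by
  simp only [excludedMask, Nat.testBit_or, Bool.or_eq_true] at h
  rcases h with ((h | h) | h) | h
  · have := testBit_one_iff.1 (testBit_of_periodicMask h)
    rw [Nat.mod_mod_of_dvd _ (dvd_trans (by norm_num) hL)] at this
    exact h4 this
  · have := testBit_one_iff.1 (testBit_of_periodicMask h)
    rw [Nat.mod_mod_of_dvd _ (dvd_trans (by norm_num) hL)] at this
    exact h25 this
  · have := testBit_of_periodicMask h
    rw [Nat.mod_mod_of_dvd _ (dvd_trans (by norm_num) hL), h3] at this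
    have h' : S % 3 < 3 := Nat.mod_lt _ (by norm_num)
    interval_cases S % 3 <;> revert this <;> decide
  · split_ifs at h with hS
    · have := testBit_one_iff.1 (testBit_of_periodicMask h)
      have hS : S = 0 := by simpa using hS
      rw [Nat.mod_mod_of_dvd _ (hL' hS)] at this
      exact h27 hS this
    · simp at h

/-- Integer square root of numbers below `2 ^ 20`, by bisection. -/
def bisectSqrt (n : ℕ) : ℕ → ℕ → ℕ
  | 0, r => r
  | k + 1, r => bif Nat.ble (Nat.pow (Nat.add r (Nat.pow 2 k)) 2) n then
      bisectSqrt n k (Nat.add r (Nat.pow 2 k)) else bisectSqrt n k r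

/-- Union of the shifts of a bit set by the multiples of the polygonal numbers of variables at
most `B`. -/
def polyShift (B c : ℕ) (k : Bool) (E : ℕ) : ℕ :=
  bif k then orBelow (Nat.succ B) fun v =>
    Nat.lor (Nat.shiftLeft E (Nat.mul c (Nat.mul v (Nat.sub (Nat.mul 3 v) 2))))
      (Nat.shiftLeft E (Nat.mul c (Nat.mul v (Nat.add (Nat.mul 3 v) 2))))
  else orBelow (Nat.succ B) fun v => Nat.shiftLeft E (Nat.mul c (Nat.mul v v))

/-- Bit set of numbers up to `T` represented by the given terms. -/
def smallMask (T : ℕ) : List MixedTerm → ℕ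
  | [] => 1
  | (c, k) :: l =>
      Nat.mod (polyShift (bisectSqrt (Nat.div T c) 10 0) c k (smallMask T l)) (Nat.pow 2 (T + 1))

theorem exists_of_testBit_polyShift {B c : ℕ} {k : Bool} {E n : ℕ}
    (h : (polyShift B c k E).testBit n) :
    ∃ x : ℤ, ∃ d ≤ n, (d : ℤ) = c * polyVal k x ∧ E.testBit (n - d) := by
  have key : ∀ d : ℕ, ∀ x : ℤ, (d : ℤ) = c * polyVal k x → (E <<< d).testBit n →
      ∃ x : ℤ, ∃ d ≤ n, (d : ℤ) = c * polyVal k x ∧ E.testBit (n - d) := by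
    intro d x hd h
    rw [Nat.testBit_shiftLeft, Bool.and_eq_true, decide_eq_true_eq] at h
    exact ⟨x, d, h.1, hd, h.2⟩
  cases k with
  | false =>
    rw [polyShift, cond_false] at h
    obtain ⟨v, -, h⟩ := testBit_orBelow h
    refine key (c * (v * v)) v ?_ h
    simp [polyVal, pow_two]
  | true =>
    rw [polyShift, cond_true] at h
    obtain ⟨v, -, h⟩ := testBit_orBelow h
    change (E <<< (c * (v * (3 * v - 2))) ||| E <<< (c * (v * (3 * v + 2)))).testBit n = true at h
    rw [Nat.testBit_or, Bool.or_eq_true] at h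
    rcases h with h | h
    · refine key _ v ?_ h
      rcases Nat.eq_zero_or_pos v with rfl | hv
      · simp [polyVal]
      · simp only [polyVal, if_true]
        push_cast [show 2 ≤ 3 * v by omega]; ring
    · refine key _ (-v) ?_ h
      simp only [polyVal, if_true]
      push_cast; ring

theorem termsRep_of_smallMask {T : ℕ} {l : List MixedTerm} :
    ∀ {n : ℕ}, (smallMask T l).testBit n → TermsRep l n := by
  induction l with
  | nil =>
    intro n h
    have h0 : n = 0 := testBit_one_iff.1 h
    simp [h0, TermsRep]
  | cons q l ih =>
    obtain ⟨c, k⟩ := q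
    intro n h
    change (polyShift (bisectSqrt (T / c) 10 0) c k (smallMask T l) % 2 ^ (T + 1)).testBit n = true
      at h
    rw [Nat.testBit_mod_two_pow, Bool.and_eq_true] at h
    obtain ⟨x, d, hd, hx, h⟩ := exists_of_testBit_polyShift h.2
    refine ⟨x, ?_⟩
    rw [← hx, ← Nat.cast_sub hd]
    exact ih h

/-- Bound beyond which the covering argument applies. -/
def smallBound (B : ℕ) (l : List MixedTerm) : ℕ :=
  9 * octSum l + 3400 + (l.map fun q => sqCoeff q * B ^ 2).sum / 3

/-- Sufficient test for universality. -/
def leafTest (L : ℕ) (es : List MaskEntry) (B : ℕ) (l : List MixedTerm) : Bool :=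
  L % 300 == 0 && (octSum l != 0 || (L % 27 == 0 && l.all fun q => !q.2)) &&
  (excludedMask L (octSum l) ||| coverMask L B es (splits l 3)) % 2 ^ L == 2 ^ L - 1 &&
  smallMask (smallBound B l) l == 2 ^ (smallBound B l + 1) - 1

theorem universalTerms_of_leafTest {L B : ℕ} {es : List MaskEntry} (hes : ∀ e ∈ es, e.Sound)
    (hL : 0 < L) {l : List MixedTerm} (h : leafTest L es B l = true) : UniversalTerms l := by
  simp only [leafTest, Bool.and_eq_true, Bool.or_eq_true, bne_iff_ne, beq_iff_eq,
    List.all_eq_true, Bool.not_eq_true'] at h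
  obtain ⟨⟨⟨h1, h2⟩, h3⟩, h4⟩ := h
  refine universalTerms_of_large (smallBound B l) (by unfold smallBound; omega)
    (fun n hn => termsRep_of_smallMask (T := smallBound B l) ?_) ?_
    fun h0 q hq => (h2.resolve_left fun h => h h0).2 q hq
  · rw [h4, Nat.testBit_two_pow_sub_one, decide_eq_true_eq]; omega
  · intro A hA hA3 hA4 hA25 hA27
    have hbit : ((excludedMask L (octSum l) ||| coverMask L B es (splits l 3)) % 2 ^ L).testBit
        (A % L) := by
      rw [h3, Nat.testBit_two_pow_sub_one, decide_eq_true_eq]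
      exact Nat.mod_lt _ hL
    rw [Nat.testBit_mod_two_pow, Bool.and_eq_true, Nat.testBit_or, Bool.or_eq_true] at hbit
    rcases hbit.2 with hb | hb
    · exact (of_testBit_excludedMask hb (Nat.dvd_of_mod_eq_zero h1) (fun h0 =>
        Nat.dvd_of_mod_eq_zero (h2.resolve_left fun h => h h0).1) hA3 hA4 hA25 hA27).elim
    · refine coverSound_coverMask hL hes (fun s hs => perm_of_mem_splits hs) _ hb A
        (Nat.mod_mod _ _).symm ?_
      unfold smallBound at hA
      omega

/-- A value of `y² + 2 w²` with `3 ∣ y, w` has a representation prime to `3`. -/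
theorem exists_one_two_prime_to_three (n : ℕ) : ∀ y w : ℤ, y.natAbs + w.natAbs ≤ n →
    (y ≠ 0 ∨ w ≠ 0) → 3 ∣ y → 3 ∣ w → ∃ y' w' : ℤ, y' ^ 2 + 2 * w' ^ 2 = y ^ 2 + 2 * w ^ 2 ∧
      ¬ 3 ∣ y' ∧ ¬ 3 ∣ w' ∧ ∀ k : ℤ, IsCoprime k 3 → k ∣ y' → k ∣ w' → k ∣ y ∧ k ∣ w := by
  induction n with
  | zero => intro y w h h0; omega
  | succ n ih =>
    rintro y w h h0 ⟨a, rfl⟩ ⟨b, rfl⟩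
    obtain ⟨a', b', he, hne, hk⟩ : ∃ a' b' : ℤ, a' ^ 2 + 2 * b' ^ 2 = a ^ 2 + 2 * b ^ 2 ∧
        ¬ (3 ∣ a' ∧ 3 ∣ b') ∧
        ∀ k : ℤ, IsCoprime k 3 → k ∣ a' → k ∣ b' → k ∣ a ∧ k ∣ b := by
      by_cases hd : 3 ∣ a ∧ 3 ∣ b
      · obtain ⟨a', b', h1, h2, h3, h4⟩ := ih a b (by omega) (by omega) hd.1 hd.2
        exact ⟨a', b', h1, fun h => h2 h.1, h4⟩
      · exact ⟨a, b, rfl, hd, fun k _ h1 h2 => ⟨h1, h2⟩⟩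
    have key : ∀ k : ℤ, IsCoprime k 3 → k ∣ 9 * a' → k ∣ 9 * b' → k ∣ 3 * a ∧ k ∣ 3 * b := by
      intro k hk3 h1 h2
      have h9 : IsCoprime k 9 := by
        rw [show (9 : ℤ) = 3 * 3 by norm_num]; exact hk3.mul_right hk3
      have := hk k hk3 (h9.dvd_of_dvd_mul_left h1) (h9.dvd_of_dvd_mul_left h2)
      exact ⟨this.1.mul_left 3, this.2.mul_left 3⟩
    by_cases hs : 3 ∣ a' + b'
    · refine ⟨a' - 4 * b', 2 * a' + b', by linear_combination 9 * he, by omega, by omega,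
        fun k hk3 ⟨c, hc⟩ ⟨d, hd⟩ => key k hk3 ⟨c + 4 * d, ?_⟩ ⟨d - 2 * c, ?_⟩⟩
      · linear_combination hc + 4 * hd
      · linear_combination hd - 2 * hc
    · refine ⟨a' + 4 * b', 2 * a' - b', by linear_combination 9 * he, by omega, by omega,
        fun k hk3 ⟨c, hc⟩ ⟨d, hd⟩ => key k hk3 ⟨c + 4 * d, ?_⟩ ⟨2 * c - d, ?_⟩⟩
      · linear_combination hc + 4 * hd
      · linear_combination 2 * hc - hd

/-- If `w` has the opposite parity of `u` and `v`, it is prime to `3`. -/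
def OddOut (w u v : ℤ) : Prop := u % 2 = v % 2 → w % 2 ≠ u % 2 → ¬ 3 ∣ w

/-- A condition on representations by three squares that can be achieved for `n ≡ 2 (mod 3)`. -/
def OddOutCond (x y z : ℤ) : Prop :=
  (x ^ 2 + y ^ 2 + z ^ 2) % 3 = 2 → OddOut x y z ∧ OddOut y x z ∧ OddOut z x y

theorem sq_emod_three (x : ℤ) : x ^ 2 % 3 = if 3 ∣ x then 0 else 1 := by
  rcases (by omega : x % 3 = 0 ∨ x % 3 = 1 ∨ x % 3 = 2) with h | h | h <;>
    rw [pow_two, Int.mul_emod, h] <;> split_ifs <;> omega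

theorem sq_emod_four (x : ℤ) : x ^ 2 % 4 = if 2 ∣ x then 0 else 1 := by
  rcases (by omega : x % 4 = 0 ∨ x % 4 = 1 ∨ x % 4 = 2 ∨ x % 4 = 3) with h | h | h | h <;>
    rw [pow_two, Int.mul_emod, h] <;> split_ifs <;> omega

theorem exists_oddOut_aux {n x y z : ℤ} (hn : 2 < n) (h4 : n % 4 ≠ 0) (h3 : n % 3 = 2)
    (h : x ^ 2 + y ^ 2 + z ^ 2 = n) (hp : Primitive₃ x y z) (hxy : x % 2 = y % 2) :
    ∃ x y z : ℤ, x ^ 2 + y ^ 2 + z ^ 2 = n ∧ Primitive₃ x y z ∧ OddOutCond x y z := by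
  by_cases hz3 : 3 ∣ z
  · have hx3 : ¬ 3 ∣ x ∧ ¬ 3 ∣ y := by
      have h1 := sq_emod_three x
      have h2 := sq_emod_three y
      have h3 := sq_emod_three z
      split_ifs at h1 h2 h3 <;> constructor <;> omega
    obtain ⟨p, q, hx, hy, hp3⟩ : ∃ p q : ℤ, x = p + q ∧ (y = p - q ∨ y = -(p - q)) ∧ 3 ∣ p := by
      by_cases hd : 3 ∣ (x + y) / 2
      · exact ⟨(x + y) / 2, (x - y) / 2, by omega, Or.inl (by omega), hd⟩
      · refine ⟨(x - y) / 2, (x + y) / 2, by omega, Or.inr (by omega), ?_⟩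
        have e1 : x = (x + y) / 2 + (x - y) / 2 := by omega
        have e2 : y = (x + y) / 2 - (x - y) / 2 := by omega
        generalize (x + y) / 2 = f at *
        generalize (x - y) / 2 = d at *
        rcases (by omega : f % 3 = 1 ∨ f % 3 = 2) with hf | hf <;> omega
    have hn' : z ^ 2 + 2 * p ^ 2 + 2 * q ^ 2 = n := by
      rw [← h, hx]; rcases hy with rfl | rfl <;> ring
    have hk : ∀ k : ℤ, k ∣ p → k ∣ q → k ∣ z → k ∣ 1 := fun k h1 h2 h3 => by
      refine hp k (hx ▸ dvd_add h1 h2) ?_ h3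
      rcases hy with rfl | rfl
      · exact dvd_sub h1 h2
      · exact (dvd_sub h1 h2).neg_right
    have hne : z ≠ 0 ∨ p ≠ 0 := by
      by_contra hc
      push Not at hc
      have hq := hk q (by simp [hc.2]) dvd_rfl (by simp [hc.1])
      have : q ^ 2 = 1 := by
        rcases Int.isUnit_iff.1 (isUnit_of_dvd_one hq) with rfl | rfl <;> rfl
      rw [hc.1, hc.2, this] at hn'
      omega
    obtain ⟨z', p', he, hz', hp', hk'⟩ := exists_one_two_prime_to_three _ z p le_rfl hne hz3 hp3
    have hn'' : (p' + q) ^ 2 + (p' - q) ^ 2 + z' ^ 2 = n := by rw [← hn']; linear_combination he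
    have hpar : z' % 2 = z % 2 := by
      have e1 := sq_emod_four z
      have e2 := sq_emod_four z'
      split_ifs at e1 e2 <;> omega
    have hpar' : p' % 2 = p % 2 := by
      have e1 := sq_emod_four z
      have e2 := sq_emod_four z'
      have e3 := sq_emod_four p
      have e4 := sq_emod_four p'
      split_ifs at e1 e2 e3 e4 <;> omega
    refine ⟨p' + q, p' - q, z', hn'', fun k h1 h2 h3' => ?_, fun _ => ?_⟩
    · have hk2 : IsCoprime k 2 := by
        refine (Int.prime_two.coprime_iff_not_dvd.2 fun hd => h4 ?_).symm
        have e1 := sq_emod_four (p' + q)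
        have e2 := sq_emod_four (p' - q)
        have e3 := sq_emod_four z'
        rw [if_pos (hd.trans h1)] at e1
        rw [if_pos (hd.trans h2)] at e2
        rw [if_pos (hd.trans h3')] at e3
        omega
      have hk3 : IsCoprime k 3 :=
        (Int.prime_three.coprime_iff_not_dvd.2 fun hd => hz' (hd.trans h3')).symm
      have hp2 : k ∣ p' := hk2.dvd_of_dvd_mul_left
        (by have := dvd_add h1 h2; rwa [show p' + q + (p' - q) = 2 * p' by ring] at this)
      have hq2 : k ∣ q := by have := dvd_sub h1 hp2; rwa [add_sub_cancel_left] at this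
      obtain ⟨g1, g2⟩ := hk' k hk3 h3' hp2
      exact hk k g2 hq2 g1
    · exact ⟨fun _ _ => by omega, fun _ _ => by omega, fun _ _ => hz'⟩
  · exact ⟨x, y, z, h, hp, fun _ => ⟨fun h1 h2 => by omega, fun h1 h2 => by omega, fun _ _ => hz3⟩⟩

theorem Primitive₃.swap₁₂ {x y z : ℤ} (h : Primitive₃ x y z) : Primitive₃ y x z :=
  fun k h1 h2 h3 => h k h2 h1 h3

theorem Primitive₃.swap₂₃ {x y z : ℤ} (h : Primitive₃ x y z) : Primitive₃ x z y :=
  fun k h1 h2 h3 => h k h1 h3 h2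

theorem exists_sum_three_squares_oddOut {n : ℕ} (hn : 2 < n) (h4 : n % 4 ≠ 0) (h8 : n % 8 ≠ 7) :
    ∃ x y z : ℤ, x ^ 2 + y ^ 2 + z ^ 2 = n ∧ Primitive₃ x y z ∧ OddOutCond x y z := by
  obtain ⟨x, y, z, h, hp⟩ := exists_sum_three_squares (by omega) h4 h8
  by_cases h3 : n % 3 = 2
  · by_cases hxy : x % 2 = y % 2
    · by_cases hz : z % 2 = x % 2
      · exact ⟨x, y, z, h, hp, fun _ => ⟨fun h1 h2 => by omega, fun h1 h2 => by omega,
          fun h1 h2 => by omega⟩⟩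
      · exact exists_oddOut_aux (by omega) (by omega) (by omega) h hp hxy
    · by_cases hz : z % 2 = x % 2
      · exact exists_oddOut_aux (x := x) (y := z) (z := y) (by omega) (by omega) (by omega)
          (by rw [← h]; ring) hp.swap₂₃ hz.symm
      · exact exists_oddOut_aux (x := z) (y := y) (z := x) (by omega) (by omega) (by omega)
          (by rw [← h]; ring) hp.swap₁₂.swap₂₃.swap₁₂ (by omega)
  · exact ⟨x, y, z, h, hp, fun h' => by dsimp only at h; rw [h] at h'; omega⟩

/-! ### Ternary facts -/

/-- A matrix with a denominator, mapping solutions of a base form to solutions of a diagonal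
form. -/
structure ScaledIsometry where
  den : ℕ
  a₁ : ℤ
  a₂ : ℤ
  a₃ : ℤ
  b₁ : ℤ
  b₂ : ℤ
  b₃ : ℤ
  c₁ : ℤ
  c₂ : ℤ
  c₃ : ℤ

/-- Data asserting that three terms represent the numbers in some residue classes: these are
obtained from representations by the base form `x² + y² + z²`, `x² + y² + 3 z²` or
`x² + y² + 2 z² + y z + x z + x y`, according to `base = 2, 3, 5`. -/
structure TernaryFact where
  t₁ : MixedTerm
  t₂ : MixedTerm
  t₃ : MixedTerm
  base : ℕ
  mult : ℕ
  div : ℕ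
  modulus : ℕ
  residues : ℕ
  isometries : List ScaledIsometry
  period : ℕ
  mask : ℕ

/-- The base forms, on natural numbers. -/
def baseNat (p x y z : ℕ) : ℕ :=
  bif Nat.beq p 2 then Nat.add (Nat.add (Nat.mul x x) (Nat.mul y y)) (Nat.mul z z)
  else bif Nat.beq p 3 then
    Nat.add (Nat.add (Nat.mul x x) (Nat.mul y y)) (Nat.mul 3 (Nat.mul z z))
  else Nat.add (Nat.mul x (Nat.add x (Nat.add y z)))
    (Nat.add (Nat.mul y (Nat.add y z)) (Nat.mul 2 (Nat.mul z z)))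

/-- Coefficients of the base forms. -/
def baseCoeffs (p : ℕ) : ℤ × ℤ × ℤ × ℤ × ℤ × ℤ :=
  match p with
  | 2 => (1, 1, 1, 0, 0, 0)
  | 3 => (1, 1, 3, 0, 0, 0)
  | _ => (1, 1, 2, 1, 1, 1)

/-- The base forms. -/
def baseForm (p : ℕ) (x y z : ℤ) : ℤ :=
  match baseCoeffs p with
  | (a, b, c, r, s, t) => ternaryForm a b c r s t x y z

/-- The modulus needed to decide integrality and divisibility by `3` of a transformed vector. -/
def TernaryFact.testModulus (f : TernaryFact) (g : ScaledIsometry) : ℕ :=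
  bif f.t₁.2 || f.t₂.2 || f.t₃.2 then 3 * g.den else g.den

/-- The residue of an integer, as a natural number. -/
def natResidue (Q : ℕ) (x : ℤ) : ℕ := (x % Q).toNat

/-- `v / d` is an integer, prime to `3` if `k` is set; where `v` is given modulo `D`. -/
def goodCoord (k : Bool) (d D v : ℕ) : Bool :=
  bif Nat.beq (Nat.mod v d) 0 then
    bif k then bif Nat.beq (Nat.mod v D) 0 then false else true else true
  else false

/-- A linear form modulo `D`. -/
def coordResidue (D : ℕ) (a b c : ℤ) (x y z : ℕ) : ℕ :=
  Nat.add (Nat.mul (natResidue D a) x) (Nat.add (Nat.mul (natResidue D b) y)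
    (Nat.mul (natResidue D c) z))

/-- The isometry is good at a vector known modulo `modulus`. -/
def TernaryFact.testIsometry (f : TernaryFact) (x y z : ℕ) (g : ScaledIsometry) : Bool :=
  goodCoord f.t₁.2 g.den (f.testModulus g) (coordResidue (f.testModulus g) g.a₁ g.a₂ g.a₃ x y z) &&
  goodCoord f.t₂.2 g.den (f.testModulus g) (coordResidue (f.testModulus g) g.b₁ g.b₂ g.b₃ x y z) &&
  goodCoord f.t₃.2 g.den (f.testModulus g) (coordResidue (f.testModulus g) g.c₁ g.c₂ g.c₃ x y z)

/-- Boolean version of `OddOut`. -/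
def oddOutB (w u v : ℕ) : Bool := u % 2 != v % 2 || w % 2 == u % 2 || w % 3 != 0

/-- Boolean version of `OddOutCond`. -/
def oddOutCondB (x y z : ℕ) : Bool :=
  (x * x + y * y + z * z) % 3 != 2 || (oddOutB x y z && oddOutB y x z && oddOutB z x y)

/-- Residue vectors that do not occur. -/
def TernaryFact.skip (f : TernaryFact) (x y z : ℕ) : Bool :=
  (f.modulus % 2 == 0 && x % 2 == 0 && y % 2 == 0 && z % 2 == 0) ||
  (f.modulus % 3 == 0 && x % 3 == 0 && y % 3 == 0 && z % 3 == 0) ||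
  (f.modulus % 5 == 0 && x % 5 == 0 && y % 5 == 0 && z % 5 == 0) ||
  (f.base == 2 && f.modulus % 6 == 0 && !oddOutCondB x y z)

/-- Some isometry is good at the residue vector, if it occurs. -/
def TernaryFact.testVector (f : TernaryFact) (x y z : ℕ) : Bool :=
  bif Nat.beq (Nat.mod (Nat.shiftRight f.residues (Nat.mod (baseNat f.base x y z) f.modulus)) 2) 0
  then true else f.skip x y z || f.isometries.any fun g => f.testIsometry x y z g

/-- `testVector` for all residue vectors up to symmetry. -/
def TernaryFact.scan (f : TernaryFact) : Bool :=
  match f.base with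
  | 2 => allBelow (f.modulus / 2 + 1) fun z => allBelow (z + 1) fun y => allBelow (y + 1) fun x =>
      f.testVector x y z
  | 3 => allBelow (f.modulus / 2 + 1) fun z => allBelow (f.modulus / 2 + 1) fun y =>
      allBelow (y + 1) fun x => f.testVector x y z
  | _ => allBelow (f.modulus / 2 + 1) fun z => allBelow f.modulus fun y =>
      allBelow (y + 1) fun x => f.testVector x y z

/-- The base form has a primitive solution. -/
def baseSolvable (p n : ℕ) : Bool :=
  match p with
  | 2 => n % 4 != 0 && n % 8 != 7
  | 3 => n % 3 != 0 || n % 9 == 3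
  | _ => n % 5 != 0 || n % 25 == 10 || n % 25 == 15

/-- The modulus that decides `baseSolvable`. -/
def baseModulus (p : ℕ) : ℕ :=
  match p with
  | 2 => 8
  | 3 => 9
  | _ => 25

/-- The matrix transforms `mult · (diagonal form)` into `den² · div · (base form)`. -/
def TernaryFact.testMatrix (f : TernaryFact) (g : ScaledIsometry) : Bool :=
  match baseCoeffs f.base with
  | (a, b, c, r, s, t) =>
    let F₁ : ℤ := sqCoeff f.t₁
    let F₂ : ℤ := sqCoeff f.t₂
    let F₃ : ℤ := sqCoeff f.t₃
    let D : ℤ := g.den * g.den * f.div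
    0 < g.den && f.modulus % f.testModulus g == 0 &&
    f.mult * (F₁ * (g.a₁ * g.a₁) + F₂ * (g.b₁ * g.b₁) + F₃ * (g.c₁ * g.c₁)) == D * a &&
    f.mult * (F₁ * (g.a₂ * g.a₂) + F₂ * (g.b₂ * g.b₂) + F₃ * (g.c₂ * g.c₂)) == D * b &&
    f.mult * (F₁ * (g.a₃ * g.a₃) + F₂ * (g.b₃ * g.b₃) + F₃ * (g.c₃ * g.c₃)) == D * c &&
    2 * f.mult * (F₁ * (g.a₂ * g.a₃) + F₂ * (g.b₂ * g.b₃) + F₃ * (g.c₂ * g.c₃)) == D * r &&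
    2 * f.mult * (F₁ * (g.a₁ * g.a₃) + F₂ * (g.b₁ * g.b₃) + F₃ * (g.c₁ * g.c₃)) == D * s &&
    2 * f.mult * (F₁ * (g.a₁ * g.a₂) + F₂ * (g.b₁ * g.b₂) + F₃ * (g.c₁ * g.c₂)) == D * t

/-- The residue classes of the mask are covered. -/
def TernaryFact.testMask (f : TernaryFact) : Bool :=
  allBelow f.period fun j => !f.mask.testBit j ||
    (j % f.div == 0 && baseSolvable f.base (f.mult * (j / f.div)) &&
      f.residues.testBit (f.mult * (j / f.div) % f.modulus))

/-- Correctness test of a ternary fact. -/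
def TernaryFact.test (f : TernaryFact) : Bool :=
  0 < f.div && f.div ≤ 48 && 0 < f.mult && 0 < f.modulus && 0 < f.period && f.period % f.div == 0 &&
  f.mult * (f.period / f.div) % f.modulus == 0 &&
  f.mult * (f.period / f.div) % baseModulus f.base == 0 &&
  f.isometries.all f.testMatrix && f.testMask && f.scan

/-- The entry of the table given by a ternary fact. -/
def TernaryFact.entry (f : TernaryFact) : MaskEntry :=
  ⟨[f.t₁, f.t₂, f.t₃], f.period, f.mask⟩

theorem natResidue_cast {Q : ℕ} (hQ : 0 < Q) (x : ℤ) : (natResidue Q x : ℤ) = x % Q :=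
  Int.toNat_of_nonneg (Int.emod_nonneg _ (by omega))

theorem natResidue_lt {Q : ℕ} (hQ : 0 < Q) (x : ℤ) : natResidue Q x < Q := by
  have := natResidue_cast hQ x
  have := Int.emod_lt_of_pos x (show (0 : ℤ) < Q by omega)
  omega

theorem natResidue_neg {Q : ℕ} (hQ : 0 < Q) (x : ℤ) :
    natResidue Q x ≤ Q / 2 ∨ natResidue Q (-x) ≤ Q / 2 := by
  by_cases h : natResidue Q x ≤ Q / 2
  · exact Or.inl h
  · right
    have h1 := natResidue_cast hQ x
    have h2 := natResidue_cast hQ (-x)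
    have h3 := natResidue_lt hQ x
    have h4 : (-x) % (Q : ℤ) = Q - x % Q := by
      have h5 : ((-x) % (Q : ℤ)) = (Q - x % Q) % Q := by
        rw [Int.sub_emod, Int.emod_emod_of_dvd _ dvd_rfl, ← Int.sub_emod, Int.sub_emod_left]
      rw [h5]
      exact Int.emod_eq_of_lt (by omega) (by omega)
    omega

section Canonical

variable {Q : ℕ} {C : ℤ → ℤ → ℤ → Prop}

theorem exists_canonical_two (hQ : 0 < Q) (neg : ∀ x y z, C x y z → C (-x) y z)
    (swap₁₂ : ∀ x y z, C x y z → C y x z) (swap₂₃ : ∀ x y z, C x y z → C x z y)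
    {x y z : ℤ} (h : C x y z) : ∃ x y z, C x y z ∧ natResidue Q x ≤ natResidue Q y ∧
      natResidue Q y ≤ natResidue Q z ∧ natResidue Q z ≤ Q / 2 := by
  obtain ⟨x, hx, h⟩ : ∃ x, natResidue Q x ≤ Q / 2 ∧ C x y z :=
    (natResidue_neg hQ x).elim (fun e => ⟨x, e, h⟩) fun e => ⟨-x, e, neg _ _ _ h⟩
  obtain ⟨y, hy, h⟩ : ∃ y, natResidue Q y ≤ Q / 2 ∧ C x y z :=
    (natResidue_neg hQ y).elim (fun e => ⟨y, e, h⟩) fun e => ⟨-y, e, swap₁₂ _ _ _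
      (neg _ _ _ (swap₁₂ _ _ _ h))⟩
  obtain ⟨z, hz, h⟩ : ∃ z, natResidue Q z ≤ Q / 2 ∧ C x y z :=
    (natResidue_neg hQ z).elim (fun e => ⟨z, e, h⟩) fun e => ⟨-z, e, swap₂₃ _ _ _ (swap₁₂ _ _ _
      (neg _ _ _ (swap₁₂ _ _ _ (swap₂₃ _ _ _ h))))⟩
  rcases le_total (natResidue Q x) (natResidue Q y) with h1 | h1 <;>
    rcases le_total (natResidue Q y) (natResidue Q z) with h2 | h2 <;>
    rcases le_total (natResidue Q x) (natResidue Q z) with h3 | h3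
  · exact ⟨x, y, z, h, h1, h2, hz⟩
  · exact ⟨x, y, z, h, h1, h2, hz⟩
  · exact ⟨x, z, y, swap₂₃ _ _ _ h, h3, h2, hy⟩
  · exact ⟨z, x, y, swap₁₂ _ _ _ (swap₂₃ _ _ _ h), h3, h1, hy⟩
  · exact ⟨y, x, z, swap₁₂ _ _ _ h, h1, h3, hz⟩
  · exact ⟨y, z, x, swap₂₃ _ _ _ (swap₁₂ _ _ _ h), h2, h3, hx⟩
  · exact ⟨z, y, x, swap₁₂ _ _ _ (swap₂₃ _ _ _ (swap₁₂ _ _ _ h)), h2, h1, hx⟩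
  · exact ⟨z, y, x, swap₁₂ _ _ _ (swap₂₃ _ _ _ (swap₁₂ _ _ _ h)), h2, h1, hx⟩

theorem exists_canonical_three (hQ : 0 < Q) (neg₁ : ∀ x y z, C x y z → C (-x) y z)
    (neg₃ : ∀ x y z, C x y z → C x y (-z)) (swap₁₂ : ∀ x y z, C x y z → C y x z)
    {x y z : ℤ} (h : C x y z) : ∃ x y z, C x y z ∧ natResidue Q x ≤ natResidue Q y ∧
      natResidue Q y ≤ Q / 2 ∧ natResidue Q z ≤ Q / 2 := by
  obtain ⟨x, hx, h⟩ : ∃ x, natResidue Q x ≤ Q / 2 ∧ C x y z :=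
    (natResidue_neg hQ x).elim (fun e => ⟨x, e, h⟩) fun e => ⟨-x, e, neg₁ _ _ _ h⟩
  obtain ⟨y, hy, h⟩ : ∃ y, natResidue Q y ≤ Q / 2 ∧ C x y z :=
    (natResidue_neg hQ y).elim (fun e => ⟨y, e, h⟩) fun e => ⟨-y, e, swap₁₂ _ _ _
      (neg₁ _ _ _ (swap₁₂ _ _ _ h))⟩
  obtain ⟨z, hz, h⟩ : ∃ z, natResidue Q z ≤ Q / 2 ∧ C x y z :=
    (natResidue_neg hQ z).elim (fun e => ⟨z, e, h⟩) fun e => ⟨-z, e, neg₃ _ _ _ h⟩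
  rcases le_total (natResidue Q x) (natResidue Q y) with h1 | h1
  · exact ⟨x, y, z, h, h1, hy, hz⟩
  · exact ⟨y, x, z, swap₁₂ _ _ _ h, h1, hx, hz⟩

theorem exists_canonical_five (hQ : 0 < Q) (neg : ∀ x y z, C x y z → C (-x) (-y) (-z))
    (swap₁₂ : ∀ x y z, C x y z → C y x z) {x y z : ℤ} (h : C x y z) :
    ∃ x y z, C x y z ∧ natResidue Q x ≤ natResidue Q y ∧ natResidue Q z ≤ Q / 2 := by
  obtain ⟨x, y, z, hz, h⟩ : ∃ x y z, natResidue Q z ≤ Q / 2 ∧ C x y z :=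
    (natResidue_neg hQ z).elim (fun e => ⟨x, y, z, e, h⟩) fun e => ⟨-x, -y, -z, e, neg _ _ _ h⟩
  rcases le_total (natResidue Q x) (natResidue Q y) with h1 | h1
  · exact ⟨x, y, z, h, h1, hz⟩
  · exact ⟨y, x, z, swap₁₂ _ _ _ h, h1, hz⟩

end Canonical

/-- Primitive solutions of the base form equation, with the parity condition. -/
def BaseSol (p : ℕ) (n : ℤ) (x y z : ℤ) : Prop :=
  baseForm p x y z = n ∧ Primitive₃ x y z ∧ (p = 2 → OddOutCond x y z)

theorem exists_baseSol {p n : ℕ} (hn : 2 < n) (h : baseSolvable p n = true) :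
    ∃ x y z, BaseSol p n x y z := by
  unfold baseSolvable at h
  split at h
  · simp only [Bool.and_eq_true, bne_iff_ne] at h
    obtain ⟨x, y, z, h1, h2, h3⟩ := exists_sum_three_squares_oddOut hn h.1 h.2
    exact ⟨x, y, z, by rw [← h1]; simp [baseForm, baseCoeffs, ternaryForm], h2, fun _ => h3⟩
  · simp only [Bool.or_eq_true, bne_iff_ne, beq_iff_eq] at h
    obtain ⟨x, y, z, h1, h2⟩ := exists_one_one_three (by omega) h
    exact ⟨x, y, z, by dsimp only at h1; rw [← h1]; simp [baseForm, baseCoeffs, ternaryForm], h2,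
      fun h => by omega⟩
  · next hp2 hp3 =>
    simp only [Bool.or_eq_true, bne_iff_ne, beq_iff_eq] at h
    obtain ⟨x, y, z, h1, h2⟩ := exists_halfDisc_five (n := n) (by omega) (by tauto)
    refine ⟨x, y, z, ?_, h2, fun h => (hp2 h).elim⟩
    dsimp only at h1
    rw [← h1]
    unfold baseForm baseCoeffs ternaryForm
    split
    next h =>
      split at h
      · exact (hp2 rfl).elim
      · exact (hp3 rfl).elim
      · simp only [Prod.mk.injEq] at h
        obtain ⟨rfl, rfl, rfl, rfl, rfl, rfl⟩ := h
        ring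

theorem BaseSol.swap₁₂ {p : ℕ} {n x y z : ℤ} (h : BaseSol p n x y z) : BaseSol p n y x z := by
  obtain ⟨h1, h2, h3⟩ := h
  refine ⟨?_, h2.swap₁₂, fun hp h => ?_⟩
  · rw [← h1]
    unfold baseForm baseCoeffs ternaryForm
    split
    next h => split at h <;> simp_all <;> (obtain ⟨rfl, rfl, rfl, rfl, rfl, rfl⟩ := h; ring)
  · obtain ⟨a, b, c⟩ := h3 hp (by rw [← h]; ring_nf)
    exact ⟨b, a, fun h1 h2 => c h1.symm (by omega)⟩

theorem BaseSol.neg {p : ℕ} {n x y z : ℤ} (h : BaseSol p n x y z) :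
    BaseSol p n (-x) (-y) (-z) := by
  obtain ⟨h1, h2, h3⟩ := h
  refine ⟨?_, fun k a b c => h2 k (by simpa using a) (by simpa using b) (by simpa using c),
    fun hp h => ?_⟩
  · rw [← h1]
    unfold baseForm ternaryForm
    split
    ring
  · obtain ⟨a, b, c⟩ := h3 hp (by rw [← h]; ring_nf)
    unfold OddOut at *
    refine ⟨?_, ?_, ?_⟩ <;> omega

theorem BaseSol.neg₁ {p : ℕ} (hp : p = 2 ∨ p = 3) {n x y z : ℤ} (h : BaseSol p n x y z) :
    BaseSol p n (-x) y z := by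
  obtain ⟨h1, h2, h3⟩ := h
  refine ⟨?_, fun k a b c => h2 k (by simpa using a) b c, fun hp h => ?_⟩
  · rw [← h1]
    rcases hp with rfl | rfl <;> simp [baseForm, baseCoeffs, ternaryForm]
  · obtain ⟨a, b, c⟩ := h3 hp (by rw [← h]; ring_nf)
    unfold OddOut at *
    refine ⟨?_, ?_, ?_⟩ <;> omega

theorem BaseSol.neg₃ {p : ℕ} (hp : p = 2 ∨ p = 3) {n x y z : ℤ} (h : BaseSol p n x y z) :
    BaseSol p n x y (-z) := by
  obtain ⟨h1, h2, h3⟩ := h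
  refine ⟨?_, fun k a b c => h2 k a b (by simpa using c), fun hp h => ?_⟩
  · rw [← h1]
    rcases hp with rfl | rfl <;> simp [baseForm, baseCoeffs, ternaryForm]
  · obtain ⟨a, b, c⟩ := h3 hp (by rw [← h]; ring_nf)
    unfold OddOut at *
    refine ⟨?_, ?_, ?_⟩ <;> omega

theorem BaseSol.swap₂₃ {n x y z : ℤ} (h : BaseSol 2 n x y z) : BaseSol 2 n x z y := by
  obtain ⟨h1, h2, h3⟩ := h
  refine ⟨?_, h2.swap₂₃, fun hp h => ?_⟩
  · rw [← h1]
    simp only [baseForm, baseCoeffs, ternaryForm]; ring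
  · obtain ⟨a, b, c⟩ := h3 hp (by rw [← h]; ring_nf)
    unfold OddOut at *
    refine ⟨?_, ?_, ?_⟩ <;> omega

theorem TernaryFact.exists_of_scan {f : TernaryFact} (h : f.scan = true) (hQ : 0 < f.modulus)
    {n x y z : ℤ} (hs : BaseSol f.base n x y z) : ∃ x y z, BaseSol f.base n x y z ∧
      f.testVector (natResidue f.modulus x) (natResidue f.modulus y)
        (natResidue f.modulus z) = true := by
  unfold TernaryFact.scan at h
  split at h
  · next hp =>
    obtain ⟨x, y, z, h1, h2, h3, h4⟩ := exists_canonical_two (C := BaseSol f.base n) hQ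
      (fun _ _ _ h => h.neg₁ (Or.inl hp)) (fun _ _ _ h => h.swap₁₂)
      (fun _ _ _ h => by rw [hp] at h ⊢; exact h.swap₂₃) hs
    exact ⟨x, y, z, h1, allBelow_iff.1 (allBelow_iff.1 (allBelow_iff.1 h _ (by omega)) _
      (by omega)) _ (by omega)⟩
  · next hp =>
    obtain ⟨x, y, z, h1, h2, h3, h4⟩ := exists_canonical_three (C := BaseSol f.base n) hQ
      (fun _ _ _ h => h.neg₁ (Or.inr hp)) (fun _ _ _ h => h.neg₃ (Or.inr hp))
      (fun _ _ _ h => h.swap₁₂) hs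
    exact ⟨x, y, z, h1, allBelow_iff.1 (allBelow_iff.1 (allBelow_iff.1 h _ (by omega)) _
      (by omega)) _ (by omega)⟩
  · obtain ⟨x, y, z, h1, h2, h3⟩ := exists_canonical_five (C := BaseSol f.base n) hQ
      (fun _ _ _ h => h.neg) (fun _ _ _ h => h.swap₁₂) hs
    exact ⟨x, y, z, h1, allBelow_iff.1 (allBelow_iff.1 (allBelow_iff.1 h _ (by omega)) _
      (natResidue_lt hQ y)) _ (by omega)⟩

theorem baseNat_cast (p x y z : ℕ) : (baseNat p x y z : ℤ) = baseForm p x y z := by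
  by_cases h2 : p = 2
  · subst h2
    simp only [baseNat, baseForm, baseCoeffs, ternaryForm, Nat.add_eq, Nat.mul_eq, Nat.beq_refl,
      cond_true]
    push_cast
    ring
  by_cases h3 : p = 3
  · subst h3
    simp only [baseNat, baseForm, baseCoeffs, ternaryForm, Nat.add_eq, Nat.mul_eq,
      show Nat.beq 3 2 = false from rfl, Nat.beq_refl, cond_true, cond_false]
    push_cast
    ring
  have e2 : Nat.beq p 2 = false := by
    rw [Bool.eq_false_iff]; exact fun h => h2 (Nat.eq_of_beq_eq_true h)
  have e3 : Nat.beq p 3 = false := by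
    rw [Bool.eq_false_iff]; exact fun h => h3 (Nat.eq_of_beq_eq_true h)
  unfold baseNat baseForm baseCoeffs ternaryForm
  rw [e2, e3]
  simp only [cond_false, Nat.add_eq, Nat.mul_eq]
  push_cast
  ring

theorem baseForm_modEq (p : ℕ) {Q : ℤ} {x y z x' y' z' : ℤ} (hx : x ≡ x' [ZMOD Q])
    (hy : y ≡ y' [ZMOD Q]) (hz : z ≡ z' [ZMOD Q]) :
    baseForm p x y z ≡ baseForm p x' y' z' [ZMOD Q] := by
  unfold baseForm ternaryForm
  split
  gcongr

theorem natResidue_modEq {Q : ℕ} (hQ : 0 < Q) (x : ℤ) : (natResidue Q x : ℤ) ≡ x [ZMOD Q] := by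
  rw [natResidue_cast hQ]; exact Int.mod_modEq _ _

theorem natResidue_mod {Q d : ℕ} (hQ : 0 < Q) (hd : d ∣ Q) (x : ℤ) :
    ((natResidue Q x % d : ℕ) : ℤ) = x % d := by
  push_cast
  exact (natResidue_modEq hQ x).of_dvd (by exact_mod_cast hd)

theorem TernaryFact.not_skip {f : TernaryFact} (hQ : 0 < f.modulus) {n x y z : ℤ}
    (hs : BaseSol f.base n x y z) : f.skip (natResidue f.modulus x) (natResidue f.modulus y)
      (natResidue f.modulus z) = false := by
  obtain ⟨-, hp, ho⟩ := hs
  have hprime : ∀ d : ℕ, 2 ≤ d → (f.modulus % d == 0 && natResidue f.modulus x % d == 0 &&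
      natResidue f.modulus y % d == 0 && natResidue f.modulus z % d == 0) = false := by
    intro d hd
    rw [← Bool.not_eq_true]
    intro h
    simp only [Bool.and_eq_true, beq_iff_eq] at h
    obtain ⟨⟨⟨h0, h1⟩, h2⟩, h3⟩ := h
    have h0 := Nat.dvd_of_mod_eq_zero h0
    have e1 := natResidue_mod hQ h0 x
    have e2 := natResidue_mod hQ h0 y
    have e3 := natResidue_mod hQ h0 z
    rw [h1] at e1; rw [h2] at e2; rw [h3] at e3
    have := hp d (Int.dvd_of_emod_eq_zero e1.symm) (Int.dvd_of_emod_eq_zero e2.symm)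
      (Int.dvd_of_emod_eq_zero e3.symm)
    have := Int.le_of_dvd one_pos this
    omega
  have hodd : (f.base == 2 && f.modulus % 6 == 0 && !oddOutCondB (natResidue f.modulus x)
      (natResidue f.modulus y) (natResidue f.modulus z)) = false := by
    rw [← Bool.not_eq_true]
    intro h
    simp only [Bool.and_eq_true, beq_iff_eq, Bool.not_eq_true'] at h
    obtain ⟨⟨hb, h6⟩, hc⟩ := h
    have h2 : 2 ∣ f.modulus := by omega
    have h3 : 3 ∣ f.modulus := by omega
    have x2 := natResidue_mod hQ h2 x
    have y2 := natResidue_mod hQ h2 y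
    have z2 := natResidue_mod hQ h2 z
    have x3 := natResidue_mod hQ h3 x
    have y3 := natResidue_mod hQ h3 y
    have z3 := natResidue_mod hQ h3 z
    have hsum : (((natResidue f.modulus x * natResidue f.modulus x +
        natResidue f.modulus y * natResidue f.modulus y +
        natResidue f.modulus z * natResidue f.modulus z) % 3 : ℕ) : ℤ) =
        (x ^ 2 + y ^ 2 + z ^ 2) % 3 := by
      push_cast
      have hx := (natResidue_modEq hQ x).of_dvd (show (3 : ℤ) ∣ f.modulus by exact_mod_cast h3)
      have hy := (natResidue_modEq hQ y).of_dvd (show (3 : ℤ) ∣ f.modulus by exact_mod_cast h3)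
      have hz := (natResidue_modEq hQ z).of_dvd (show (3 : ℤ) ∣ f.modulus by exact_mod_cast h3)
      simp only [pow_two]
      exact ((hx.mul hx).add (hy.mul hy)).add (hz.mul hz)
    have ho := ho hb
    simp only [oddOutCondB, oddOutB, Bool.or_eq_false_iff, Bool.and_eq_false_iff, bne_eq_false_iff_eq,
      beq_eq_false_iff_ne] at hc
    unfold OddOutCond OddOut at ho
    obtain ⟨a, b, c⟩ := ho (by rw [← hsum, hc.1]; rfl)
    generalize natResidue f.modulus x = rx at *
    generalize natResidue f.modulus y = ry at *
    generalize natResidue f.modulus z = rz at *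
    push_cast at x2 y2 z2 x3 y3 z3
    rcases hc.2 with (hc | hc) | hc
    · exact a (by omega) (by omega) (by omega)
    · exact b (by omega) (by omega) (by omega)
    · exact c (by omega) (by omega) (by omega)
  unfold TernaryFact.skip
  rw [hprime 2 le_rfl, hprime 3 (by norm_num), hprime 5 (by norm_num), hodd]
  rfl

theorem Primitive₃.dvd_of_dvd_mul {x y z a k : ℤ} (h : Primitive₃ x y z) (hx : k ∣ a * x)
    (hy : k ∣ a * y) (hz : k ∣ a * z) : k ∣ a := by
  obtain ⟨A, B, h1⟩ : ∃ A B, ((Int.gcd x y : ℕ) : ℤ) = x * A + y * B :=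
    ⟨_, _, Int.gcd_eq_gcd_ab x y⟩
  obtain ⟨C, D, h2⟩ : ∃ C D, ((Int.gcd (Int.gcd x y) z : ℕ) : ℤ) = (Int.gcd x y : ℕ) * C + z * D :=
    ⟨_, _, Int.gcd_eq_gcd_ab _ z⟩
  have h3 : ((Int.gcd (Int.gcd x y) z : ℕ) : ℤ) = 1 := by
    have h4 := h (Int.gcd (Int.gcd x y) z)
      ((Int.gcd_dvd_left _ _).trans (Int.gcd_dvd_left _ _))
      ((Int.gcd_dvd_left _ _).trans (Int.gcd_dvd_right _ _)) (Int.gcd_dvd_right _ _)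
    rcases Int.isUnit_iff.1 (isUnit_of_dvd_one h4) with h5 | h5 <;> omega
  rw [h3, h1] at h2
  rw [← mul_one a, h2, show a * ((x * A + y * B) * C + z * D) =
    a * x * (A * C) + a * y * (B * C) + a * z * D by ring]
  exact dvd_add (dvd_add (hx.mul_right _) (hy.mul_right _)) (hz.mul_right _)

/-- The determinant of the matrix. -/
def ScaledIsometry.det (g : ScaledIsometry) : ℤ :=
  g.a₁ * (g.b₂ * g.c₃ - g.b₃ * g.c₂) - g.a₂ * (g.b₁ * g.c₃ - g.b₃ * g.c₁) +
    g.a₃ * (g.b₁ * g.c₂ - g.b₂ * g.c₁)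

theorem coordResidue_modEq {D : ℕ} (hD : 0 < D) (a b c : ℤ) {x y z : ℤ} {X Y Z : ℕ}
    (hx : (X : ℤ) ≡ x [ZMOD D]) (hy : (Y : ℤ) ≡ y [ZMOD D]) (hz : (Z : ℤ) ≡ z [ZMOD D]) :
    (coordResidue D a b c X Y Z : ℤ) ≡ a * x + b * y + c * z [ZMOD D] := by
  have := ((natResidue_modEq hD a).mul hx).add (((natResidue_modEq hD b).mul hy).add
    ((natResidue_modEq hD c).mul hz))
  rw [add_assoc]
  convert this using 1
  change ((natResidue D a * X + (natResidue D b * Y + natResidue D c * Z) : ℕ) : ℤ) = _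
  push_cast
  rfl

theorem exists_of_goodCoord {k : Bool} {d D n : ℕ} {v : ℤ} (hd : d ∣ D) (hD : k = true → D = 3 * d)
    (hn : (n : ℤ) ≡ v [ZMOD D]) (h : goodCoord k d D n = true) :
    ∃ u : ℤ, v = d * u ∧ (k = true → ¬ 3 ∣ u) := by
  simp only [goodCoord, Bool.cond_eq_ite, Bool.if_false_right,
    Bool.if_true_right, Bool.and_eq_true, Bool.or_eq_true, decide_eq_true_eq, Nat.beq_eq,
    Bool.not_eq_true', decide_eq_false_iff_not] at h
  have h1 : (n : ℤ) ≡ v [ZMOD d] := hn.of_dvd (by exact_mod_cast hd)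
  obtain ⟨u, rfl⟩ : (d : ℤ) ∣ v :=
    h1.dvd_iff.1 (by exact_mod_cast Nat.dvd_of_mod_eq_zero h.1)
  refine ⟨u, rfl, fun hk ⟨w, hw⟩ => ?_⟩
  have h2 : ((D : ℕ) : ℤ) ∣ n := hn.dvd_iff.2 ⟨w, by rw [hD hk, hw]; push_cast; ring⟩
  have h3 : Nat.mod n D = 0 := Nat.mod_eq_zero_of_dvd (by exact_mod_cast h2)
  simp [hk, h3] at h

/-- The content of a ternary fact. -/
theorem TernaryFact.exists_rep {f : TernaryFact} (h : f.test = true) {m : ℕ} (hm : 10000 < m)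
    (hmask : f.mask.testBit (m % f.period)) : ∃ g ∈ f.isometries, ∃ x y z : ℤ,
      sqCoeff f.t₁ * x ^ 2 + sqCoeff f.t₂ * y ^ 2 + sqCoeff f.t₃ * z ^ 2 = (m : ℤ) ∧
      (f.t₁.2 = true → ¬ 3 ∣ x) ∧ (f.t₂.2 = true → ¬ 3 ∣ y) ∧ (f.t₃.2 = true → ¬ 3 ∣ z) ∧
      ∀ k : ℤ, k ∣ x → k ∣ y → k ∣ z → k ∣ g.det := by
  simp only [TernaryFact.test, Bool.and_eq_true, decide_eq_true_eq, beq_iff_eq,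
    List.all_eq_true] at h
  obtain ⟨⟨⟨⟨⟨⟨⟨⟨⟨⟨hdiv, hdiv'⟩, hmult⟩, hQ⟩, hP⟩, hPd⟩, hPQ⟩, hPb⟩, hmat⟩, htm⟩, hscan⟩ := h
  have hj := allBelow_iff.1 htm (m % f.period) (Nat.mod_lt _ hP)
  rw [hmask] at hj
  simp only [Bool.not_true, Bool.false_or, Bool.and_eq_true, beq_iff_eq] at hj
  obtain ⟨⟨hjd, hjs⟩, hjr⟩ := hj
  obtain ⟨P', hP'⟩ := Nat.dvd_of_mod_eq_zero hPd
  obtain ⟨j', hj'⟩ := Nat.dvd_of_mod_eq_zero hjd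
  rw [hP', Nat.mul_div_cancel_left _ hdiv] at hPQ hPb
  rw [hj', Nat.mul_div_cancel_left _ hdiv] at hjs hjr
  obtain ⟨n, hn⟩ : ∃ n, n = j' + P' * (m / f.period) := ⟨_, rfl⟩
  have hmn : m = f.div * n := by
    conv_lhs => rw [← Nat.mod_add_div m f.period, hj']
    rw [hn, mul_add, ← mul_assoc, ← hP']
  have hMQ : ∀ e, f.mult * P' % e = 0 → f.mult * n % e = f.mult * j' % e := by
    intro e he
    obtain ⟨c, hc⟩ := Nat.dvd_of_mod_eq_zero he
    rw [hn, mul_add, ← mul_assoc, hc, mul_assoc, Nat.add_mul_mod_self_left]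
  have hn2 : 2 < f.mult * n := by
    have : 2 < n := by
      by_contra hlt
      have : f.div * n ≤ 48 * 2 := Nat.mul_le_mul hdiv' (by omega)
      omega
    exact lt_of_lt_of_le this (Nat.le_mul_of_pos_left n hmult)
  have hsolv : baseSolvable f.base (f.mult * n) = true := by
    have := hMQ _ hPb
    rw [← hjs]
    unfold baseModulus at this
    unfold baseSolvable
    split at this
    · rw [this, show f.mult * n % 4 = f.mult * j' % 4 by omega]
    · rw [this, show f.mult * n % 3 = f.mult * j' % 3 by omega]
    · rw [this, show f.mult * n % 5 = f.mult * j' % 5 by omega]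
  obtain ⟨x₀, y₀, z₀, h₀⟩ := exists_baseSol hn2 hsolv
  obtain ⟨x, y, z, hsol, htest⟩ := f.exists_of_scan hscan hQ h₀
  have hres : baseNat f.base (natResidue f.modulus x) (natResidue f.modulus y)
      (natResidue f.modulus z) % f.modulus = f.mult * j' % f.modulus := by
    rw [← hMQ _ hPQ]
    have h1 := baseForm_modEq f.base (natResidue_modEq hQ x) (natResidue_modEq hQ y)
      (natResidue_modEq hQ z)
    rw [← baseNat_cast, hsol.1] at h1
    exact Int.natCast_modEq_iff.1 h1
  have hbit : Nat.beq (Nat.mod (Nat.shiftRight f.residues (Nat.mod (baseNat f.base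
      (natResidue f.modulus x) (natResidue f.modulus y) (natResidue f.modulus z)) f.modulus)) 2) 0
      = false := by
    rw [← Bool.not_eq_true, Nat.beq_eq]
    change ¬ (f.residues >>> (baseNat f.base (natResidue f.modulus x) (natResidue f.modulus y)
      (natResidue f.modulus z) % f.modulus) % 2 = 0)
    rw [Nat.testBit_eq_decide_div_mod_eq, decide_eq_true_eq] at hjr
    rw [hres, Nat.shiftRight_eq_div_pow, hjr]
    norm_num
  unfold TernaryFact.testVector at htest
  rw [hbit, f.not_skip hQ hsol, cond_false, Bool.false_or, List.any_eq_true] at htest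
  obtain ⟨g, hg, htest⟩ := htest
  have hm' := hmat g hg
  unfold TernaryFact.testMatrix at hm'
  simp only [Bool.and_eq_true, decide_eq_true_eq, beq_iff_eq] at hm'
  obtain ⟨⟨⟨⟨⟨⟨⟨hd, hdQ⟩, e1⟩, e2⟩, e3⟩, e4⟩, e5⟩, e6⟩ := hm'
  have hdD : g.den ∣ f.testModulus g := by
    unfold TernaryFact.testModulus
    cases f.t₁.2 || f.t₂.2 || f.t₃.2
    · exact dvd_rfl
    · exact dvd_mul_left _ _
  have hdQ' : f.testModulus g ∣ f.modulus := Nat.dvd_of_mod_eq_zero hdQ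
  have hcongr : ∀ a b c : ℤ, (coordResidue (f.testModulus g) a b c (natResidue f.modulus x)
      (natResidue f.modulus y) (natResidue f.modulus z) : ℤ) ≡ a * x + b * y + c * z
      [ZMOD f.testModulus g] := by
    have hdQ' : (f.testModulus g : ℤ) ∣ f.modulus := by exact_mod_cast hdQ'
    exact fun a b c => coordResidue_modEq (Nat.pos_of_dvd_of_pos (by assumption) hQ) a b c
      ((natResidue_modEq hQ x).of_dvd hdQ') ((natResidue_modEq hQ y).of_dvd hdQ')
      ((natResidue_modEq hQ z).of_dvd hdQ')
  simp only [TernaryFact.testIsometry, Bool.and_eq_true] at htest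
  obtain ⟨⟨g1, g2⟩, g3⟩ := htest
  obtain ⟨u, hu, hu3⟩ := exists_of_goodCoord hdD
    (fun hk => by simp [TernaryFact.testModulus, hk]) (hcongr _ _ _) g1
  obtain ⟨v, hv, hv3⟩ := exists_of_goodCoord hdD
    (fun hk => by simp [TernaryFact.testModulus, hk]) (hcongr _ _ _) g2
  obtain ⟨w, hw, hw3⟩ := exists_of_goodCoord hdD
    (fun hk => by simp [TernaryFact.testModulus, hk]) (hcongr _ _ _) g3
  refine ⟨g, hg, u, v, w, ?_, hu3, hv3, hw3, fun k ⟨p, hp⟩ ⟨q, hq⟩ ⟨r, hr⟩ => ?_⟩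
  · have hform : (f.mult : ℤ) * (sqCoeff f.t₁ * (g.a₁ * x + g.a₂ * y + g.a₃ * z) ^ 2 +
        sqCoeff f.t₂ * (g.b₁ * x + g.b₂ * y + g.b₃ * z) ^ 2 +
        sqCoeff f.t₃ * (g.c₁ * x + g.c₂ * y + g.c₃ * z) ^ 2) =
        g.den * g.den * f.div * baseForm f.base x y z := by
      unfold baseForm ternaryForm
      generalize baseCoeffs f.base = cs at *
      obtain ⟨a, b, c, r, s, t⟩ := cs
      dsimp only at *
      linear_combination x ^ 2 * e1 + y ^ 2 * e2 + z ^ 2 * e3 + y * z * e4 + x * z * e5 +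
        x * y * e6
    rw [hu, hv, hw, hsol.1] at hform
    have hne : (f.mult : ℤ) * (g.den * g.den) ≠ 0 := by positivity
    refine mul_left_cancel₀ hne ?_
    rw [hmn]
    push_cast at hform ⊢
    linear_combination hform
  · have hprim := hsol.2.1
    have key : ∀ a b c t : ℤ, g.det * t = g.den * (a * u + b * v + c * w) → k ∣ g.det * t := by
      intro a b c t h
      exact ⟨g.den * (a * p + b * q + c * r), by rw [h, hp, hq, hr]; ring⟩
    have hx := key (g.b₂ * g.c₃ - g.b₃ * g.c₂) (g.a₃ * g.c₂ - g.a₂ * g.c₃)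
      (g.a₂ * g.b₃ - g.a₃ * g.b₂) x (by
        unfold ScaledIsometry.det
        linear_combination hu * (g.b₂ * g.c₃ - g.b₃ * g.c₂) + hv * (g.a₃ * g.c₂ - g.a₂ * g.c₃) +
        hw * (g.a₂ * g.b₃ - g.a₃ * g.b₂))
    have hy := key (g.b₃ * g.c₁ - g.b₁ * g.c₃) (g.a₁ * g.c₃ - g.a₃ * g.c₁)
      (g.a₃ * g.b₁ - g.a₁ * g.b₃) y (by
        unfold ScaledIsometry.det
        linear_combination hu * (g.b₃ * g.c₁ - g.b₁ * g.c₃) + hv * (g.a₁ * g.c₃ - g.a₃ * g.c₁) +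
        hw * (g.a₃ * g.b₁ - g.a₁ * g.b₃))
    have hz := key (g.b₁ * g.c₂ - g.b₂ * g.c₁) (g.a₂ * g.c₁ - g.a₁ * g.c₂)
      (g.a₁ * g.b₂ - g.a₂ * g.b₁) z (by
        unfold ScaledIsometry.det
        linear_combination hu * (g.b₁ * g.c₂ - g.b₂ * g.c₁) + hv * (g.a₂ * g.c₁ - g.a₁ * g.c₂) +
        hw * (g.a₁ * g.b₂ - g.a₂ * g.b₁))
    exact hprim.dvd_of_dvd_mul hx hy hz

theorem TernaryFact.sound {f : TernaryFact} (h : f.test = true) : f.entry.Sound := by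
  intro m hm hmask
  obtain ⟨g, -, x, y, z, he, hx, hy, hz, -⟩ := f.exists_rep h hm hmask
  exact ⟨x, hx, y, hy, z, hz, show _ = (0 : ℤ) by rw [← he]; ring⟩

/-- A descent used to make a variable prime to `3`. -/
theorem exists_not_three_dvd_of_step {C : ℤ → ℤ → Prop}
    (step : ∀ a b, C (3 * a) (3 * b) → C (2 * a - b) (-5 * a - 2 * b) ∧
      C (-2 * a - b) (5 * a - 2 * b)) (n : ℕ) : ∀ u w : ℤ, C u w → 3 ∣ u → 3 ∣ w →
      ¬ ((3 : ℤ) ^ (n + 1) ∣ u ∧ (3 : ℤ) ^ (n + 1) ∣ w) → ∃ u' w', C u' w' ∧ ¬ 3 ∣ u' := by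
  induction n with
  | zero => intro u w _ h1 h2 h3; simp [h1, h2] at h3
  | succ n ih =>
    intro u w hC hu hw hn
    by_cases hd : (3 : ℤ) ^ (n + 1) ∣ u ∧ (3 : ℤ) ^ (n + 1) ∣ w
    · obtain ⟨⟨a, rfl⟩, ⟨b, rfl⟩⟩ := hd
      have hab : ¬ (3 ∣ a ∧ 3 ∣ b) := fun h => hn
        ⟨by rw [pow_succ]; exact mul_dvd_mul_left _ h.1,
          by rw [pow_succ]; exact mul_dvd_mul_left _ h.2⟩
      have key : ∀ c d : ℤ, C (3 ^ n * c) (3 ^ n * d) → ¬ 3 ∣ c → ∃ u' w', C u' w' ∧ ¬ 3 ∣ u' := by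
        intro c d hC hc
        cases n with
        | zero => exact ⟨_, _, hC, by simpa using hc⟩
        | succ n =>
          refine ih _ _ hC ?_ ?_ fun h => hc ?_
          · rw [pow_succ']; exact dvd_mul_of_dvd_left (dvd_mul_right _ _) _
          · rw [pow_succ']; exact dvd_mul_of_dvd_left (dvd_mul_right _ _) _
          · have := h.1
            rw [pow_succ _ (n + 1)] at this
            exact (mul_dvd_mul_iff_left (by positivity)).1 this
      rw [pow_succ', mul_assoc, mul_assoc] at hC
      obtain ⟨h1, h2⟩ := step _ _ hC
      by_cases hc : 3 ∣ 2 * a - b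
      · refine key (-2 * a - b) (5 * a - 2 * b) ?_ (by omega)
        convert h2 using 1 <;> ring
      · refine key (2 * a - b) (-5 * a - 2 * b) ?_ hc
        convert h1 using 1 <;> ring
    · exact ih u w hC hu hw hd

theorem exists_not_three_dvd_of_step' {C : ℤ → ℤ → Prop}
    (step : ∀ a b, C (3 * a) (3 * b) → C (2 * a - b) (-5 * a - 2 * b) ∧
      C (-2 * a - b) (5 * a - 2 * b)) {u w : ℤ} (h : C u w) (hu : 3 ∣ u) (hw : 3 ∣ w)
    (h0 : u ≠ 0 ∨ w ≠ 0) : ∃ u' w', C u' w' ∧ ¬ 3 ∣ u' := by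
  have hlt : ∀ x : ℤ, x ≠ 0 → ∀ n : ℕ, x.natAbs ≤ n → ¬ (3 : ℤ) ^ (n + 1) ∣ x := by
    intro x hx n hn hd
    have h1 := Int.natAbs_dvd_natAbs.2 hd
    have h2 := Nat.le_of_dvd (Int.natAbs_pos.2 hx) h1
    rw [Int.natAbs_pow] at h2
    have h3 : n + 1 < 3 ^ (n + 1) := Nat.lt_pow_self (by norm_num)
    change 3 ^ (n + 1) ≤ _ at h2
    omega
  refine exists_not_three_dvd_of_step step (u.natAbs + w.natAbs) u w h hu hw fun hd => ?_
  rcases h0 with h0 | h0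
  · exact hlt u h0 _ (by omega) hd.1
  · exact hlt w h0 _ (by omega) hd.2

/-- Representations by `y² + 3 z² + 6 x²` with `3 ∤ y z`. -/
theorem exists_one_three_six {m x y z : ℤ} (h : y ^ 2 + 3 * z ^ 2 + 6 * x ^ 2 = m)
    (hy : ¬ 3 ∣ y) (h0 : z ≠ 0 ∨ x ≠ 0) :
    ∃ x y z : ℤ, y ^ 2 + 3 * z ^ 2 + 6 * x ^ 2 = m ∧ ¬ 3 ∣ y ∧ ¬ 3 ∣ z := by
  by_cases hz : 3 ∣ z
  · by_cases hx : 3 ∣ x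
    · obtain ⟨z', x', he, hz', -, -⟩ := exists_one_two_prime_to_three _ z x le_rfl h0 hz hx
      exact ⟨x', y, z', by linear_combination h + 3 * he, hy, hz'⟩
    · obtain ⟨y, h, hy, hyx⟩ : ∃ y' : ℤ, y' ^ 2 + 3 * z ^ 2 + 6 * x ^ 2 = m ∧ ¬ 3 ∣ y' ∧
          3 ∣ y' + 2 * x := by
        by_cases hs : 3 ∣ y + 2 * x
        · exact ⟨y, h, hy, hs⟩
        · refine ⟨-y, by rw [neg_sq]; exact h, by omega, ?_⟩
          rcases (by omega : y % 3 = 1 ∨ y % 3 = 2) with e | e <;>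
            rcases (by omega : x % 3 = 1 ∨ x % 3 = 2) with e' | e' <;> omega
      by_cases hne : z ≠ 0 ∨ y + 2 * x ≠ 0
      · obtain ⟨u, w, ⟨y, x, h1, h2, -⟩, h3⟩ := exists_not_three_dvd_of_step'
          (C := fun u w => ∃ y x : ℤ, y ^ 2 + 3 * u ^ 2 + 6 * x ^ 2 = m ∧ ¬ 3 ∣ y ∧ w = y + 2 * x)
          (by
            rintro a b ⟨y, x, h1, h2, h3⟩
            exact ⟨⟨-3 * a - 2 * x, x - a - b, by rw [← h1, show y = 3 * b - 2 * x by linarith]; ring,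
              by omega, by linarith⟩, ⟨3 * a - 2 * x, x + a - b, by
                rw [← h1, show y = 3 * b - 2 * x by linarith]; ring, by omega, by linarith⟩⟩)
          ⟨y, x, h, hy, rfl⟩ hz hyx hne
        exact ⟨x, y, u, h1, h2, h3⟩
      · push Not at hne
        exact ⟨x, x, x, by rw [← h, hne.1, show y = -2 * x by linarith]; ring, hx, hx⟩
  · exact ⟨x, y, z, h, hy, hz⟩

/-- Representations by `3 x² + 2 y² + 6 w²` with `3 ∤ y w`. -/
theorem exists_two_three_six {m x y w : ℤ} (h : 3 * x ^ 2 + 2 * y ^ 2 + 6 * w ^ 2 = m)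
    (hy : ¬ 3 ∣ y) (h0 : x ≠ 0 ∨ w ≠ 0) (h5 : w = 0 → x ≠ y ∧ x ≠ -y) :
    ∃ x y w : ℤ, 3 * x ^ 2 + 2 * y ^ 2 + 6 * w ^ 2 = m ∧ ¬ 3 ∣ y ∧ ¬ 3 ∣ w := by
  by_cases hw : 3 ∣ w
  · by_cases hx : 3 ∣ x
    · obtain ⟨x', w', he, -, hw', -⟩ := exists_one_two_prime_to_three _ x w le_rfl h0 hx hw
      exact ⟨x', y, w', by linear_combination h + 3 * he, hy, hw'⟩
    · obtain ⟨y, h, hy, hyx, h5⟩ : ∃ y' : ℤ, 3 * x ^ 2 + 2 * y' ^ 2 + 6 * w ^ 2 = m ∧ ¬ 3 ∣ y' ∧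
          3 ∣ x + y' ∧ (w = 0 → x ≠ -y') := by
        by_cases hs : 3 ∣ x + y
        · exact ⟨y, h, hy, hs, fun hw => (h5 hw).2⟩
        · refine ⟨-y, by rw [neg_sq]; exact h, by omega, ?_, fun hw => by
            rw [neg_neg]; exact (h5 hw).1⟩
          rcases (by omega : y % 3 = 1 ∨ y % 3 = 2) with e | e <;> omega
      obtain ⟨u, s, ⟨y, x, h1, h2, -⟩, h3⟩ := exists_not_three_dvd_of_step'
          (C := fun u s => ∃ y x : ℤ, 3 * x ^ 2 + 2 * y ^ 2 + 6 * u ^ 2 = m ∧ ¬ 3 ∣ y ∧ s = x + y)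
          (by
            rintro a b ⟨y, x, h1, h2, h3⟩
            exact ⟨⟨-x - 3 * a, x - 2 * b - 2 * a, by
                rw [← h1, show y = 3 * b - x by linarith]; ring, by omega, by linarith⟩,
              ⟨-x + 3 * a, x - 2 * b + 2 * a, by
                rw [← h1, show y = 3 * b - x by linarith]; ring, by omega, by linarith⟩⟩)
          ⟨y, x, h, hy, rfl⟩ hw hyx (by
            by_contra hne
            push Not at hne
            exact h5 hne.1 (by linarith))
      exact ⟨x, y, u, h1, h2, h3⟩
  · exact ⟨x, y, w, h, hy, hw⟩

/-- All determinants of the isometries are nonzero and small. -/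
def TernaryFact.smallDet (f : TernaryFact) : Bool :=
  f.isometries.all fun g => g.det != 0 && g.det.natAbs ≤ 44

theorem TernaryFact.natAbs_le_of_smallDet {f : TernaryFact} (h : f.smallDet = true)
    {g : ScaledIsometry} (hg : g ∈ f.isometries) {k : ℤ} (hk : k ∣ g.det) : k ^ 2 ≤ 44 ^ 2 := by
  have := List.all_eq_true.1 h g hg
  simp only [Bool.and_eq_true, bne_iff_ne, decide_eq_true_eq] at this
  have h1 := Nat.le_of_dvd (Int.natAbs_pos.2 this.1) (Int.natAbs_dvd_natAbs.2 hk)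
  rw [sq_le_sq, Int.abs_eq_natAbs, Int.abs_eq_natAbs]
  exact_mod_cast h1.trans this.2

/-- The terms `x² + P₈(y) + 2 z²` yield `P₈(y) + 2 x² + 3 P₈(z)`. -/
theorem TernaryFact.sound_one_three_six {f : TernaryFact} (h : f.test = true)
    (hd : f.smallDet = true) (ht : f.entry.terms = [(1, false), (1, true), (2, false)]) :
    MaskEntry.Sound ⟨[(1, true), (2, false), (3, true)], f.period, f.mask⟩ := by
  intro m hm hmask
  simp only [TernaryFact.entry, List.cons.injEq, and_true] at ht
  obtain ⟨g, hg, z, y, x, he, -, hy, -, hk⟩ := f.exists_rep h hm hmask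
  rw [ht.1, ht.2.1, ht.2.2] at he
  rw [ht.2.1] at hy
  obtain ⟨x, y, z, h1, h2, h3⟩ := exists_one_three_six (m := m) (x := x) (y := y) (z := z)
    (by rw [← he]; simp only [sqCoeff]; push_cast; simp; ring) (hy rfl) (by
      by_contra hc
      push Not at hc
      have := f.natAbs_le_of_smallDet hd hg (hk y (by simp [hc.1]) dvd_rfl (by simp [hc.2]))
      rw [hc.1, hc.2] at he
      simp [sqCoeff] at he
      omega)
  refine ⟨y, fun _ => h2, x, fun h => by simp at h, z, fun _ => h3, ?_⟩
  change (_ : ℤ) = 0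
  rw [← h1]
  simp only [sqCoeff]; push_cast; simp; ring

/-- The terms `x² + 2 y² + 2 P₈(z)` yield `x² + 2 P₈(y) + 6 P₈(z)`. -/
theorem TernaryFact.sound_two_three_six {f : TernaryFact} (h : f.test = true)
    (hd : f.smallDet = true) (ht : f.entry.terms = [(1, false), (2, false), (2, true)]) :
    MaskEntry.Sound ⟨[(1, false), (2, true), (6, true)], f.period, f.mask⟩ := by
  intro m hm hmask
  simp only [TernaryFact.entry, List.cons.injEq, and_true] at ht
  obtain ⟨g, hg, x, w, y, he, -, -, hy, hk⟩ := f.exists_rep h hm hmask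
  rw [ht.1, ht.2.1, ht.2.2] at he
  rw [ht.2.2] at hy
  simp only [sqCoeff, Bool.false_eq_true, if_true, if_false] at he
  have hsmall : ∀ k : ℤ, k ∣ x → k ∣ w → k ∣ y → k ^ 2 ≤ 44 ^ 2 := fun k h1 h2 h3 =>
    f.natAbs_le_of_smallDet hd hg (hk k h1 h2 h3)
  obtain ⟨x, y, w, h1, h2, h3⟩ := exists_two_three_six (m := m) (x := x) (y := y) (w := w)
    (by rw [← he]; push_cast; ring) (hy rfl) (by
      by_contra hc
      push Not at hc
      have := hsmall y (by simp [hc.1]) (by simp [hc.2]) dvd_rfl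
      rw [hc.1, hc.2] at he
      push_cast at he
      omega) (by
      intro hw
      constructor <;> intro hxy
      · have := hsmall y (by simp [hxy]) (by simp [hw]) dvd_rfl
        rw [hw, hxy] at he
        push_cast at he
        omega
      · have := hsmall y (by simp [hxy]) (by simp [hw]) dvd_rfl
        rw [hw, hxy, neg_sq] at he
        push_cast at he
        omega)
  refine ⟨x, fun h => by simp at h, y, fun _ => h2, w, fun _ => h3, ?_⟩
  change (_ : ℤ) = 0
  rw [← h1]
  simp only [sqCoeff, Bool.false_eq_true, if_true, if_false]; push_cast; ring

/-- Ternary subsums used for the leaves of the escalator tree. -/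
def ternaryFacts : List TernaryFact := [
  ⟨(1, true), (2, true), (3, true), 2, 1, 24, 3, 7,
    [⟨1, 2, 4, -2, 2, -2, -2, 2, 0, 2⟩],
    576, 878694152870967769856139293217963835853594009007997413940950113597993970688606652697101586309075505526974523754440480677580042920399286109894227599715236577280⟩,
  ⟨(1, true), (2, true), (3, false), 2, 3, 6, 9, 73,
    [⟨3, 3, 3, 0, 0, 0, 3, 1, -1, 0⟩, ⟨3, 3, -3, 0, 0, 0, 3, 1, 1, 0⟩],
    144, 353893682696553849483487107371173505404992⟩,
  ⟨(1, false), (1, true), (3, false), 3, 1, 1, 9, 146,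
    [⟨3, 0, 0, 3, 0, 3, 0, 1, 0, 0⟩, ⟨3, 0, 0, 3, 3, 0, 0, 0, 1, 0⟩], 9, 146⟩,
  ⟨(1, false), (2, false), (8, false), 2, 1, 3, 8, 78,
    [⟨4, 4, 0, 0, 0, 2, 2, 0, 1, -1⟩, ⟨4, 0, 0, 4, 2, 2, 0, 1, -1, 0⟩,
    ⟨4, 0, 4, 0, 2, 0, -2, 1, 0, 1⟩, ⟨4, 4, 0, 0, 0, 2, -2, 0, 1, 1⟩,
    ⟨4, 0, 0, 4, 2, -2, 0, 1, 1, 0⟩], 24, 262728⟩,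
  ⟨(1, false), (2, true), (4, true), 2, 1, 6, 6, 63,
    [⟨2, 0, 2, 2, 2, 2, -2, 2, -1, 1⟩, ⟨2, 2, 2, 0, 2, -2, 2, 1, -1, -2⟩,
    ⟨2, 2, 0, -2, 2, -2, 2, 1, 2, 1⟩], 144, 5529609561241859875049522531886220709952⟩,
  ⟨(1, false), (1, true), (4, true), 3, 1, 1, 12, 2336,
    [⟨2, 0, 0, 2, 2, 0, 0, 0, 1, 0⟩, ⟨2, 0, 0, 2, 0, 2, 0, 1, 0, 0⟩,
    ⟨4, 2, 0, -2, 0, 4, 0, 1, 0, 3⟩, ⟨4, 2, 0, 2, 0, 4, 0, 1, 0, -3⟩], 36, 39201147168⟩,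
  ⟨(1, false), (3, true), (16, false), 2, 1, 3, 24, 2359332,
    [⟨4, 0, 4, 0, 4, 0, 0, 0, 0, 1⟩, ⟨4, 0, 4, 0, 0, 0, 4, 1, 0, 0⟩,
    ⟨4, 4, 0, 0, 0, 0, 4, 0, 1, 0⟩, ⟨4, 0, 0, 4, 4, 0, 0, 0, 1, 0⟩,
    ⟨4, 4, 0, 0, 0, 4, 0, 0, 0, 1⟩, ⟨4, 0, 0, 4, 0, 4, 0, 1, 0, 0⟩], 72, 9241386435364290624⟩,
  ⟨(1, false), (1, true), (4, false), 3, 3, 1, 36, 2101256,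
    [⟨6, 2, 0, 0, 0, 0, 6, 0, 1, 0⟩, ⟨6, 0, 2, 0, 0, 0, 6, 1, 0, 0⟩,
    ⟨12, 4, 0, 0, 0, 6, 6, 0, 1, -3⟩, ⟨12, 4, 0, 0, 0, 6, -6, 0, 1, 3⟩], 12, 146⟩,
  ⟨(1, true), (1, true), (2, true), 2, 1, 2, 3, 4,
    [⟨1, 1, 1, 0, 1, -1, 0, 0, 0, 1⟩], 48, 17452499984⟩,
  ⟨(5, true), (10, true), (15, true), 2, 1, 30, 3, 7,
    [⟨1, 1, 2, -1, 1, -1, -1, 1, 0, 1⟩],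
    720, 4784065737519319389228560179687595349099322105864570421542996606196212120053356480565244713256118230981670468369981547589642969627275937547080257008023934869548183538295853128272259854476511146934272⟩,
  ⟨(1, true), (2, false), (2, false), 3, 3, 1, 36, 1073745928,
    [⟨6, 0, 0, 6, 1, 1, 0, 1, -1, 0⟩, ⟨12, 6, 0, 6, 1, 2, -3, 1, -2, -3⟩,
    ⟨12, 0, 6, 6, 2, 1, -3, 2, -1, 3⟩, ⟨12, 6, 0, -6, 1, 2, 3, 1, -2, 3⟩,
    ⟨12, 0, 6, -6, 2, 1, 3, 2, -1, -3⟩], 12, 1042⟩,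
  ⟨(1, false), (2, false), (10, false), 5, 1, 3, 4, 6,
    [⟨4, 4, 2, 2, 0, 1, -3, 0, 1, 1⟩, ⟨4, 2, -2, 0, 1, 1, 4, 1, 1, 0⟩,
    ⟨4, 2, 4, 2, 1, 0, -3, 1, 0, 1⟩],
    300, 35816017166320634483840801667187805950028565537140645527985542696215607053461696710705224⟩,
  ⟨(1, false), (2, true), (4, false), 3, 3, 2, 36, 1073745928,
    [⟨6, 2, 2, 0, 0, 0, 6, 1, -1, 0⟩, ⟨12, 4, 2, -6, 0, 6, 6, 2, -1, 3⟩,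
    ⟨12, 2, 4, -6, 6, 0, 6, 1, -2, -3⟩, ⟨12, 4, 2, 6, 0, 6, -6, 2, -1, -3⟩,
    ⟨12, 2, 4, 6, 6, 0, -6, 1, -2, 3⟩], 24, 1048836⟩,
  ⟨(1, true), (2, true), (3, false), 2, 6, 3, 18, 4161,
    [⟨6, 3, 3, 0, 0, 0, 3, 1, -1, 0⟩, ⟨6, 0, 3, 3, 3, 0, 0, 0, 1, -1⟩,
    ⟨6, 3, 0, 3, 0, 3, 0, 1, 0, -1⟩, ⟨6, 3, 0, -3, 0, 3, 0, 1, 0, 1⟩,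
    ⟨6, 3, -3, 0, 0, 0, 3, 1, 1, 0⟩, ⟨6, 0, 3, -3, 3, 0, 0, 0, 1, 1⟩], 36, 8726282760⟩,
  ⟨(1, false), (2, false), (20, false), 5, 1, 24, 2, 3,
    [⟨2, 2, 0, -6, 2, 4, 2, 1, 0, 1⟩, ⟨2, 0, 2, -6, 4, 2, 2, 0, 1, 1⟩,
    ⟨2, 2, 2, 8, 2, -2, 0, 1, 1, 0⟩],
    1200, 1026301412742564878501430523232569155958588312853604919991515655121239688881872949493871120142483898084469559196110767820685883485788039100480368832378046787078451576866318167937172123786578166920491363002388556599900707567320613498109053453745040723903961377606333536115738290895890973799548017452858374930235735435380014867370872077633214283463255916544⟩,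
  ⟨(1, false), (1, true), (3, true), 3, 3, 1, 36, 2101248,
    [⟨3, 1, 0, 0, 0, 0, 3, 0, 1, 0⟩, ⟨3, 0, 1, 0, 0, 0, 3, 1, 0, 0⟩,
    ⟨6, 2, 0, 0, 0, 3, 3, 0, 1, -3⟩, ⟨6, 0, 2, 0, 3, 0, 3, 1, 0, -3⟩], 12, 144⟩,
  ⟨(1, false), (2, true), (6, false), 3, 1, 1, 36, 38731270404,
    [⟨6, 0, 0, 6, 3, 3, 0, 1, -1, 0⟩, ⟨6, 0, 0, 6, 3, -3, 0, 1, 1, 0⟩,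
    ⟨12, 6, 0, -6, 3, 6, 9, 1, -2, 3⟩, ⟨12, 6, 0, -6, 3, -6, 9, 1, 2, 3⟩,
    ⟨12, 0, 6, -6, 6, 3, 9, 2, -1, -3⟩, ⟨12, 0, 6, -6, 6, -3, -9, 2, 1, 3⟩,
    ⟨12, 6, 0, 6, 3, 6, -9, 1, -2, -3⟩, ⟨12, 6, 0, 6, 3, -6, -9, 1, 2, -3⟩,
    ⟨12, 0, 6, 6, 6, 3, -9, 2, -1, 3⟩, ⟨12, 0, 6, 6, 6, -3, 9, 2, 1, -3⟩], 36, 38731270404⟩,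
  ⟨(1, false), (1, true), (16, false), 3, 3, 1, 72, 144115737831673856,
    [⟨12, 4, 0, 0, 0, 0, 12, 0, 1, 0⟩, ⟨12, 0, 4, 0, 0, 0, 12, 1, 0, 0⟩,
    ⟨24, 8, 0, 0, 0, 12, 12, 0, 1, -3⟩, ⟨24, 0, 8, 0, 12, 0, 12, 1, 0, -3⟩,
    ⟨24, 8, 0, 0, 0, 12, -12, 0, 1, 3⟩, ⟨24, 0, 8, 0, 12, 0, -12, 1, 0, 3⟩], 24, 532496⟩,
  ⟨(1, false), (1, true), (8, false), 2, 2, 1, 36, 67125252,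
    [⟨12, 4, -2, 2, 0, 6, 6, 1, 1, -1⟩, ⟨12, 2, 2, 4, 6, -6, 0, 1, 1, -1⟩,
    ⟨12, 2, -4, 2, 6, 0, -6, 1, 1, 1⟩, ⟨12, 2, -4, -2, 6, 0, 6, 1, 1, -1⟩,
    ⟨12, 4, 2, 2, 0, 6, -6, 1, -1, -1⟩, ⟨12, 4, 2, -2, 0, 6, 6, 1, -1, 1⟩,
    ⟨12, 4, -2, -2, 0, 6, -6, 1, 1, 1⟩, ⟨12, 2, 4, 2, 6, 0, -6, 1, -1, 1⟩,
    ⟨12, 2, 4, -2, 6, 0, 6, 1, -1, -1⟩, ⟨12, 2, 2, -4, 6, -6, 0, 1, 1, 1⟩,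
    ⟨12, 2, -2, 4, 6, 6, 0, 1, -1, -1⟩, ⟨12, 2, -2, -4, 6, 6, 0, 1, -1, 1⟩], 36, 2181570690⟩,
  ⟨(1, false), (2, false), (2, true), 2, 1, 1, 18, 149796,
    [⟨6, 2, -2, -2, 1, 2, -1, 3, 0, 3⟩, ⟨6, 2, 2, -2, 1, -2, -1, 3, 0, 3⟩,
    ⟨6, 2, 2, 2, 2, -1, -1, 0, 3, -3⟩, ⟨6, 2, 2, 2, 1, 1, -2, 3, -3, 0⟩,
    ⟨6, 2, 2, -2, 1, 1, 2, 3, -3, 0⟩, ⟨6, 2, -2, -2, 2, 1, 1, 0, 3, -3⟩], 72, 42091770526176528420⟩,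
  ⟨(1, false), (1, false), (1, false), 2, 1, 3, 1, 1,
    [⟨1, 1, 0, 0, 0, 1, 0, 0, 0, 1⟩], 24, 295496⟩,
  ⟨(1, false), (1, false), (2, true), 3, 6, 1, 36, 1073745920,
    [⟨6, 1, 1, 0, 1, -1, 0, 0, 0, 3⟩, ⟨12, 2, 1, -3, 2, -1, 3, 0, 3, 3⟩,
    ⟨12, 1, 2, -3, 1, -2, -3, 3, 0, 3⟩, ⟨12, 2, 1, 3, 2, -1, -3, 0, 3, -3⟩,
    ⟨12, 1, 2, 3, 1, -2, 3, 3, 0, -3⟩], 6, 36⟩,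
  ⟨(1, true), (2, true), (2, true), 2, 1, 1, 6, 36,
    [⟨2, 0, 2, 0, 1, 0, 1, 1, 0, -1⟩], 24, 149540⟩,
  ⟨(1, false), (2, false), (8, true), 2, 1, 4, 18, 149796,
    [⟨6, 4, -4, -4, 2, 4, -2, 3, 0, 3⟩, ⟨6, 4, 4, -4, 2, -4, -2, 3, 0, 3⟩,
    ⟨6, 4, 4, 4, 4, -2, -2, 0, 3, -3⟩, ⟨6, 4, 4, 4, 2, 2, -4, 3, -3, 0⟩,
    ⟨6, 4, 4, -4, 2, 2, 4, 3, -3, 0⟩, ⟨6, 4, -4, -4, 4, 2, 2, 0, 3, -3⟩],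
    288, 1853125851073590525439697012361839141225333080024754554250960551244591937880320⟩,
  ⟨(1, false), (2, false), (3, false), 2, 3, 6, 3, 1,
    [⟨3, 2, -1, -1, 1, 1, 1, 0, 1, -1⟩], 48, 4466766254144⟩,
  ⟨(1, true), (1, true), (12, true), 3, 1, 4, 12, 288,
    [⟨1, 2, 0, 0, 0, 2, 0, 0, 0, 1⟩, ⟨2, 4, 0, 0, 0, 2, 6, 0, 1, -1⟩,
    ⟨2, 2, 0, 6, 0, 4, 0, 1, 0, -1⟩], 144, 340365443670676229926398615185859280896⟩,
  ⟨(1, true), (3, true), (8, true), 2, 2, 3, 12, 4,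
    [⟨4, 4, 2, -2, 0, 2, 2, 1, -1, 1⟩, ⟨4, 2, 4, 2, 2, 0, -2, 1, -1, 1⟩,
    ⟨4, 2, 4, -2, 2, 0, 2, 1, -1, -1⟩, ⟨4, 2, 2, -4, 2, -2, 0, 1, 1, 1⟩], 36, 2097160⟩,
  ⟨(1, true), (2, false), (4, false), 2, 1, 2, 18, 149796,
    [⟨6, 6, 0, 6, 2, -2, -2, 1, 2, -1⟩, ⟨6, 6, 0, 6, 2, 2, -2, 1, -2, -1⟩,
    ⟨6, 6, 6, 0, 2, -2, 2, 1, -1, -2⟩, ⟨6, 6, 6, 0, 2, -2, -2, 1, -1, 2⟩,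
    ⟨6, 0, 6, 6, 2, 2, -2, 2, -1, 1⟩, ⟨6, 0, 6, 6, 2, -2, 2, 2, 1, -1⟩],
    144, 1382729505012552664065122930884001924112⟩,
  ⟨(1, true), (1, true), (3, false), 2, 1, 1, 9, 292,
    [⟨3, 0, 3, 0, 0, 0, 3, 1, 0, 0⟩, ⟨3, 3, 0, 0, 0, 3, 0, 0, 0, 1⟩,
    ⟨3, 3, 0, 0, 0, 0, 3, 0, 1, 0⟩], 72, 42091770526176528420⟩,
  ⟨(1, false), (2, false), (4, false), 2, 2, 3, 4, 4,
    [⟨4, 2, 2, 0, 0, 0, 2, 1, -1, 0⟩, ⟨4, 0, 2, 2, 2, 0, 0, 0, 1, -1⟩], 12, 520⟩,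
  ⟨(1, false), (2, true), (4, false), 3, 6, 1, 36, 1073741824,
    [⟨12, 2, 2, 0, 0, 0, 6, 1, -1, 0⟩, ⟨12, 2, -2, 0, 0, 0, 6, 1, 1, 0⟩], 6, 32⟩,
  ⟨(1, false), (1, false), (6, false), 3, 2, 3, 4, 5,
    [⟨2, 1, 1, 0, 1, -1, 0, 0, 0, 1⟩, ⟨4, 2, 1, 3, 2, -1, -3, 0, 1, -1⟩,
    ⟨4, 1, 2, 3, 1, -2, 3, 1, 0, -1⟩], 54, 2573416647659592⟩,
  ⟨(1, false), (2, false), (4, true), 2, 1, 2, 18, 149796,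
    [⟨6, 2, 4, -2, 2, -2, -2, 3, 0, 3⟩, ⟨6, 2, -4, -2, 2, 2, -2, 3, 0, 3⟩,
    ⟨6, 4, 2, -2, 2, -2, 2, 0, 3, 3⟩, ⟨6, 4, -2, 2, 2, 2, -2, 0, 3, 3⟩,
    ⟨6, 2, 2, 4, 2, 2, -2, 3, -3, 0⟩, ⟨6, 2, 2, -4, 2, 2, 2, 3, -3, 0⟩],
    144, 1382729505012552664065122930884001924112⟩,
  ⟨(1, true), (2, true), (4, true), 2, 2, 1, 12, 4,
    [⟨4, 2, 0, -2, 0, 2, 0, 1, 0, 1⟩, ⟨4, 2, -2, 0, 0, 0, 2, 1, 1, 0⟩,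
    ⟨4, 0, 2, -2, 2, 0, 0, 0, 1, 1⟩], 12, 130⟩,
  ⟨(1, true), (2, true), (3, true), 2, 2, 3, 6, 5,
    [⟨2, 1, 2, 1, 1, -1, 1, 1, 0, -1⟩, ⟨2, 1, -1, 2, 1, -1, -1, 1, 1, 0⟩], 36, 136315400⟩,
  ⟨(1, false), (1, false), (3, true), 2, 1, 3, 3, 7,
    [⟨1, 1, 0, 0, 0, 1, 0, 0, 0, 1⟩], 72, 83174734675692520008⟩,
  ⟨(1, true), (1, true), (4, true), 2, 1, 1, 12, 576,
    [⟨2, 2, 0, 0, 0, 0, 2, 0, 1, 0⟩, ⟨2, 2, 0, 0, 0, 2, 0, 0, 0, 1⟩,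
    ⟨2, 0, 2, 0, 0, 0, 2, 1, 0, 0⟩], 24, 2359872⟩,
  ⟨(1, false), (2, true), (8, false), 2, 1, 1, 36, 34435254276,
    [⟨12, 4, 4, 4, 6, 0, -6, 1, -2, 1⟩, ⟨12, 4, 4, -4, 6, 0, 6, 1, -2, -1⟩,
    ⟨12, 4, -4, -4, 0, 6, -6, 2, 1, 1⟩, ⟨12, 4, -4, 4, 0, 6, 6, 2, 1, -1⟩,
    ⟨12, 4, 4, -4, 6, -6, 0, 1, 1, 2⟩, ⟨12, 4, 4, 4, 6, -6, 0, 1, 1, -2⟩,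
    ⟨12, 4, 4, 4, 0, 6, -6, 2, -1, -1⟩, ⟨12, 4, 4, -4, 0, 6, 6, 2, -1, 1⟩,
    ⟨12, 4, -4, 4, 6, 6, 0, 1, -1, -2⟩, ⟨12, 4, -4, 4, 6, 0, -6, 1, 2, 1⟩,
    ⟨12, 4, -4, -4, 6, 6, 0, 1, -1, 2⟩, ⟨12, 4, -4, -4, 6, 0, 6, 1, 2, -1⟩],
    72, 5189272979942426628⟩,
  ⟨(1, false), (2, false), (3, false), 2, 6, 3, 6, 1,
    [⟨6, 1, 1, 2, 1, 1, -1, 1, -1, 0⟩], 12, 520⟩,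
  ⟨(1, true), (2, true), (6, false), 2, 3, 3, 18, 37449,
    [⟨6, 6, 0, 0, 0, 3, 3, 0, 1, -1⟩, ⟨6, 0, 0, 6, 3, 3, 0, 1, -1, 0⟩,
    ⟨6, 6, 0, 0, 0, 3, -3, 0, 1, 1⟩, ⟨6, 0, 6, 0, 3, 0, 3, 1, 0, -1⟩,
    ⟨6, 0, 6, 0, 3, 0, -3, 1, 0, 1⟩, ⟨6, 0, 0, 6, 3, -3, 0, 1, 1, 0⟩], 72, 664247207632161735240⟩,
  ⟨(1, true), (2, true), (4, false), 2, 1, 6, 6, 63,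
    [⟨2, 4, -2, 2, 2, 2, -2, 0, 1, 1⟩, ⟨2, 2, 2, -4, 2, 2, 2, 1, -1, 0⟩,
    ⟨2, 2, 4, 2, 2, -2, 2, 1, 0, -1⟩], 144, 5529609561241859875049522531886220709952⟩,
  ⟨(1, false), (2, true), (8, true), 3, 1, 1, 24, 4727808,
    [⟨4, 0, 0, 4, 2, 2, 0, 1, -1, 0⟩, ⟨4, 0, 0, 4, 2, -2, 0, 1, 1, 0⟩,
    ⟨8, 4, 0, 4, 2, 4, -6, 1, -2, -3⟩, ⟨8, 4, 0, 4, 2, -4, -6, 1, 2, -3⟩,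
    ⟨8, 0, 4, 4, 4, 2, -6, 2, -1, 3⟩, ⟨8, 0, 4, 4, 4, -2, 6, 2, 1, -3⟩], 72, 1330759726011913872384⟩,
  ⟨(1, false), (2, false), (6, false), 2, 3, 3, 6, 9,
    [⟨6, 2, 2, 2, 2, -1, -1, 0, 1, -1⟩, ⟨6, 2, 2, -2, 1, 1, 2, 1, -1, 0⟩,
    ⟨6, 2, -2, -2, 2, 1, 1, 0, 1, -1⟩], 24, 2359880⟩,
  ⟨(1, false), (2, false), (3, true), 2, 1, 24, 3, 7,
    [⟨1, 2, 0, -2, 0, 2, 0, 2, 0, 2⟩],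
    576, 878694152870967769856139293217963835853594009007997413940950113597993970688606652697101586309075505526974523754440480677580042920399286109894227599715236577280⟩,
  ⟨(1, true), (2, true), (4, false), 2, 2, 3, 12, 1092,
    [⟨4, 4, 2, -2, 2, -2, 2, 0, 1, 1⟩, ⟨4, 2, -2, -4, 2, -2, 2, 1, 1, 0⟩,
    ⟨4, 4, 2, 2, 2, -2, -2, 0, 1, -1⟩, ⟨4, 2, 4, 2, 2, -2, 2, 1, 0, -1⟩,
    ⟨4, 2, 2, 4, 2, 2, -2, 1, -1, 0⟩, ⟨4, 4, -2, -2, 2, 2, 2, 0, 1, -1⟩,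
    ⟨4, 2, 4, -2, 2, -2, -2, 1, 0, 1⟩, ⟨4, 2, 2, -4, 2, 2, 2, 1, -1, 0⟩,
    ⟨4, 2, -4, -2, 2, 2, -2, 1, 0, 1⟩], 36, 8726282760⟩,
  ⟨(1, false), (2, false), (20, false), 5, 1, 6, 4, 6,
    [⟨4, 2, 0, -6, 2, 4, 2, 1, 0, 1⟩, ⟨4, 0, 2, -6, 4, 2, 2, 0, 1, 1⟩,
    ⟨4, 2, 2, 8, 2, -2, 0, 1, 1, 0⟩],
    600, 1028894531455007920409413404605903327114290204073112973551592067058246629193284578748084963769223702811899375910941618823218819189628261395330627192711022923770248905684250792000⟩,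
  ⟨(1, false), (1, true), (2, true), 2, 1, 6, 3, 7,
    [⟨1, 1, 1, 0, 1, -1, 2, 1, -1, -1⟩], 144, 5529609561241859875049522531886220709952⟩,
  ⟨(1, false), (2, true), (5, false), 2, 5, 8, 45, 34360786976,
    [⟨15, 10, 4, -2, 0, 6, 12, 2, -4, 2⟩, ⟨15, 10, 4, 2, 0, 6, -12, 2, -4, -2⟩,
    ⟨15, 2, -4, -10, 12, 6, 0, 2, -4, 2⟩, ⟨15, 4, -10, 2, 6, 0, -12, 4, 2, 2⟩,
    ⟨15, 10, 2, 4, 0, 12, -6, 2, -2, -4⟩, ⟨15, 10, 2, -4, 0, 12, 6, 2, -2, 4⟩,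
    ⟨15, 4, 10, -2, 6, 0, 12, 4, -2, -2⟩, ⟨15, 4, -2, 10, 6, 12, 0, 4, -2, -2⟩,
    ⟨15, 4, 10, 2, 6, 0, -12, 4, -2, 2⟩, ⟨15, 4, 2, 10, 6, -12, 0, 4, 2, -2⟩,
    ⟨15, 4, -2, -10, 6, 12, 0, 4, -2, 2⟩, ⟨15, 4, -10, -2, 6, 0, 12, 4, 2, -2⟩,
    ⟨15, 10, -2, 4, 0, 12, 6, 2, 2, -4⟩, ⟨15, 10, -2, -4, 0, 12, -6, 2, 2, 4⟩,
    ⟨15, 4, 2, -10, 6, -12, 0, 4, 2, 2⟩, ⟨15, 2, 10, 4, 12, 0, -6, 2, -2, 4⟩,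
    ⟨15, 2, 10, -4, 12, 0, 6, 2, -2, -4⟩, ⟨15, 2, 4, 10, 12, -6, 0, 2, 4, -2⟩],
    576, 3773962424821541352242353748664783890402805569266032467146709834983932792280289908963903015159324469742880636268746606218039692826665082943944829900166963375729492885760⟩,
  ⟨(1, false), (2, false), (6, true), 2, 1, 3, 6, 45,
    [⟨2, 0, 2, 0, 1, 0, -1, 1, 0, 1⟩, ⟨2, 2, 0, 0, 0, 1, -1, 0, 1, 1⟩,
    ⟨2, 0, 0, 2, 1, -1, 0, 1, 1, 0⟩], 72, 9243642641948901952⟩,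
  ⟨(1, false), (1, true), (2, true), 2, 2, 3, 6, 21,
    [⟨2, 0, 1, 1, 2, 1, -1, 1, -1, 1⟩, ⟨2, 1, 1, 0, 1, -1, 2, 1, -1, -1⟩,
    ⟨2, 1, 0, 1, 1, 2, -1, 1, -1, -1⟩], 36, 8726282760⟩,
  ⟨(1, false), (5, true), (10, true), 5, 10, 3, 60, 1125900980584448,
    [⟨20, 5, 0, 5, 3, 4, -1, 0, 2, 4⟩, ⟨20, 5, 5, 0, 3, -1, 4, 0, 2, 4⟩,
    ⟨20, 0, 5, 5, 4, 3, -1, 2, 0, 4⟩, ⟨20, 5, 0, 5, 1, 4, 5, 2, 2, -2⟩,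
    ⟨20, 5, 5, 0, 1, -3, -4, 2, 0, 4⟩, ⟨20, 0, 5, 5, 4, 1, 5, 2, 2, -2⟩],
    90, 154742514134044579941318656⟩,
  ⟨(1, false), (1, true), (1, true), 3, 1, 1, 3, 4,
    [⟨1, 0, 0, 1, 1, 0, 0, 0, 1, 0⟩], 9, 292⟩,
  ⟨(1, false), (2, false), (9, false), 2, 2, 3, 6, 1,
    [⟨6, 3, 3, 0, 0, 0, 3, 1, -1, 0⟩], 36, 134218240⟩,
  ⟨(1, false), (2, true), (12, false), 2, 3, 8, 27, 2101256,
    [⟨9, 6, 0, -6, 6, 6, 6, 1, -2, 1⟩, ⟨9, 6, 6, 0, 6, -6, 6, 1, -1, -2⟩,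
    ⟨9, 6, 6, 0, 6, -6, -6, 1, -1, 2⟩, ⟨9, 6, 0, 6, 6, 6, -6, 1, -2, -1⟩],
    576, 3773962649767231079401373721562828380690664823860061331668269848933025106132393738410802991529935631610763497772027210791098463777887134622544893686307756858349132448000⟩,
  ⟨(1, true), (2, false), (3, false), 3, 2, 1, 36, 4363141380,
    [⟨6, 3, 3, 0, 0, 0, 3, 1, -1, 0⟩, ⟨6, 3, -3, 0, 0, 0, 3, 1, 1, 0⟩,
    ⟨12, 6, 3, 9, 0, 3, -3, 2, -1, -3⟩, ⟨12, 6, -3, -9, 0, 3, -3, 2, 1, 3⟩,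
    ⟨12, 3, 6, 9, 3, 0, -3, 1, -2, 3⟩, ⟨12, 3, -6, 9, 3, 0, -3, 1, 2, 3⟩,
    ⟨12, 6, 3, -9, 0, 3, 3, 2, -1, 3⟩, ⟨12, 6, -3, 9, 0, 3, 3, 2, 1, -3⟩,
    ⟨12, 3, 6, -9, 3, 0, 3, 1, -2, -3⟩, ⟨12, 3, -6, -9, 3, 0, 3, 1, 2, -3⟩], 18, 74898⟩,
  ⟨(1, false), (5, false), (10, false), 5, 10, 3, 20, 1024,
    [⟨20, 5, 0, 5, 1, 0, -3, 1, 2, 1⟩, ⟨20, 5, 5, 0, 1, 1, 4, 1, -1, 0⟩,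
    ⟨20, 0, 5, 5, 0, 1, -3, 2, 1, 1⟩], 30, 134217736⟩,
  ⟨(1, false), (2, false), (9, true), 2, 6, 3, 54, 262145,
    [⟨18, 7, 1, -2, 1, -5, 1, 1, 1, 4⟩, ⟨18, 2, 7, 1, 1, -1, 5, 4, -1, -1⟩,
    ⟨18, 2, -1, -7, 1, -5, 1, 4, 1, 1⟩, ⟨6, 2, -1, 1, 1, 1, -1, 0, 1, 1⟩,
    ⟨6, 1, 2, 1, 1, -1, 1, 1, 0, -1⟩, ⟨6, 1, -1, 2, 1, -1, -1, 1, 1, 0⟩,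
    ⟨6, 1, 2, -1, 1, -1, -1, 1, 0, 1⟩, ⟨6, 1, -1, -2, 1, -1, 1, 1, 1, 0⟩,
    ⟨18, 7, 1, 2, 1, -5, -1, 1, 1, -4⟩, ⟨18, 2, 7, -1, 1, -1, -5, 4, -1, 1⟩,
    ⟨6, 1, -2, 1, 1, 1, 1, 1, 0, -1⟩, ⟨6, 2, 1, 1, 1, -1, -1, 0, 1, -1⟩,
    ⟨6, 1, -2, -1, 1, 1, -1, 1, 0, 1⟩, ⟨18, 7, 2, -1, 1, -1, 5, 1, -4, -1⟩,
    ⟨18, 7, -1, -2, 1, 5, 1, 1, -1, 4⟩, ⟨6, 2, -1, -1, 1, 1, 1, 0, 1, -1⟩,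
    ⟨6, 1, 1, -2, 1, 1, 1, 1, -1, 0⟩, ⟨18, 7, 2, 1, 1, -1, -5, 1, -4, 1⟩,
    ⟨18, 7, -1, 2, 1, 5, -1, 1, -1, -4⟩, ⟨18, 7, -2, 1, 1, 1, -5, 1, 4, 1⟩,
    ⟨6, 1, 1, 2, 1, 1, -1, 1, -1, 0⟩, ⟨18, 7, -2, -1, 1, 1, 5, 1, 4, -1⟩,
    ⟨18, 2, -1, 7, 1, -5, -1, 4, 1, -1⟩], 108, 2417860862601295338406400⟩,
  ⟨(1, true), (2, false), (4, false), 2, 2, 1, 36, 67125252,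
    [⟨12, 6, 0, -6, 2, 2, 2, 1, -2, 1⟩, ⟨12, 6, -6, 0, 2, 2, -2, 1, 1, 2⟩,
    ⟨12, 0, 6, -6, 2, -2, -2, 2, 1, 1⟩, ⟨12, 6, 6, 0, 2, -2, 2, 1, -1, -2⟩,
    ⟨12, 6, 6, 0, 2, -2, -2, 1, -1, 2⟩, ⟨12, 6, 0, 6, 2, 2, -2, 1, -2, -1⟩,
    ⟨12, 6, 0, 6, 2, -2, -2, 1, 2, -1⟩, ⟨12, 6, 0, -6, 2, -2, 2, 1, 2, 1⟩,
    ⟨12, 6, -6, 0, 2, 2, 2, 1, 1, -2⟩, ⟨12, 0, 6, 6, 2, 2, -2, 2, -1, 1⟩,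
    ⟨12, 0, 6, 6, 2, -2, 2, 2, 1, -1⟩, ⟨12, 0, 6, -6, 2, 2, 2, 2, -1, -1⟩], 36, 2181570690⟩,
  ⟨(1, true), (1, true), (4, true), 2, 3, 12, 3, 1,
    [⟨1, 2, 0, 0, 0, 2, 0, 0, 0, 1⟩], 96, 19347535480317005176770560⟩,
  ⟨(1, false), (2, false), (3, true), 2, 1, 6, 3, 7,
    [⟨1, 1, 0, -1, 0, 1, 0, 1, 0, 1⟩], 144, 5529609561241859875049522531886220709952⟩,
  ⟨(1, false), (3, true), (5, false), 2, 5, 3, 15, 33,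
    [⟨5, 0, 2, -1, 0, 1, 2, 1, 0, 0⟩, ⟨5, 2, 1, 0, 1, -2, 0, 0, 0, 1⟩,
    ⟨5, 2, 0, 1, 1, 0, -2, 0, 1, 0⟩, ⟨5, 2, -1, 0, 1, 2, 0, 0, 0, 1⟩,
    ⟨5, 1, 0, 2, 2, 0, -1, 0, 1, 0⟩, ⟨5, 0, 2, 1, 0, 1, -2, 1, 0, 0⟩,
    ⟨5, 0, 1, 2, 0, 2, -1, 1, 0, 0⟩], 72, 83028398465540685832⟩,
  ⟨(1, true), (1, true), (2, false), 3, 2, 1, 12, 1040,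
    [⟨2, 1, 1, 0, 1, -1, 0, 0, 0, 1⟩, ⟨4, 2, 1, 3, 2, -1, -3, 0, 1, -1⟩,
    ⟨4, 1, 2, 3, 1, -2, 3, 1, 0, -1⟩, ⟨4, 2, 1, -3, 2, -1, 3, 0, 1, 1⟩,
    ⟨4, 1, 2, -3, 1, -2, -3, 1, 0, 1⟩], 18, 149796⟩,
  ⟨(1, false), (1, false), (2, false), 2, 2, 3, 2, 1,
    [⟨2, 0, 1, 1, 0, 1, -1, 1, 0, 0⟩], 12, 520⟩,
  ⟨(1, false), (2, false), (3, true), 2, 2, 3, 6, 5,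
    [⟨2, 1, 0, 1, 0, 1, 0, 1, 0, -1⟩, ⟨2, 1, -1, 0, 0, 0, 1, 1, 1, 0⟩], 36, 136315400⟩,
  ⟨(1, true), (2, false), (4, true), 3, 2, 1, 12, 1024,
    [⟨4, 2, -2, 0, 0, 0, 2, 1, 1, 0⟩], 18, 133152⟩,
  ⟨(1, false), (2, false), (4, true), 2, 2, 1, 36, 67125252,
    [⟨12, 4, -2, 2, 2, 2, -2, 0, 3, 3⟩, ⟨12, 2, 4, -2, 2, -2, -2, 3, 0, 3⟩,
    ⟨12, 2, -2, 4, 2, -2, -2, 3, 3, 0⟩, ⟨12, 2, -4, -2, 2, 2, -2, 3, 0, 3⟩,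
    ⟨12, 4, 2, 2, 2, -2, -2, 0, 3, -3⟩, ⟨12, 4, 2, -2, 2, -2, 2, 0, 3, 3⟩,
    ⟨12, 4, -2, -2, 2, 2, 2, 0, 3, -3⟩, ⟨12, 2, 4, 2, 2, -2, 2, 3, 0, -3⟩,
    ⟨12, 2, 2, 4, 2, 2, -2, 3, -3, 0⟩, ⟨12, 2, 2, -4, 2, 2, 2, 3, -3, 0⟩,
    ⟨12, 2, -2, -4, 2, -2, 2, 3, 3, 0⟩, ⟨12, 2, -4, 2, 2, 2, 2, 3, 0, -3⟩], 36, 2181570690⟩,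
  ⟨(1, false), (2, true), (3, false), 2, 6, 1, 54, 281476050456576,
    [⟨18, 0, 3, -3, 3, -3, -3, 2, 1, 1⟩, ⟨18, 3, -3, 0, 3, 3, -3, 1, 1, 2⟩,
    ⟨18, 3, 3, 0, 3, -3, 3, 1, -1, -2⟩, ⟨18, 3, 0, 3, 3, -3, -3, 1, 2, -1⟩,
    ⟨18, 3, 0, -3, 3, 3, 3, 1, -2, 1⟩, ⟨18, 3, -3, 0, 3, 3, 3, 1, 1, -2⟩,
    ⟨18, 0, 3, -3, 3, 3, 3, 2, -1, -1⟩, ⟨18, 3, 3, 0, 3, -3, -3, 1, -1, 2⟩,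
    ⟨18, 3, 0, 3, 3, 3, -3, 1, -2, -1⟩, ⟨18, 3, 0, -3, 3, -3, 3, 1, 2, 1⟩,
    ⟨18, 0, 3, 3, 3, 3, -3, 2, -1, 1⟩, ⟨18, 0, 3, 3, 3, -3, 3, 2, 1, -1⟩], 36, 34905131040⟩,
  ⟨(1, false), (3, true), (12, true), 2, 2, 6, 6, 5,
    [⟨2, 2, 0, 0, 0, 2, 0, 0, 0, 1⟩, ⟨2, 0, 0, 2, 2, 0, 0, 0, 1, 0⟩], 72, 18018796556255296⟩,
  ⟨(1, false), (2, true), (2, true), 3, 1, 1, 12, 1168,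
    [⟨2, 0, 0, 2, 1, 1, 0, 1, -1, 0⟩, ⟨4, 2, 0, -2, 1, 2, 3, 1, -2, 3⟩,
    ⟨4, 0, 2, -2, 2, 1, 3, 2, -1, -3⟩, ⟨4, 2, 0, 2, 1, 2, -3, 1, -2, -3⟩,
    ⟨4, 0, 2, 2, 2, 1, -3, 2, -1, 3⟩], 36, 19600573584⟩,
  ⟨(1, false), (2, true), (10, true), 2, 5, 3, 60, 36028831378735104,
    [⟨10, 4, 0, 2, 1, -5, -2, 1, 1, -2⟩, ⟨10, 4, 0, -2, 1, 5, 2, 1, -1, 2⟩,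
    ⟨10, 4, 2, 0, 1, -2, 5, 1, -2, -1⟩, ⟨10, 4, -2, 0, 1, 2, -5, 1, 2, 1⟩,
    ⟨10, 0, 4, 2, 5, 1, -2, 1, -1, 2⟩, ⟨10, 0, 4, -2, 5, 1, 2, 1, -1, -2⟩,
    ⟨10, 2, -4, 0, 2, 1, 5, 2, 1, -1⟩, ⟨10, 0, 4, -2, 5, -1, -2, 1, 1, 2⟩,
    ⟨10, 2, 4, 0, 2, -1, 5, 2, -1, -1⟩, ⟨10, 2, 0, 4, 2, 5, -1, 2, -1, -1⟩,
    ⟨10, 2, 0, -4, 2, 5, 1, 2, -1, 1⟩, ⟨10, 0, 4, 2, 5, -1, 2, 1, 1, -2⟩,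
    ⟨10, 4, 2, 0, 1, -2, -5, 1, -2, 1⟩, ⟨10, 0, 2, 4, 5, 2, -1, 1, -2, 1⟩],
    72, 590295845543079837696⟩,
  ⟨(1, false), (3, true), (12, true), 2, 1, 12, 3, 5,
    [⟨1, 2, 0, 0, 0, 2, 0, 0, 0, 1⟩],
    288, 7237005577437600216650452267729740102062187187919956957047241574860277678080⟩,
  ⟨(1, false), (1, true), (2, false), 2, 1, 2, 9, 292,
    [⟨3, 2, 1, -1, 0, 3, 3, 1, -1, 1⟩, ⟨3, 2, 1, 1, 0, 3, -3, 1, -1, -1⟩,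
    ⟨3, 2, -1, 1, 0, 3, 3, 1, 1, -1⟩], 144, 1382729505012552664065122930884001924112⟩,
  ⟨(1, false), (1, false), (2, false), 2, 1, 6, 1, 1,
    [⟨1, 1, 1, 0, 1, -1, 0, 0, 0, 1⟩], 48, 69793484864⟩,
  ⟨(1, true), (2, false), (2, true), 2, 1, 3, 6, 63,
    [⟨2, 2, 2, -2, 0, 1, 1, 2, -1, 1⟩, ⟨2, 2, 2, 2, 1, -1, 0, 1, 1, -2⟩,
    ⟨2, 2, -2, 2, 1, 0, -1, 1, 2, 1⟩], 72, 83174734675692520008⟩,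
  ⟨(1, false), (1, false), (3, false), 3, 1, 3, 1, 1,
    [⟨1, 1, 0, 0, 0, 1, 0, 0, 0, 1⟩], 27, 18911816⟩,
  ⟨(1, true), (1, true), (12, false), 2, 1, 4, 9, 292,
    [⟨3, 0, 6, 0, 0, 0, 6, 1, 0, 0⟩, ⟨3, 6, 0, 0, 0, 6, 0, 0, 0, 1⟩,
    ⟨3, 6, 0, 0, 0, 0, 6, 0, 1, 0⟩],
    288, 1853125851073590525439697012361839141225333080024754554250960551244591937880320⟩,
  ⟨(1, false), (2, false), (5, false), 5, 1, 6, 2, 3,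
    [⟨2, 1, 0, -3, 1, 2, 1, 1, 0, 1⟩, ⟨2, 0, 1, -3, 2, 1, 1, 0, 1, 1⟩,
    ⟨2, 1, 1, 4, 1, -1, 0, 1, 1, 0⟩],
    300, 32333902489124093844834401615282474705026353116125102188040895567418795416331181617320000⟩,
  ⟨(1, true), (1, true), (2, true), 2, 2, 1, 6, 4,
    [⟨2, 1, 0, 1, 1, 0, -1, 0, 1, 0⟩], 12, 130⟩,
  ⟨(1, true), (1, true), (1, true), 2, 3, 3, 3, 1,
    [⟨1, 1, 0, 0, 0, 1, 0, 0, 0, 1⟩], 24, 2359880⟩,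
  ⟨(1, false), (1, true), (8, true), 2, 2, 3, 12, 1092,
    [⟨4, 2, 2, 0, 2, -2, 4, 1, -1, -1⟩, ⟨4, 0, 2, -2, 4, 2, 2, 1, -1, -1⟩,
    ⟨4, 2, 0, 2, 2, 4, -2, 1, -1, -1⟩, ⟨4, 2, 0, -2, 2, 4, 2, 1, -1, 1⟩,
    ⟨4, 2, -2, 0, 2, 2, -4, 1, 1, 1⟩, ⟨4, 0, 2, 2, 4, 2, -2, 1, -1, 1⟩], 36, 8726282760⟩,
  ⟨(1, false), (2, true), (4, true), 2, 2, 3, 12, 1092,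
    [⟨4, 2, 2, 0, 2, -2, 2, 1, -1, -2⟩, ⟨4, 2, -2, 0, 2, 2, 2, 1, 1, -2⟩,
    ⟨4, 0, 2, 2, 2, 2, -2, 2, -1, 1⟩, ⟨4, 0, 2, -2, 2, 2, 2, 2, -1, -1⟩,
    ⟨4, 2, 0, -2, 2, -2, 2, 1, 2, 1⟩, ⟨4, 2, 0, 2, 2, 2, -2, 1, -2, -1⟩,
    ⟨4, 2, 0, 2, 2, -2, -2, 1, 2, -1⟩], 36, 8726282760⟩,
  ⟨(1, false), (3, true), (9, false), 2, 1, 3, 9, 438,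
    [⟨3, 0, 3, 0, 0, 0, 3, 1, 0, 0⟩, ⟨3, 3, 0, 0, 0, 3, 0, 0, 0, 1⟩,
    ⟨3, 0, 0, 3, 3, 0, 0, 0, 1, 0⟩], 216, 1648768760778793976287248675676406785650308549127804984204755016⟩,
  ⟨(1, false), (3, true), (12, false), 3, 2, 6, 12, 1300,
    [⟨2, 2, 0, 0, 0, 2, 0, 0, 0, 1⟩, ⟨4, 4, 0, 0, 0, 2, 6, 0, 1, -1⟩,
    ⟨4, 0, 4, 0, 2, 0, 6, 1, 0, -1⟩, ⟨2, 0, 2, 0, 2, 0, 0, 0, 0, 1⟩,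
    ⟨4, 4, 0, 0, 0, 2, -6, 0, 1, 1⟩, ⟨4, 2, 0, -6, 0, 4, 0, 1, 0, 1⟩,
    ⟨4, 0, 4, 0, 2, 0, -6, 1, 0, 1⟩, ⟨4, 0, 2, -6, 4, 0, 0, 0, 1, 1⟩,
    ⟨4, 2, 0, 6, 0, 4, 0, 1, 0, -1⟩, ⟨4, 0, 2, 6, 4, 0, 0, 0, 1, -1⟩],
    108, 5149850208546690864978004545600⟩,
  ⟨(1, false), (5, true), (10, true), 5, 5, 6, 30, 1081377,
    [⟨10, 5, 0, 5, 3, 4, -1, 0, 2, 4⟩, ⟨10, 5, 5, 0, 1, -3, -4, 2, 0, 4⟩,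
    ⟨10, 0, 5, 5, 4, 3, -1, 2, 0, 4⟩, ⟨10, 5, 0, 5, 1, 4, 5, 2, 2, -2⟩,
    ⟨10, 5, 5, 0, 3, -1, 4, 0, 2, 4⟩, ⟨10, 0, 5, 5, 4, 1, 5, 2, 2, -2⟩],
    180, 379990425711479276928211625887028127003531758796800⟩,
  ⟨(1, false), (2, false), (5, false), 5, 2, 3, 4, 4,
    [⟨4, 0, 1, -3, 2, 1, 1, 0, 1, 1⟩, ⟨4, 1, 1, 4, 1, -1, 0, 1, 1, 0⟩,
    ⟨4, 1, 0, -3, 1, 2, 1, 1, 0, 1⟩], 150, 181237802248335293092918215435126362234454536⟩,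
  ⟨(1, false), (2, true), (12, false), 2, 3, 2, 54, 282025808367624,
    [⟨18, 6, 0, -6, 6, 6, 6, 1, -2, 1⟩, ⟨18, 6, -6, 0, 6, 6, -6, 1, 1, 2⟩,
    ⟨18, 0, 6, -6, 6, -6, -6, 2, 1, 1⟩, ⟨18, 6, 6, 0, 6, -6, 6, 1, -1, -2⟩,
    ⟨18, 6, -6, 0, 6, 6, 6, 1, 1, -2⟩, ⟨18, 0, 6, -6, 6, 6, 6, 2, -1, -1⟩,
    ⟨18, 6, 0, 6, 6, 6, -6, 1, -2, -1⟩, ⟨18, 6, 0, 6, 6, -6, -6, 1, 2, -1⟩,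
    ⟨18, 0, 6, 6, 6, -6, 6, 2, 1, -1⟩, ⟨18, 6, 6, 0, 6, -6, -6, 1, -1, 2⟩,
    ⟨18, 6, 0, -6, 6, -6, 6, 1, 2, 1⟩, ⟨18, 0, 6, 6, 6, 6, -6, 2, -1, 1⟩],
    144, 1415574730766249900980353745479426815049732⟩,
  ⟨(1, false), (2, false), (15, false), 5, 6, 12, 18, 1,
    [⟨6, 4, 3, -1, 2, 0, 4, 0, 1, 1⟩, ⟨6, 4, 1, 5, 2, 2, -2, 0, 1, 1⟩,
    ⟨6, 3, -1, 4, 0, 2, 4, 1, 1, 0⟩, ⟨6, 1, -3, -4, 2, 0, 4, 1, 1, 0⟩,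
    ⟨6, 3, 4, -1, 0, 2, 4, 1, 0, 1⟩, ⟨6, 1, 4, 5, 2, 2, -2, 1, 0, 1⟩,
    ⟨18, 9, -3, -8, 0, 6, -8, 3, 3, 4⟩, ⟨18, 12, 3, -5, 6, 6, 14, 0, 3, -1⟩,
    ⟨18, 13, 1, 8, 4, 10, 8, 1, 1, -4⟩, ⟨18, 12, -1, 7, 6, 10, 2, 0, 1, 5⟩,
    ⟨18, 13, 12, 5, 4, -6, -4, 1, 0, 5⟩, ⟨18, 9, 12, 17, 0, 6, -8, 3, 0, -1⟩],
    900, 123003155724926140062778179689878654375082054625862313095032494420910587873782909292850803518309338869624453789675833654238223697866807390692873987864259490834349445284948329622748490284331750329078266972133336491911582727948754356462839399462733525746054070272⟩,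
  ⟨(1, false), (5, true), (5, true), 3, 1, 1, 60, 4504836879949824,
    [⟨5, 0, 0, 5, 2, 1, 0, 1, -2, 0⟩, ⟨5, 0, 0, 5, 2, -1, 0, 1, 2, 0⟩,
    ⟨10, 5, 0, 5, 2, 2, -6, 1, -4, -3⟩, ⟨10, 0, 5, 5, 4, 1, -3, 2, -2, 6⟩,
    ⟨10, 5, 0, -5, 2, 2, 6, 1, -4, 3⟩, ⟨10, 0, 5, -5, 4, 1, 3, 2, -2, -6⟩,
    ⟨10, 5, 0, 5, 2, -2, -6, 1, 4, -3⟩, ⟨10, 0, 5, 5, 4, -1, 3, 2, 2, -6⟩,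
    ⟨10, 5, 0, -5, 2, -2, 6, 1, 4, 3⟩, ⟨10, 0, 5, -5, 4, -1, -3, 2, 2, 6⟩],
    180, 5987955297273678233231682112356623135107094916636672⟩,
  ⟨(5, true), (10, true), (10, true), 2, 1, 5, 6, 36,
    [⟨2, 0, 2, 0, 1, 0, 1, 1, 0, -1⟩], 120, 38686806855317648054420480⟩,
  ⟨(1, true), (1, true), (8, false), 3, 1, 2, 12, 1042,
    [⟨2, 2, 2, 0, 2, -2, 0, 0, 0, 1⟩, ⟨4, 4, 2, 6, 4, -2, -6, 0, 1, -1⟩,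
    ⟨4, 2, 4, 6, 2, -4, 6, 1, 0, -1⟩, ⟨4, 4, 2, -6, 4, -2, 6, 0, 1, 1⟩,
    ⟨4, 2, 4, -6, 2, -4, -6, 1, 0, 1⟩], 72, 295221106269846765828⟩,
  ⟨(5, true), (10, true), (20, true), 2, 2, 5, 12, 4,
    [⟨4, 2, 0, -2, 0, 2, 0, 1, 0, 1⟩, ⟨4, 2, -2, 0, 0, 0, 2, 1, 1, 0⟩,
    ⟨4, 0, 2, -2, 2, 0, 0, 0, 1, 1⟩], 60, 34359738400⟩,
  ⟨(1, false), (2, false), (8, true), 2, 1, 1, 36, 34435254276,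
    [⟨12, 4, 4, -4, 2, -4, -2, 3, 0, 3⟩, ⟨12, 4, -4, 4, 2, 4, 2, 3, 0, -3⟩,
    ⟨12, 4, -4, -4, 2, 4, -2, 3, 0, 3⟩, ⟨12, 4, 4, 4, 2, -4, 2, 3, 0, -3⟩,
    ⟨12, 4, 4, -4, 4, -2, 2, 0, 3, 3⟩, ⟨12, 4, -4, -4, 2, -2, 4, 3, 3, 0⟩,
    ⟨12, 4, 4, 4, 4, -2, -2, 0, 3, -3⟩, ⟨12, 4, 4, 4, 2, 2, -4, 3, -3, 0⟩,
    ⟨12, 4, 4, -4, 2, 2, 4, 3, -3, 0⟩, ⟨12, 4, -4, 4, 4, 2, -2, 0, 3, 3⟩,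
    ⟨12, 4, -4, 4, 2, -2, -4, 3, 3, 0⟩, ⟨12, 4, -4, -4, 4, 2, 2, 0, 3, -3⟩],
    72, 5189272979942426628⟩,
  ⟨(1, false), (2, false), (10, false), 5, 1, 12, 2, 3,
    [⟨2, 4, 2, 2, 0, 1, -3, 0, 1, 1⟩, ⟨2, 2, -2, 0, 1, 1, 4, 1, 1, 0⟩,
    ⟨2, 2, 4, 2, 1, 0, -3, 1, 0, 1⟩],
    600, 1013312715233450114791408288200198061950743602677867458575799211871001991710812163900541201481678556057448742935528860215927282036164425646246828857512670768426447767159542124544⟩,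
  ⟨(1, false), (2, true), (5, false), 2, 5, 2, 45, 34360786976,
    [⟨15, 5, 2, -1, 0, 3, 6, 1, -2, 1⟩, ⟨15, 5, 2, 1, 0, 3, -6, 1, -2, -1⟩,
    ⟨15, 1, -2, -5, 6, 3, 0, 1, -2, 1⟩, ⟨15, 2, -5, 1, 3, 0, -6, 2, 1, 1⟩,
    ⟨15, 5, 1, 2, 0, 6, -3, 1, -1, -2⟩, ⟨15, 5, 1, -2, 0, 6, 3, 1, -1, 2⟩,
    ⟨15, 2, 5, -1, 3, 0, 6, 2, -1, -1⟩, ⟨15, 2, -1, 5, 3, 6, 0, 2, -1, -1⟩,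
    ⟨15, 2, 5, 1, 3, 0, -6, 2, -1, 1⟩, ⟨15, 2, 1, 5, 3, -6, 0, 2, 1, -1⟩,
    ⟨15, 2, -1, -5, 3, 6, 0, 2, -1, 1⟩, ⟨15, 2, -5, -1, 3, 0, 6, 2, 1, -1⟩,
    ⟨15, 5, -1, 2, 0, 6, 3, 1, 1, -2⟩, ⟨15, 5, -1, -2, 0, 6, -3, 1, 1, 2⟩,
    ⟨15, 2, 1, -5, 3, -6, 0, 2, 1, 1⟩, ⟨15, 1, 5, 2, 6, 0, -3, 1, -1, 2⟩,
    ⟨15, 1, 5, -2, 6, 0, 3, 1, -1, -2⟩, ⟨15, 1, 2, 5, 6, -3, 0, 1, 2, -1⟩],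
    144, 1393801976195292901629826396426971359756292⟩,
  ⟨(1, false), (1, true), (2, false), 2, 2, 1, 18, 16644,
    [⟨6, 1, -2, 1, 3, 0, -3, 1, 1, 1⟩, ⟨6, 2, 1, 1, 0, 3, -3, 1, -1, -1⟩,
    ⟨6, 2, -1, -1, 0, 3, -3, 1, 1, 1⟩, ⟨6, 1, 2, 1, 3, 0, -3, 1, -1, 1⟩,
    ⟨6, 1, 1, 2, 3, -3, 0, 1, 1, -1⟩, ⟨6, 1, 1, -2, 3, -3, 0, 1, 1, 1⟩], 36, 2181570690⟩,
  ⟨(1, true), (1, true), (3, true), 3, 1, 1, 12, 288,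
    [⟨1, 1, 0, 0, 0, 1, 0, 0, 0, 1⟩, ⟨2, 2, 0, 0, 0, 1, 3, 0, 1, -1⟩,
    ⟨2, 1, 0, 3, 0, 2, 0, 1, 0, -1⟩], 36, 4833018144⟩,
  ⟨(1, false), (1, false), (1, true), 3, 3, 1, 9, 8,
    [⟨3, 1, 0, 0, 0, 1, 0, 0, 0, 3⟩], 3, 2⟩,
  ⟨(1, true), (1, true), (4, false), 3, 1, 1, 12, 292,
    [⟨2, 2, 0, 0, 0, 2, 0, 0, 0, 1⟩, ⟨4, 4, 0, 0, 0, 2, 6, 0, 1, -1⟩,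
    ⟨4, 4, 0, 0, 0, 2, -6, 0, 1, 1⟩, ⟨4, 2, 0, 6, 0, 4, 0, 1, 0, -1⟩,
    ⟨4, 2, 0, -6, 0, 4, 0, 1, 0, 1⟩], 36, 4900143396⟩,
  ⟨(1, false), (2, false), (2, false), 2, 1, 3, 2, 3,
    [⟨2, 2, 0, 0, 0, 1, 1, 0, 1, -1⟩, ⟨2, 0, 0, 2, 1, 1, 0, 1, -1, 0⟩], 24, 295496⟩,
  ⟨(1, true), (2, true), (6, true), 2, 1, 3, 6, 45,
    [⟨2, 2, 2, -2, 2, -1, 1, 0, 1, 1⟩, ⟨2, 2, -2, 2, 1, 2, 1, 1, 0, -1⟩,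
    ⟨2, 2, -2, 2, 1, -1, -2, 1, 1, 0⟩], 72, 9243642641948901952⟩,
  ⟨(1, false), (2, true), (10, true), 2, 5, 12, 15, 1057,
    [⟨5, 0, 4, 2, 5, 1, -2, 1, -1, 2⟩, ⟨5, 0, 4, -2, 5, -1, -2, 1, 1, 2⟩,
    ⟨5, 4, 2, 0, 1, -2, 5, 1, -2, -1⟩, ⟨5, 4, 0, 2, 1, -5, -2, 1, 1, -2⟩,
    ⟨5, 4, 0, -2, 1, 5, 2, 1, -1, 2⟩, ⟨5, 2, 4, 0, 2, -1, 5, 2, -1, -1⟩,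
    ⟨5, 0, 2, 4, 5, 2, -1, 1, -2, 1⟩],
    288, 121446455775958397316095020000616919131510702367371448658258788297839468447535206400⟩,
  ⟨(1, true), (2, true), (3, true), 2, 1, 6, 3, 7,
    [⟨1, 1, 2, -1, 1, -1, -1, 1, 0, 1⟩], 144, 5529609561241859875049522531886220709952⟩,
  ⟨(1, false), (2, true), (8, false), 2, 1, 4, 18, 149796,
    [⟨6, 4, -4, -4, 6, 0, 6, 1, 2, -1⟩, ⟨6, 4, 4, -4, 6, 0, 6, 1, -2, -1⟩,
    ⟨6, 4, 4, 4, 6, -6, 0, 1, 1, -2⟩, ⟨6, 4, 4, 4, 0, 6, -6, 2, -1, -1⟩,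
    ⟨6, 4, 4, -4, 6, -6, 0, 1, 1, 2⟩, ⟨6, 4, -4, -4, 0, 6, -6, 2, 1, 1⟩],
    288, 1853125851073590525439697012361839141225333080024754554250960551244591937880320⟩,
  ⟨(1, true), (2, false), (4, true), 3, 1, 2, 24, 4793488,
    [⟨2, 2, 2, 0, 0, 0, 2, 1, -1, 0⟩, ⟨4, 4, 2, 6, 0, 2, -2, 2, -1, -3⟩,
    ⟨4, 2, 4, 6, 2, 0, -2, 1, -2, 3⟩, ⟨4, 4, 2, -6, 0, 2, 2, 2, -1, 3⟩,
    ⟨4, 2, 4, -6, 2, 0, 2, 1, -2, -3⟩], 144, 1415920330065119477288718704866479028846848⟩,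
  ⟨(1, false), (2, false), (4, false), 2, 1, 6, 2, 3,
    [⟨2, 2, 2, 0, 0, 0, 2, 1, -1, 0⟩, ⟨2, 0, 2, 2, 2, 0, 0, 0, 1, -1⟩], 48, 69793484864⟩,
  ⟨(1, true), (2, true), (4, true), 2, 1, 2, 6, 36,
    [⟨2, 2, 0, 2, 0, 2, 0, 1, 0, -1⟩], 48, 17452499984⟩,
  ⟨(1, false), (2, true), (7, true), 2, 14, 3, 42, 268435456,
    [⟨14, 2, 3, 1, 1, -2, 4, 2, -1, -1⟩, ⟨14, 1, 3, 2, 4, -2, 1, 1, 1, -2⟩,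
    ⟨14, 1, 3, -2, 4, -2, -1, 1, 1, 2⟩, ⟨14, 3, 2, -1, 2, -1, 4, 1, -2, -1⟩,
    ⟨14, 3, 1, 2, 2, -4, -1, 1, 1, -2⟩, ⟨14, 3, -1, -2, 2, 4, 1, 1, -1, 2⟩,
    ⟨14, 3, -2, 1, 2, 1, -4, 1, 2, 1⟩, ⟨14, 3, -2, -1, 2, 1, 4, 1, 2, -1⟩,
    ⟨14, 2, 3, -1, 1, -2, -4, 2, -1, 1⟩, ⟨14, 2, 1, -3, 1, 4, 2, 2, -1, 1⟩,
    ⟨14, 2, -1, -3, 1, -4, 2, 2, 1, 1⟩, ⟨14, 1, 2, -3, 4, 1, 2, 1, -2, -1⟩,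
    ⟨14, 1, -2, 3, 4, -1, -2, 1, 2, 1⟩, ⟨14, 1, -2, -3, 4, -1, 2, 1, 2, -1⟩,
    ⟨14, 1, -3, 2, 4, 2, 1, 1, -1, -2⟩], 36, 8589967360⟩,
  ⟨(1, false), (3, true), (3, true), 2, 1, 3, 3, 5,
    [⟨1, 1, 0, 0, 0, 1, 0, 0, 0, 1⟩], 72, 9243642641948901952⟩]

theorem ternaryFacts_test_first : (ternaryFacts.take 36).all TernaryFact.test = true := by
  decide +kernel

theorem ternaryFacts_test_second : ((ternaryFacts.drop 36).take 36).all TernaryFact.test = true := by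
  decide +kernel

theorem ternaryFacts_test_third : ((ternaryFacts.drop 36).drop 36).all TernaryFact.test = true := by
  decide +kernel

/-- The table of residue classes represented by ternary subsums. -/
def maskTable : List MaskEntry :=
  ternaryFacts.map TernaryFact.entry ++
  ((ternaryFacts.filter fun f => f.entry.terms == [(1, false), (1, true), (2, false)]).map
    fun f => ⟨[(1, true), (2, false), (3, true)], f.period, f.mask⟩) ++
  ((ternaryFacts.filter fun f => f.entry.terms == [(1, false), (2, false), (2, true)]).map
    fun f => ⟨[(1, false), (2, true), (6, true)], f.period, f.mask⟩)

theorem test_of_mem_ternaryFacts {f : TernaryFact} (hf : f ∈ ternaryFacts) : f.test = true := by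
  rw [← List.take_append_drop 36 ternaryFacts, ← List.take_append_drop 36 (ternaryFacts.drop 36),
    List.mem_append, List.mem_append] at hf
  rcases hf with hf | hf | hf
  · exact List.all_eq_true.1 ternaryFacts_test_first f hf
  · exact List.all_eq_true.1 ternaryFacts_test_second f hf
  · exact List.all_eq_true.1 ternaryFacts_test_third f hf

theorem smallDet_of_terms : (ternaryFacts.all fun f => f.smallDet ||
    (f.entry.terms != [(1, false), (1, true), (2, false)] &&
      f.entry.terms != [(1, false), (2, false), (2, true)])) = true := by
  decide +kernel

theorem maskTable_sound {e : MaskEntry} (he : e ∈ maskTable) : e.Sound := by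
  simp only [maskTable, List.mem_append, List.mem_map, List.mem_filter, beq_iff_eq] at he
  rcases he with (⟨f, hf, rfl⟩ | ⟨f, ⟨hf, ht⟩, rfl⟩) | ⟨f, ⟨hf, ht⟩, rfl⟩
  · exact f.sound (test_of_mem_ternaryFacts hf)
  · have := List.all_eq_true.1 smallDet_of_terms f hf
    refine f.sound_one_three_six (test_of_mem_ternaryFacts hf) ?_ ht
    simpa [ht] using this
  · have := List.all_eq_true.1 smallDet_of_terms f hf
    refine f.sound_two_three_six (test_of_mem_ternaryFacts hf) ?_ ht
    simpa [ht] using this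

/-! ### Rational maps between ternary forms -/

/-- A ternary quadratic form with natural coefficients. -/
structure FormCoeffs where
  a : ℕ
  b : ℕ
  c : ℕ
  r : ℕ
  s : ℕ
  t : ℕ
  deriving DecidableEq

/-- The value of the form. -/
def FormCoeffs.eval (F : FormCoeffs) (x y z : ℤ) : ℤ := ternaryForm F.a F.b F.c F.r F.s F.t x y z

/-- A rational matrix with a target form. The entries of the numerator are stored increased by
`12 * den`, so that they are natural numbers with the right residues modulo `3 * den`. -/
structure FormMap where
  tgt : FormCoeffs
  den : ℕ
  a₁ : ℕ
  a₂ : ℕ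
  a₃ : ℕ
  b₁ : ℕ
  b₂ : ℕ
  b₃ : ℕ
  c₁ : ℕ
  c₂ : ℕ
  c₃ : ℕ

/-- A linear form with shifted coefficients. -/
def FormMap.row (g : FormMap) (p q r : ℕ) (x y z : ℤ) : ℤ :=
  (p - 12 * g.den) * x + (q - 12 * g.den) * y + (r - 12 * g.den) * z

/-- The image of `(x, y, z)` is `(u, v, w)`. -/
def FormMap.Maps (g : FormMap) (x y z u v w : ℤ) : Prop :=
  g.row g.a₁ g.a₂ g.a₃ x y z = g.den * u ∧ g.row g.b₁ g.b₂ g.b₃ x y z = g.den * v ∧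
    g.row g.c₁ g.c₂ g.c₃ x y z = g.den * w

/-- `v` is divisible by `d`, and the quotient is prime to `3` if `k` is set. -/
def goodResidue (k : Bool) (d v : ℕ) : Bool :=
  bif Nat.beq (Nat.mod v d) 0 then
    bif k then bif Nat.beq (Nat.mod v (Nat.mul 3 d)) 0 then false else true else true
  else false

/-- The linear form on residues. -/
def rowResidue (p q r x y z : ℕ) : ℕ := Nat.add (Nat.mul p x) (Nat.add (Nat.mul q y) (Nat.mul r z))

/-- The image of a residue vector is integral, with the second and third coordinate prime to `3`
if `k` is set. -/
def FormMap.testResidue (k : Bool) (x y z : ℕ) : FormMap → Bool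
  | ⟨_, d, a₁, a₂, a₃, b₁, b₂, b₃, c₁, c₂, c₃⟩ =>
    bif goodResidue false d (rowResidue a₁ a₂ a₃ x y z) then
      bif goodResidue k d (rowResidue b₁ b₂ b₃ x y z) then
        goodResidue k d (rowResidue c₁ c₂ c₃ x y z) else false
    else false

/-- The map multiplies the form `F` by `div / mult`. -/
def FormMap.testForm (F : FormCoeffs) (mult div : ℕ) (g : FormMap) : Bool :=
  let e : ℕ → ℤ := fun p => p - 12 * g.den
  let D : ℤ := g.den * g.den * div
  let B : ℕ → ℕ → ℕ → ℕ → ℕ → ℕ → ℤ := fun p q r p' q' r' =>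
    mult * (2 * (g.tgt.a * (e p * e p') + g.tgt.b * (e q * e q') + g.tgt.c * (e r * e r')) +
      g.tgt.r * (e q * e r' + e r * e q') + g.tgt.s * (e p * e r' + e r * e p') +
      g.tgt.t * (e p * e q' + e q * e p'))
  0 < g.den && 0 < mult &&
  B g.a₁ g.b₁ g.c₁ g.a₁ g.b₁ g.c₁ == D * (2 * F.a) &&
  B g.a₂ g.b₂ g.c₂ g.a₂ g.b₂ g.c₂ == D * (2 * F.b) &&
  B g.a₃ g.b₃ g.c₃ g.a₃ g.b₃ g.c₃ == D * (2 * F.c) &&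
  B g.a₂ g.b₂ g.c₂ g.a₃ g.b₃ g.c₃ == D * F.r &&
  B g.a₁ g.b₁ g.c₁ g.a₃ g.b₃ g.c₃ == D * F.s &&
  B g.a₁ g.b₁ g.c₁ g.a₂ g.b₂ g.c₂ == D * F.t

theorem FormMap.Maps.eval_eq {g : FormMap} {F : FormCoeffs} {mult div : ℕ} {x y z u v w : ℤ}
    (hm : g.Maps x y z u v w) (h : g.testForm F mult div = true) :
    mult * g.tgt.eval u v w = div * F.eval x y z := by
  simp only [testForm, Bool.and_eq_true, decide_eq_true_eq, beq_iff_eq] at h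
  obtain ⟨⟨⟨⟨⟨⟨⟨hd, -⟩, e1⟩, e2⟩, e3⟩, e4⟩, e5⟩, e6⟩ := h
  obtain ⟨h1, h2, h3⟩ := hm
  have hne : (2 * (g.den * g.den) : ℤ) ≠ 0 := by positivity
  refine mul_left_cancel₀ hne ?_
  have hform : 2 * (mult : ℤ) * ternaryForm g.tgt.a g.tgt.b g.tgt.c g.tgt.r g.tgt.s g.tgt.t
      (g.row g.a₁ g.a₂ g.a₃ x y z) (g.row g.b₁ g.b₂ g.b₃ x y z) (g.row g.c₁ g.c₂ g.c₃ x y z) =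
      2 * (g.den * g.den * div) * F.eval x y z := by
    unfold FormCoeffs.eval ternaryForm row
    linear_combination x ^ 2 * e1 + y ^ 2 * e2 + z ^ 2 * e3 + 2 * y * z * e4 + 2 * x * z * e5 +
      2 * x * y * e6
  rw [h1, h2, h3] at hform
  have e : ∀ d u v w : ℤ, ternaryForm g.tgt.a g.tgt.b g.tgt.c g.tgt.r g.tgt.s g.tgt.t
      (d * u) (d * v) (d * w) = d * d * g.tgt.eval u v w := by
    intros; unfold FormCoeffs.eval ternaryForm; ring
  rw [e] at hform
  linear_combination hform

theorem FormMap.exists_of_goodResidue {g : FormMap} {k : Bool} {Q n : ℕ} {p q r X Y Z : ℕ}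
    {x y z : ℤ} (hn : n.Coprime g.den) (hQ : (bif k then 3 * g.den else g.den) ∣ Q)
    (hx : (X : ℤ) ≡ n * x [ZMOD Q]) (hy : (Y : ℤ) ≡ n * y [ZMOD Q]) (hz : (Z : ℤ) ≡ n * z [ZMOD Q])
    (h : goodResidue k g.den (rowResidue p q r X Y Z) = true) :
    ∃ u, g.row p q r x y z = g.den * u ∧ (k = true → ¬ 3 ∣ u) := by
  have hmod : ∀ d : ℕ, d ∣ Q → d ∣ 3 * g.den →
      ((rowResidue p q r X Y Z : ℕ) : ℤ) ≡ n * g.row p q r x y z [ZMOD d] := by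
    intro d hd hd'
    have hdQ : (d : ℤ) ∣ Q := by exact_mod_cast hd
    have h12 : ∀ t : ℕ, ((t : ℤ)) ≡ t - 12 * g.den [ZMOD d] := by
      intro t
      refine (Int.modEq_iff_dvd.2 ?_)
      rw [show (t : ℤ) - 12 * g.den - t = -(4 * ((3 * g.den : ℕ) : ℤ)) by push_cast; ring, dvd_neg]
      exact dvd_mul_of_dvd_right (by exact_mod_cast hd') _
    have := ((h12 p).mul (hx.of_dvd hdQ)).add (((h12 q).mul (hy.of_dvd hdQ)).add
      ((h12 r).mul (hz.of_dvd hdQ)))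
    convert this using 1
    · change ((p * X + (q * Y + r * Z) : ℕ) : ℤ) = _
      push_cast; ring
    · unfold row; ring
  have hdQ : g.den ∣ Q := by
    refine dvd_trans ?_ hQ
    cases k
    · exact dvd_rfl
    · exact dvd_mul_left _ _
  unfold goodResidue at h
  cases hb : Nat.beq (Nat.mod (rowResidue p q r X Y Z) g.den) 0 with
  | false => rw [hb] at h; cases h
  | true =>
    rw [hb, cond_true] at h
    have hb : rowResidue p q r X Y Z % g.den = 0 := Nat.eq_of_beq_eq_true hb
    have h1 := (hmod g.den hdQ (dvd_mul_left _ _)).symm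
    have h2 : (g.den : ℤ) ∣ n * g.row p q r x y z := by
      refine h1.dvd_iff.2 ?_
      exact_mod_cast Nat.dvd_of_mod_eq_zero hb
    have h3 : IsCoprime (g.den : ℤ) n := (Nat.isCoprime_iff_coprime.2 hn).symm
    obtain ⟨u, hu⟩ := h3.dvd_of_dvd_mul_left h2
    refine ⟨u, hu, ?_⟩
    rintro rfl ⟨v, rfl⟩
    rw [cond_true] at h hQ
    have h4 := hmod (3 * g.den) hQ dvd_rfl
    rw [hu] at h4
    have h5 : ((3 * g.den : ℕ) : ℤ) ∣ (rowResidue p q r X Y Z : ℕ) :=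
      h4.dvd_iff.2 ⟨n * v, by push_cast; ring⟩
    have h6 : Nat.mod (rowResidue p q r X Y Z) (Nat.mul 3 g.den) = 0 :=
      Nat.mod_eq_zero_of_dvd (by exact_mod_cast h5)
    rw [h6] at h
    cases h

theorem FormMap.exists_maps {g : FormMap} {k : Bool} {Q n : ℕ} {X Y Z : ℕ}
    {x y z : ℤ} (hn : n.Coprime g.den) (hQ : (bif k then 3 * g.den else g.den) ∣ Q)
    (hx : (X : ℤ) ≡ n * x [ZMOD Q]) (hy : (Y : ℤ) ≡ n * y [ZMOD Q]) (hz : (Z : ℤ) ≡ n * z [ZMOD Q])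
    (h : g.testResidue k X Y Z = true) :
    ∃ u v w, g.Maps x y z u v w ∧ (k = true → ¬ 3 ∣ v ∧ ¬ 3 ∣ w) := by
  simp only [testResidue, Bool.cond_eq_ite, Bool.if_false_right, Bool.and_eq_true,
    decide_eq_true_eq] at h
  obtain ⟨h1, h2, h3⟩ := h
  obtain ⟨u, hu, -⟩ := exists_of_goodResidue hn (k := false) (dvd_trans (by
    cases k
    · exact dvd_rfl
    · exact dvd_mul_left _ _) hQ) hx hy hz h1
  obtain ⟨v, hv, hv3⟩ := exists_of_goodResidue hn hQ hx hy hz h2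
  obtain ⟨w, hw, hw3⟩ := exists_of_goodResidue hn hQ hx hy hz h3
  exact ⟨u, v, w, ⟨hu, hv, hw⟩, fun hk => ⟨hv3 hk, hw3 hk⟩⟩

/-- The form on residues. -/
def FormCoeffs.evalNat (F : FormCoeffs) (x y z : ℕ) : ℕ :=
  Nat.add (Nat.mul x (Nat.add (Nat.mul F.a x) (Nat.add (Nat.mul F.s z) (Nat.mul F.t y))))
    (Nat.add (Nat.mul y (Nat.add (Nat.mul F.b y) (Nat.mul F.r z))) (Nat.mul F.c (Nat.mul z z)))

theorem FormCoeffs.evalNat_cast (F : FormCoeffs) (x y z : ℕ) :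
    (F.evalNat x y z : ℤ) = F.eval x y z := by
  change ((x * (F.a * x + (F.s * z + F.t * y)) + (y * (F.b * y + F.r * z) + F.c * (z * z)) : ℕ) : ℤ)
    = _
  unfold eval ternaryForm
  push_cast; ring

theorem FormCoeffs.eval_modEq (F : FormCoeffs) {Q : ℤ} {x y z x' y' z' : ℤ} (hx : x ≡ x' [ZMOD Q])
    (hy : y ≡ y' [ZMOD Q]) (hz : z ≡ z' [ZMOD Q]) : F.eval x y z ≡ F.eval x' y' z' [ZMOD Q] := by
  unfold eval ternaryForm
  exact ((((((hx.pow 2).mul_left _).add ((hy.pow 2).mul_left _)).add ((hz.pow 2).mul_left _)).add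
    ((hy.mul hz).mul_left _)).add ((hx.mul hz).mul_left _)).add ((hx.mul hy).mul_left _)

/-- Vectors on which the value of `F` lies in one of the given residue classes are mapped to
integral vectors by one of the maps. Vectors divisible by a member of `primes` are skipped. -/
structure MapFact where
  src : FormCoeffs
  mult : ℕ
  div : ℕ
  modulus : ℕ
  residues : ℕ
  primes : List ℕ
  third : Bool
  maps : List FormMap

/-- Some test succeeds for all residue vectors with value in the given classes. -/
def scanResidues (F : FormCoeffs) (Q residues : ℕ) (test : ℕ → ℕ → ℕ → Bool) : Bool :=
  allBelow Q fun x => allBelow Q fun y => allBelow Q fun z =>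
    bif Nat.beq (Nat.land (Nat.shiftRight residues (Nat.mod (F.evalNat x y z) Q)) 1) 0 then true
    else test x y z

theorem test_of_scanResidues {F : FormCoeffs} {Q residues : ℕ} {test : ℕ → ℕ → ℕ → Bool}
    (hQ : 0 < Q) (h : scanResidues F Q residues test = true) {m : ℕ} {x y z : ℤ}
    (he : F.eval x y z = m) (hm : residues.testBit (m % Q)) :
    test (natResidue Q x) (natResidue Q y) (natResidue Q z) = true := by
  have h1 := allBelow_iff.1 (allBelow_iff.1 (allBelow_iff.1 h _ (natResidue_lt hQ x)) _
    (natResidue_lt hQ y)) _ (natResidue_lt hQ z)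
  have h2 : F.evalNat (natResidue Q x) (natResidue Q y) (natResidue Q z) % Q = m % Q := by
    have h3 := F.eval_modEq (natResidue_modEq hQ x) (natResidue_modEq hQ y) (natResidue_modEq hQ z)
    rw [← F.evalNat_cast, he] at h3
    exact Int.natCast_modEq_iff.1 h3
  have h3 : Nat.beq (Nat.land (Nat.shiftRight residues (Nat.mod (F.evalNat (natResidue Q x)
      (natResidue Q y) (natResidue Q z)) Q)) 1) 0 = false := by
    rw [← Bool.not_eq_true, Nat.beq_eq]
    change ¬ (residues >>> (F.evalNat (natResidue Q x) (natResidue Q y) (natResidue Q z) % Q) &&& 1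
      = 0)
    rw [h2, Nat.and_one_is_mod]
    rw [Nat.testBit_eq_decide_div_mod_eq, decide_eq_true_eq] at hm
    rw [Nat.shiftRight_eq_div_pow, hm]
    norm_num
  rwa [h3, cond_false] at h1

/-- Correctness test. -/
def MapFact.test (f : MapFact) : Bool :=
  0 < f.modulus && (f.primes.all fun p => 1 < p && f.modulus % p == 0) &&
  (f.maps.all fun g => f.modulus % (bif f.third then 3 * g.den else g.den) == 0 &&
    g.testForm f.src f.mult f.div) &&
  scanResidues f.src f.modulus f.residues fun x y z =>
    bif f.maps.any (FormMap.testResidue f.third x y z) then true else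
      f.primes.any fun p => Nat.beq (Nat.mod x p) 0 && Nat.beq (Nat.mod y p) 0 &&
        Nat.beq (Nat.mod z p) 0

theorem MapFact.exists_maps {f : MapFact} (h : f.test = true) {m : ℕ} {x y z : ℤ}
    (he : f.src.eval x y z = m) (hm : f.residues.testBit (m % f.modulus))
    (hp : f.primes = [] ∨ Primitive₃ x y z) : ∃ g ∈ f.maps, ∃ u v w, g.Maps x y z u v w ∧
      f.mult * g.tgt.eval u v w = f.div * m ∧ (f.third = true → ¬ 3 ∣ v ∧ ¬ 3 ∣ w) := by
  simp only [test, Bool.and_eq_true, decide_eq_true_eq, List.all_eq_true, beq_iff_eq] at h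
  obtain ⟨⟨⟨hQ, hprimes⟩, hmaps⟩, hscan⟩ := h
  have h1 := test_of_scanResidues hQ hscan he hm
  cases hany : f.maps.any (FormMap.testResidue f.third (natResidue f.modulus x)
      (natResidue f.modulus y) (natResidue f.modulus z)) with
  | true =>
    obtain ⟨g, hg, hg'⟩ := List.any_eq_true.1 hany
    have hd := Nat.dvd_of_mod_eq_zero (hmaps g hg).1
    obtain ⟨u, v, w, hmap, h3⟩ := FormMap.exists_maps (Nat.coprime_one_left g.den) hd
      (x := x) (y := y) (z := z) (by simpa using natResidue_modEq hQ x)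
      (by simpa using natResidue_modEq hQ y) (by simpa using natResidue_modEq hQ z) hg'
    exact ⟨g, hg, u, v, w, hmap, by rw [hmap.eval_eq (hmaps g hg).2, he], h3⟩
  | false =>
    rw [hany, cond_false, List.any_eq_true] at h1
    obtain ⟨p, hp', h1⟩ := h1
    simp only [Bool.and_eq_true, Nat.beq_eq] at h1
    obtain ⟨⟨hx, hy⟩, hz⟩ := h1
    have hpQ := Nat.dvd_of_mod_eq_zero (hprimes p hp').2
    have e1 := natResidue_mod hQ hpQ x
    have e2 := natResidue_mod hQ hpQ y
    have e3 := natResidue_mod hQ hpQ z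
    rw [show natResidue f.modulus x % p = 0 from hx] at e1
    rw [show natResidue f.modulus y % p = 0 from hy] at e2
    rw [show natResidue f.modulus z % p = 0 from hz] at e3
    rcases hp with hp | hp
    · rw [hp] at hp'; cases hp'
    · have := Int.le_of_dvd one_pos (hp p (Int.dvd_of_emod_eq_zero e1.symm)
        (Int.dvd_of_emod_eq_zero e2.symm) (Int.dvd_of_emod_eq_zero e3.symm))
      have := (hprimes p hp').1
      omega

/-- The form `3 x² + y² + 3 z²`. -/
abbrev form313 : FormCoeffs := ⟨3, 1, 3, 0, 0, 0⟩

/-- Maps from `form313` to itself. -/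
def form313MapsSeven : MapFact :=
  ⟨form313, 1, 1, 21, 533632, [], true,
    [⟨form313, 1, 13, 12, 12, 12, 13, 12, 12, 12, 13⟩,
    ⟨form313, 1, 12, 12, 13, 12, 13, 12, 13, 12, 12⟩,
    ⟨form313, 7, 91, 84, 84, 84, 85, 72, 84, 88, 85⟩,
    ⟨form313, 7, 85, 82, 78, 90, 79, 90, 90, 86, 83⟩,
    ⟨form313, 7, 85, 82, 90, 90, 79, 78, 90, 86, 85⟩,
    ⟨form313, 7, 91, 84, 84, 84, 85, 96, 84, 88, 83⟩,
    ⟨form313, 7, 84, 84, 91, 96, 83, 84, 85, 88, 84⟩,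
    ⟨form313, 7, 85, 86, 78, 90, 89, 90, 90, 82, 83⟩,
    ⟨form313, 7, 85, 86, 90, 90, 89, 78, 90, 82, 85⟩,
    ⟨form313, 7, 84, 84, 91, 96, 85, 84, 85, 80, 84⟩]⟩

theorem form313MapsSeven_test : form313MapsSeven.test = true := by
  decide +kernel

/-- Maps from `form313` to itself. -/
def form313MapsEleven : MapFact :=
  ⟨form313, 1, 1, 33, 273163392, [], true,
    [⟨form313, 1, 13, 12, 12, 12, 13, 12, 12, 12, 13⟩,
    ⟨form313, 1, 12, 12, 13, 12, 13, 12, 13, 12, 12⟩,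
    ⟨form313, 11, 135, 126, 134, 138, 131, 114, 142, 134, 135⟩,
    ⟨form313, 11, 135, 128, 140, 144, 127, 120, 140, 136, 135⟩,
    ⟨form313, 11, 134, 126, 129, 150, 133, 138, 135, 134, 122⟩,
    ⟨form313, 11, 134, 126, 135, 150, 133, 126, 135, 134, 142⟩,
    ⟨form313, 11, 135, 128, 124, 144, 127, 144, 140, 136, 129⟩,
    ⟨form313, 11, 135, 126, 130, 138, 131, 150, 142, 134, 129⟩,
    ⟨form313, 11, 135, 136, 124, 144, 137, 144, 140, 128, 129⟩,
    ⟨form313, 11, 135, 136, 140, 144, 137, 120, 140, 128, 135⟩,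
    ⟨form313, 11, 134, 138, 129, 150, 131, 138, 135, 130, 122⟩,
    ⟨form313, 11, 134, 138, 135, 150, 131, 126, 135, 130, 142⟩,
    ⟨form313, 11, 135, 138, 130, 138, 133, 150, 142, 130, 129⟩,
    ⟨form313, 11, 135, 138, 134, 138, 133, 114, 142, 130, 135⟩]⟩

theorem form313MapsEleven_test : form313MapsEleven.test = true := by
  decide +kernel

/-- The form `3 x² + 2 y² + 3 z²`. -/
abbrev form323 : FormCoeffs := ⟨3, 2, 3, 0, 0, 0⟩

/-- Maps from `form323` to itself. -/
def form323MapsSeven : MapFact :=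
  ⟨form323, 1, 1, 21, 1196064, [], true,
    [⟨form323, 1, 13, 12, 12, 12, 13, 12, 12, 12, 13⟩,
    ⟨form323, 1, 12, 12, 13, 12, 13, 12, 13, 12, 12⟩,
    ⟨form323, 7, 87, 80, 80, 90, 83, 90, 88, 88, 81⟩,
    ⟨form323, 7, 91, 84, 84, 84, 89, 78, 84, 88, 89⟩,
    ⟨form323, 7, 91, 84, 84, 84, 89, 90, 84, 88, 79⟩,
    ⟨form323, 7, 87, 80, 88, 90, 83, 78, 88, 88, 87⟩,
    ⟨form323, 7, 84, 84, 91, 90, 79, 84, 89, 88, 84⟩,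
    ⟨form323, 7, 84, 84, 91, 90, 89, 84, 89, 80, 84⟩,
    ⟨form323, 7, 87, 88, 80, 90, 85, 90, 88, 80, 81⟩,
    ⟨form323, 7, 87, 88, 88, 90, 85, 78, 88, 80, 87⟩]⟩

theorem form323MapsSeven_test : form323MapsSeven.test = true := by
  decide +kernel

/-- Maps from `form323` to itself. -/
def form323MapsEleven : MapFact :=
  ⟨form323, 1, 1, 33, 76564512, [], true,
    [⟨form323, 1, 13, 12, 12, 12, 13, 12, 12, 12, 13⟩,
    ⟨form323, 1, 12, 12, 13, 12, 13, 12, 13, 12, 12⟩,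
    ⟨form323, 11, 143, 132, 132, 132, 137, 144, 132, 140, 127⟩,
    ⟨form323, 11, 135, 124, 128, 144, 133, 138, 136, 136, 123⟩,
    ⟨form323, 11, 136, 124, 129, 138, 131, 144, 141, 136, 128⟩,
    ⟨form323, 11, 136, 124, 135, 138, 131, 120, 141, 136, 136⟩,
    ⟨form323, 11, 135, 124, 136, 144, 133, 126, 136, 136, 141⟩,
    ⟨form323, 11, 143, 132, 132, 132, 137, 120, 132, 140, 137⟩,
    ⟨form323, 11, 132, 132, 143, 144, 127, 132, 137, 140, 132⟩,
    ⟨form323, 11, 135, 140, 136, 144, 131, 126, 136, 128, 141⟩,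
    ⟨form323, 11, 135, 140, 128, 144, 131, 138, 136, 128, 123⟩,
    ⟨form323, 11, 136, 140, 129, 138, 133, 144, 141, 128, 128⟩,
    ⟨form323, 11, 132, 132, 143, 144, 137, 132, 137, 124, 132⟩,
    ⟨form323, 11, 136, 140, 135, 138, 133, 120, 141, 128, 136⟩]⟩

theorem form323MapsEleven_test : form323MapsEleven.test = true := by
  decide +kernel

/-- The form `x² + y² + 3 z²`. -/
abbrev form113 : FormCoeffs := ⟨1, 1, 3, 0, 0, 0⟩

/-- The form `3 x² + 2 y² + 5 z²`. -/
abbrev form325 : FormCoeffs := ⟨3, 2, 5, 0, 0, 0⟩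

/-- The form `x² + y² + 30 z²`, in the genus of `form325`. -/
abbrev form11T : FormCoeffs := ⟨1, 1, 30, 0, 0, 0⟩

/-- Maps from `form113` to `form325` or `form11T`. -/
def form113Maps : MapFact :=
  ⟨form113, 10, 1, 20, 1025, [2, 5], false,
    [⟨form325, 10, 121, 121, 122, 121, 121, 117, 121, 119, 120⟩,
    ⟨form325, 10, 121, 121, 118, 121, 121, 123, 121, 119, 120⟩,
    ⟨form11T, 10, 121, 123, 120, 123, 119, 120, 120, 120, 121⟩,
    ⟨form11T, 10, 121, 117, 120, 123, 121, 120, 120, 120, 121⟩,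
    ⟨form325, 10, 121, 119, 122, 121, 119, 117, 121, 121, 120⟩,
    ⟨form325, 10, 121, 119, 118, 121, 119, 123, 121, 121, 120⟩,
    ⟨form325, 20, 241, 242, 235, 244, 238, 240, 241, 242, 243⟩,
    ⟨form325, 20, 241, 242, 245, 244, 238, 240, 241, 242, 237⟩,
    ⟨form11T, 20, 241, 234, 243, 243, 242, 249, 241, 240, 239⟩,
    ⟨form325, 20, 243, 242, 241, 242, 238, 234, 241, 238, 243⟩,
    ⟨form325, 20, 243, 242, 239, 242, 238, 246, 241, 238, 237⟩,
    ⟨form11T, 20, 241, 234, 237, 243, 242, 231, 241, 240, 241⟩,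
    ⟨form11T, 20, 241, 246, 243, 243, 238, 249, 241, 240, 239⟩,
    ⟨form325, 20, 243, 238, 241, 242, 242, 234, 241, 242, 243⟩,
    ⟨form325, 20, 243, 238, 239, 242, 242, 246, 241, 242, 237⟩,
    ⟨form11T, 20, 241, 246, 237, 243, 238, 231, 241, 240, 241⟩,
    ⟨form325, 20, 241, 238, 235, 244, 242, 240, 241, 238, 243⟩,
    ⟨form325, 20, 241, 238, 245, 244, 242, 240, 241, 238, 237⟩,
    ⟨form325, 20, 242, 241, 235, 242, 236, 240, 242, 241, 243⟩,
    ⟨form325, 20, 242, 241, 245, 242, 236, 240, 242, 241, 237⟩,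
    ⟨form11T, 20, 242, 243, 249, 246, 239, 237, 240, 241, 239⟩,
    ⟨form325, 20, 242, 243, 241, 242, 238, 246, 242, 239, 237⟩,
    ⟨form325, 20, 242, 243, 239, 242, 238, 234, 242, 239, 243⟩,
    ⟨form11T, 20, 242, 243, 231, 246, 239, 243, 240, 241, 241⟩,
    ⟨form325, 20, 242, 237, 239, 242, 242, 234, 242, 241, 243⟩,
    ⟨form11T, 20, 242, 237, 231, 246, 241, 243, 240, 241, 239⟩,
    ⟨form11T, 20, 242, 237, 249, 246, 241, 237, 240, 241, 241⟩,
    ⟨form325, 20, 242, 237, 241, 242, 242, 246, 242, 241, 237⟩,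
    ⟨form325, 20, 242, 239, 245, 242, 244, 240, 242, 239, 237⟩,
    ⟨form325, 20, 242, 239, 235, 242, 244, 240, 242, 239, 243⟩]⟩

theorem form113Maps_test : form113Maps.test = true := by
  decide +kernel

/-- Maps from `form11T` to `form325`. -/
def form11TMapsSeven : MapFact :=
  ⟨form11T, 1, 1, 7, 105, [], false,
    [⟨form325, 7, 86, 81, 74, 88, 85, 99, 85, 86, 72⟩,
    ⟨form325, 7, 86, 81, 94, 88, 85, 69, 85, 86, 96⟩,
    ⟨form325, 7, 87, 82, 94, 85, 88, 99, 86, 85, 72⟩,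
    ⟨form325, 7, 87, 82, 74, 85, 88, 69, 86, 85, 96⟩,
    ⟨form325, 7, 86, 87, 94, 88, 83, 69, 85, 82, 96⟩,
    ⟨form325, 7, 86, 87, 74, 88, 83, 99, 85, 82, 72⟩,
    ⟨form325, 7, 87, 86, 74, 85, 80, 69, 86, 83, 96⟩,
    ⟨form325, 7, 87, 86, 94, 85, 80, 99, 86, 83, 72⟩]⟩

theorem form11TMapsSeven_test : form11TMapsSeven.test = true := by
  decide +kernel

/-- Maps of denominator `19` from `form11T` to itself. -/
def form11TSelfMaps : List FormMap :=
  [⟨form11T, 19, 232, 243, 168, 243, 232, 288, 230, 226, 217⟩,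
  ⟨form11T, 19, 232, 243, 288, 243, 232, 168, 230, 226, 239⟩,
  ⟨form11T, 19, 232, 213, 168, 243, 224, 288, 230, 230, 217⟩,
  ⟨form11T, 19, 232, 213, 288, 243, 224, 168, 230, 230, 239⟩]

/-- Maps from `form11T` to `form325` or `form11T`. -/
def form11TMapsNineteen : MapFact :=
  ⟨form11T, 1, 1, 19, 324877, [], false,
    [⟨form325, 19, 229, 234, 178, 241, 230, 243, 230, 221, 204⟩,
    ⟨form325, 19, 229, 234, 278, 241, 230, 213, 230, 221, 252⟩,
    ⟨form325, 19, 229, 222, 178, 241, 226, 243, 230, 235, 204⟩,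
    ⟨form325, 19, 229, 222, 278, 241, 226, 213, 230, 235, 252⟩,
    ⟨form325, 19, 234, 219, 238, 236, 235, 273, 233, 230, 192⟩,
    ⟨form325, 19, 234, 219, 218, 236, 235, 183, 233, 230, 264⟩,
    ⟨form325, 19, 234, 237, 238, 236, 221, 273, 233, 226, 192⟩,
    ⟨form325, 19, 234, 237, 218, 236, 221, 183, 233, 226, 264⟩,
    ⟨form325, 19, 237, 222, 218, 235, 236, 273, 230, 233, 192⟩,
    ⟨form325, 19, 237, 222, 238, 235, 236, 183, 230, 233, 264⟩,
    ⟨form325, 19, 237, 234, 218, 235, 220, 273, 230, 223, 192⟩,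
    ⟨form325, 19, 237, 234, 238, 235, 220, 183, 230, 223, 264⟩,
    ⟨form325, 19, 234, 229, 178, 230, 241, 243, 235, 226, 252⟩,
    ⟨form325, 19, 234, 229, 278, 230, 241, 213, 235, 226, 204⟩,
    ⟨form325, 19, 234, 227, 178, 230, 215, 243, 235, 230, 252⟩,
    ⟨form325, 19, 234, 227, 278, 230, 215, 213, 235, 230, 204⟩] ++ form11TSelfMaps⟩

theorem form11TMapsNineteen_test : form11TMapsNineteen.test = true := by
  decide +kernel

/-- Maps of denominator `11` from `form11T` to `form325`. -/
def form11TMapsEleven : List FormMap :=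
  [⟨form325, 11, 133, 126, 142, 139, 134, 147, 134, 131, 108⟩,
  ⟨form325, 11, 133, 126, 122, 139, 134, 117, 134, 131, 156⟩,
  ⟨form325, 11, 133, 138, 142, 139, 130, 147, 134, 133, 108⟩,
  ⟨form325, 11, 133, 138, 122, 139, 130, 117, 134, 133, 156⟩,
  ⟨form325, 11, 138, 131, 122, 134, 139, 147, 133, 130, 156⟩,
  ⟨form325, 11, 138, 131, 142, 134, 139, 117, 133, 130, 108⟩,
  ⟨form325, 11, 138, 133, 122, 134, 125, 147, 133, 134, 156⟩,
  ⟨form325, 11, 138, 133, 142, 134, 125, 117, 133, 134, 108⟩]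

/-- The form `x² + y² + 2 z² + y z + x z + x y`. -/
abbrev form112 : FormCoeffs := ⟨1, 1, 2, 1, 1, 1⟩

/-- The form `3 x² + 6 y² + 5 z²`. -/
abbrev form365 : FormCoeffs := ⟨3, 6, 5, 0, 0, 0⟩

/-- The form `2 x² + 6 y² + 9 z² + 6 y z`, in the genus of `form365`. -/
abbrev form269 : FormCoeffs := ⟨2, 6, 9, 6, 0, 0⟩

/-- Maps from `form112` to `form365` or `form269`. -/
def form112Maps : MapFact :=
  ⟨form112, 2, 1, 12, 1024, [2, 3], false,
    [⟨form365, 12, 148, 147, 143, 146, 144, 148, 144, 147, 147⟩,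
    ⟨form365, 12, 147, 143, 148, 144, 146, 148, 147, 147, 144⟩,
    ⟨form365, 12, 147, 148, 143, 144, 146, 148, 147, 144, 147⟩,
    ⟨form365, 12, 148, 145, 149, 146, 146, 142, 144, 147, 147⟩,
    ⟨form365, 12, 145, 141, 140, 146, 144, 148, 147, 147, 144⟩,
    ⟨form365, 12, 145, 148, 149, 146, 146, 142, 147, 144, 147⟩,
    ⟨form269, 12, 150, 147, 147, 144, 141, 141, 144, 144, 148⟩,
    ⟨form269, 12, 147, 141, 144, 141, 141, 140, 144, 144, 148⟩,
    ⟨form269, 12, 147, 150, 147, 141, 144, 141, 144, 144, 148⟩]⟩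

theorem form112Maps_test : form112Maps.test = true := by
  decide +kernel

/-- Maps from `form269` to `form365`. -/
def form269Maps : MapFact :=
  ⟨form269, 1, 1, 39, 309850161152, [], false,
    [⟨form365, 3, 38, 35, 38, 37, 37, 34, 36, 39, 39⟩,
    ⟨form365, 3, 38, 37, 34, 37, 35, 38, 36, 39, 39⟩,
    ⟨form365, 3, 38, 37, 39, 37, 35, 33, 36, 39, 36⟩,
    ⟨form365, 3, 38, 35, 33, 37, 37, 39, 36, 39, 36⟩,
    ⟨form365, 13, 158, 147, 134, 157, 145, 158, 164, 159, 159⟩,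
    ⟨form365, 13, 162, 141, 151, 161, 163, 167, 160, 159, 144⟩,
    ⟨form365, 13, 162, 171, 166, 161, 149, 160, 160, 153, 141⟩,
    ⟨form365, 13, 162, 141, 146, 161, 163, 152, 160, 159, 171⟩,
    ⟨form365, 13, 162, 171, 161, 161, 149, 145, 160, 153, 168⟩,
    ⟨form365, 13, 158, 165, 178, 157, 167, 154, 164, 153, 153⟩,
    ⟨form365, 13, 158, 147, 169, 157, 145, 143, 164, 159, 156⟩,
    ⟨form365, 13, 158, 165, 143, 157, 167, 169, 164, 153, 156⟩,
    ⟨form365, 39, 474, 451, 517, 471, 505, 499, 492, 465, 456⟩,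
    ⟨form365, 39, 474, 451, 402, 471, 505, 474, 492, 465, 477⟩,
    ⟨form365, 39, 474, 485, 419, 471, 431, 437, 492, 471, 480⟩,
    ⟨form365, 39, 474, 485, 534, 471, 431, 462, 492, 471, 459⟩,
    ⟨form365, 39, 486, 433, 418, 483, 467, 500, 480, 501, 465⟩,
    ⟨form365, 39, 486, 503, 453, 483, 469, 501, 480, 435, 432⟩]⟩

theorem form269Maps_test : form269Maps.test = true := by
  decide +kernel

/-- Composition with a map of denominator `19` makes one of the maps of denominator `11`
integral. -/
theorem form11TSelfMaps_test : (form11TSelfMaps.all fun g => g.testForm form11T 1 1 &&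
    scanResidues form11T 11 571 fun x y z =>
      bif form11TMapsEleven.any (FormMap.testResidue false x y z) then true else
        form11TMapsEleven.any (FormMap.testResidue false
          (rowResidue (g.a₁ + 120 * g.den) (g.a₂ + 120 * g.den) (g.a₃ + 120 * g.den) x y z)
          (rowResidue (g.b₁ + 120 * g.den) (g.b₂ + 120 * g.den) (g.b₃ + 120 * g.den) x y z)
          (rowResidue (g.c₁ + 120 * g.den) (g.c₂ + 120 * g.den) (g.c₃ + 120 * g.den) x y z)))
    = true := by
  decide +kernel

/-! ### Leaves with rotations of binary subforms -/

theorem termsRep_of_smallMask_eq {T : ℕ} {l : List MixedTerm}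
    (h : smallMask T l = 2 ^ (T + 1) - 1) {n : ℕ} (hn : n ≤ T) : TermsRep l n := by
  refine termsRep_of_smallMask (T := T) ?_
  rw [h, Nat.testBit_two_pow_sub_one, decide_eq_true_eq]
  omega

theorem not_three_dvd_of_sq {x : ℤ} (h : x ^ 2 % 3 = 1) : ¬ 3 ∣ x := by
  rintro ⟨k, rfl⟩
  ring_nf at h
  omega

/-- Rotation by a cube root of unity. -/
theorem exists_sq_add_three_mul_sq {x z : ℤ} (hx : ¬ 3 ∣ x) (h2 : x % 2 = z % 2) :
    ∃ x' z', x' ^ 2 + 3 * z' ^ 2 = x ^ 2 + 3 * z ^ 2 ∧ ¬ 3 ∣ x' ∧ (3 ∣ z' ↔ ¬ 3 ∣ z) := by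
  obtain ⟨k, rfl⟩ : ∃ k, z = x + 2 * k := ⟨(z - x) / 2, by omega⟩
  by_cases h : 3 ∣ x + k ↔ ¬ 3 ∣ x + 2 * k
  · exact ⟨-x - 3 * k, x + k, by ring, by omega, h⟩
  · refine ⟨2 * x + 3 * k, k, by ring, by omega, ?_⟩
    rcases (by omega : x % 3 = 1 ∨ x % 3 = 2) with e | e <;>
      rcases (by omega : k % 3 = 0 ∨ k % 3 = 1 ∨ k % 3 = 2) with e' | e' | e' <;> omega

/-- Rotation by an element of norm `9` in `ℤ[√-5]`. -/
theorem exists_sq_add_five_mul_sq_of_not_dvd {a b : ℤ} (h : ¬ (3 ∣ a ∧ 3 ∣ b)) :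
    ∃ x w, x ^ 2 + 5 * w ^ 2 = 9 * (a ^ 2 + 5 * b ^ 2) ∧ ¬ 3 ∣ x ∧ ¬ 3 ∣ w := by
  by_cases h' : 3 ∣ 2 * a - 5 * b
  · exact ⟨2 * a + 5 * b, 2 * b - a, by ring, by omega, by omega⟩
  · exact ⟨2 * a - 5 * b, 2 * b + a, by ring, by omega, by omega⟩

theorem exists_sq_add_five_mul_sq (n : ℕ) : ∀ {x w : ℤ}, x.natAbs + w.natAbs ≤ n →
    ¬ (x = 0 ∧ w = 0) → 3 ∣ x → 3 ∣ w →
    ∃ x' w', x' ^ 2 + 5 * w' ^ 2 = x ^ 2 + 5 * w ^ 2 ∧ ¬ 3 ∣ x' ∧ ¬ 3 ∣ w' := by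
  induction n with
  | zero => intro x w hn h0; omega
  | succ n ih =>
    rintro _ _ hn h0 ⟨a, rfl⟩ ⟨b, rfl⟩
    by_cases hab : 3 ∣ a ∧ 3 ∣ b
    · obtain ⟨a', b', he, ha', hb'⟩ := ih (x := a) (w := b) (by omega) (by omega) hab.1 hab.2
      obtain ⟨x', w', h, h1, h2⟩ :=
        exists_sq_add_five_mul_sq_of_not_dvd (a := a') (b := b') (by tauto)
      exact ⟨x', w', by rw [h, he]; ring, h1, h2⟩
    · obtain ⟨x', w', h, h1, h2⟩ := exists_sq_add_five_mul_sq_of_not_dvd hab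
      exact ⟨x', w', by rw [h]; ring, h1, h2⟩

theorem RepSq.of_four {q₁ q₂ q₃ q₄ : MixedTerm} {A : ℤ} (x y z w : ℤ)
    (h : sqCoeff q₁ * x ^ 2 + sqCoeff q₂ * y ^ 2 + sqCoeff q₃ * z ^ 2 + sqCoeff q₄ * w ^ 2 = A)
    (h₁ : q₁.2 = true → ¬ 3 ∣ x) (h₂ : q₂.2 = true → ¬ 3 ∣ y) (h₃ : q₃.2 = true → ¬ 3 ∣ z)
    (h₄ : q₄.2 = true → ¬ 3 ∣ w) : RepSq [q₁, q₂, q₃, q₄] A :=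
  ⟨x, h₁, y, h₂, z, h₃, w, h₄, show _ = (0 : ℤ) by rw [← h]; ring⟩

theorem universalTerms_b1_b1_b3_a5 :
    UniversalTerms [(1, true), (1, true), (3, true), (5, false)] := by
  refine universalTerms_of_large 60 (by decide) (fun n => termsRep_of_smallMask_eq
    (by decide +kernel)) (fun A hA h3 _ _ _ => ?_) (by decide)
  change A % 3 = 2 at h3
  obtain ⟨x, y, z, h, -⟩ := exists_one_one_three (n := A - 135) (by omega) (by omega)
  dsimp only at h
  push_cast [show 135 ≤ A by omega] at h
  have hx := sq_emod_three x
  have hy := sq_emod_three y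
  have hx3 := not_three_dvd_of_sq (x := x) (by omega)
  have hy3 := not_three_dvd_of_sq (x := y) (by omega)
  by_cases hz : 3 ∣ z
  · obtain ⟨a, rfl⟩ := hz
    obtain ⟨z', w', h', hz', -⟩ := exists_sq_add_five_mul_sq_of_not_dvd (a := a) (b := 1) (by omega)
    exact .of_four x y z' w' (by simp [sqCoeff]; linear_combination h + 3 * h') (fun _ => hx3)
      (fun _ => hy3) (fun _ => hz') (by simp)
  · exact .of_four x y z 3 (by simp [sqCoeff]; linear_combination h) (fun _ => hx3)
      (fun _ => hy3) (fun _ => hz) (by simp)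

theorem repSq_b1_b1_b3_b3_of_half {X Y Z W : ℤ} (hX : ¬ 3 ∣ X) (hY : 3 ∣ Y) (hZ : 3 ∣ Z)
    (hW : ¬ 3 ∣ W) : RepSq [(1, true), (1, true), (3, true), (3, true)]
      (2 * (X ^ 2 + Y ^ 2 + 3 * Z ^ 2 + 3 * W ^ 2)) :=
  .of_four (X + Y) (X - Y) (Z + W) (Z - W) (by simp [sqCoeff]; ring) (fun _ => by omega)
    (fun _ => by omega) (fun _ => by omega) (fun _ => by omega)

theorem universalTerms_b1_b1_b3_b3 :
    UniversalTerms [(1, true), (1, true), (3, true), (3, true)] := by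
  refine universalTerms_of_large 80 (by decide) (fun n => termsRep_of_smallMask_eq
    (by decide +kernel)) (fun A hA h3 h4 _ _ => ?_) (by decide)
  change A % 3 = 2 at h3
  by_cases h2 : A % 2 = 0
  · obtain ⟨B, rfl⟩ : ∃ B, A = 2 * B := ⟨A / 2, by omega⟩
    obtain ⟨X, Y, W, h, hX, hY⟩ : ∃ X Y W : ℤ, X ^ 2 + Y ^ 2 + 3 * W ^ 2 = B - 3 ∧ ¬ 3 ∣ X ∧
        3 ∣ Y := by
      obtain ⟨x, y, z, h, -⟩ := exists_one_one_three (n := B - 3) (by omega) (by omega)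
      dsimp only at h
      push_cast [show 3 ≤ B by omega] at h
      have hx := sq_emod_three x
      have hy := sq_emod_three y
      by_cases h : 3 ∣ x
      · refine ⟨y, x, z, by linarith, not_three_dvd_of_sq ?_, h⟩
        obtain ⟨k, rfl⟩ := h
        ring_nf at *
        omega
      · refine ⟨x, y, z, by linarith, h, ?_⟩
        by_contra hy3
        have : x ^ 2 % 3 = 1 := by
          rcases (by omega : x % 3 = 1 ∨ x % 3 = 2) with e | e <;> simp [pow_two, Int.mul_emod, e]
        have : y ^ 2 % 3 = 1 := by
          rcases (by omega : y % 3 = 1 ∨ y % 3 = 2) with e | e <;> simp [pow_two, Int.mul_emod, e]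
        omega
    have key : ∀ Y W : ℤ, X ^ 2 + Y ^ 2 + 3 * W ^ 2 = B - 3 → 3 ∣ Y → ¬ 3 ∣ W → X % 2 = W % 2 →
        RepSq [(1, true), (1, true), (3, true), (3, true)] ((2 * B : ℕ) : ℤ) := by
      intro Y W h hY hW h2
      obtain ⟨X', W', e, hX', hW'⟩ := exists_sq_add_three_mul_sq hX h2
      have := repSq_b1_b1_b3_b3_of_half hX' hY (hW'.2 hW) (W := 1) (by decide)
      convert this using 1
      push_cast
      linear_combination -2 * h - 2 * e
    by_cases hW : 3 ∣ W
    · convert repSq_b1_b1_b3_b3_of_half hX hY hW (W := 1) (by decide) using 1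
      push_cast
      linear_combination -2 * h
    by_cases hXo : X % 2 = 1
    · obtain ⟨X', Z', e, hX', hZ'⟩ := exists_sq_add_three_mul_sq (z := 1) hX hXo
      convert repSq_b1_b1_b3_b3_of_half hX' hY (hZ'.2 (by decide)) hW using 1
      push_cast
      linear_combination -2 * h - 2 * e
    by_cases hWo : W % 2 = 0
    · exact key Y W h hY hW (by omega)
    · have hYo : Y % 2 = 1 := by
        have h' := congrArg (· % 2) h
        by_contra hYo
        obtain ⟨x, rfl⟩ : ∃ x, X = 2 * x := ⟨X / 2, by omega⟩
        obtain ⟨y, rfl⟩ : ∃ y, Y = 2 * y := ⟨Y / 2, by omega⟩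
        obtain ⟨w, rfl⟩ : ∃ w, W = 2 * w + 1 := ⟨W / 2, by omega⟩
        ring_nf at h'
        omega
      obtain ⟨k, rfl⟩ : ∃ k, W = Y + 2 * k := ⟨(W - Y) / 2, by omega⟩
      rcases Int.emod_two_eq_zero_or_one k with hk | hk
      · exact key (2 * Y + 3 * k) k (by linear_combination h) (by omega) (by omega) (by omega)
      · exact key (Y + 3 * k) (Y + k) (by linear_combination h) (by omega) (by omega) (by omega)
  · obtain ⟨w, m, hw, hm, hm4⟩ : ∃ w m : ℕ, w % 3 ≠ 0 ∧ A = m + 3 * w ^ 2 ∧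
        (0 < m ∧ (m % 4 = 0 ∨ m % 4 = 1)) := by
      rcases (by omega : A % 4 = 1 ∨ A % 4 = 3) with e | e
      · exact ⟨2, A - 12, by norm_num, by omega, by omega⟩
      · exact ⟨1, A - 3, by norm_num, by omega, by omega⟩
    obtain ⟨x, y, z, h, -⟩ := exists_one_one_three (n := m) hm4.1 (by omega)
    dsimp only at h
    have hx := sq_emod_three x
    have hy := sq_emod_three y
    have hx3 := not_three_dvd_of_sq (x := x) (by omega)
    have hy3 := not_three_dvd_of_sq (x := y) (by omega)
    have hw3 : ¬ (3 : ℤ) ∣ w := by omega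
    by_cases hz : 3 ∣ z
    · have hpar : x % 2 = z % 2 ∨ y % 2 = z % 2 := by
        have hx4 := sq_emod_four x
        have hy4 := sq_emod_four y
        have hz4 := sq_emod_four z
        split_ifs at hx4 hy4 hz4 <;> omega
      rcases hpar with hp | hp
      · obtain ⟨x', z', e, h1, h2⟩ := exists_sq_add_three_mul_sq hx3 hp
        exact .of_four x' y z' w (by simp [sqCoeff, hm]; linear_combination h + e) (fun _ => h1)
          (fun _ => hy3) (fun _ h => h2.1 h hz) (fun _ => hw3)
      · obtain ⟨y', z', e, h1, h2⟩ := exists_sq_add_three_mul_sq hy3 hp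
        exact .of_four x y' z' w (by simp [sqCoeff, hm]; linear_combination h + e) (fun _ => hx3)
          (fun _ => h1) (fun _ h => h2.1 h hz) (fun _ => hw3)
    · exact .of_four x y z w (by simp [sqCoeff, hm]; linear_combination h) (fun _ => hx3)
        (fun _ => hy3) (fun _ => hz) (fun _ => hw3)

theorem exists_one_one_five {m : ℕ} (hm : m % 8 = 2 ∨ m % 8 = 6 ∨ m % 8 = 7) :
    ∃ x y w : ℤ, x ^ 2 + y ^ 2 + 5 * w ^ 2 = m := by
  obtain ⟨x, y, z, h, -⟩ := exists_sum_three_squares (n := 5 * m) (by omega) (by omega) (by omega)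
  dsimp only at h
  push_cast at h
  have key : ∀ x y z : ℤ, x ^ 2 + y ^ 2 + z ^ 2 = 5 * m → 5 ∣ x → 5 ∣ y - 2 * z ∨ 5 ∣ y + 2 * z →
      ∃ x y w : ℤ, x ^ 2 + y ^ 2 + 5 * w ^ 2 = m := by
    rintro _ y z h ⟨x, rfl⟩ (⟨k, hk⟩ | ⟨k, hk⟩)
    · obtain rfl : y = 2 * z + 5 * k := by omega
      exact ⟨k, z + 2 * k, x, by linarith⟩
    · obtain rfl : y = 5 * k - 2 * z := by omega
      exact ⟨k, z - 2 * k, x, by linarith⟩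
  have hz : ∀ a b c : ZMod 5, a ^ 2 + b ^ 2 + c ^ 2 = 0 →
      (a = 0 ∧ (b - 2 * c = 0 ∨ b + 2 * c = 0)) ∨ (b = 0 ∧ (a - 2 * c = 0 ∨ a + 2 * c = 0)) ∨
      (c = 0 ∧ (a - 2 * b = 0 ∨ a + 2 * b = 0)) := by decide
  have := hz x y z (by
    have := congrArg (Int.cast : ℤ → ZMod 5) h
    push_cast at this
    rw [this, show (5 : ZMod 5) = 0 from rfl, zero_mul])
  simp only [← Int.cast_ofNat (R := ZMod 5), ← Int.cast_mul, ← Int.cast_sub, ← Int.cast_add,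
    ZMod.intCast_zmod_eq_zero_iff_dvd] at this
  push_cast at this
  rcases this with h' | h' | h'
  · exact key x y z h h'.1 h'.2
  · exact key y x z (by linarith) h'.1 h'.2
  · exact key z x y (by linarith) h'.1 h'.2

theorem universalTerms_b1_b1_b3_b5 :
    UniversalTerms [(1, true), (1, true), (3, true), (5, true)] := by
  refine universalTerms_of_large 90 (by decide) (fun n => termsRep_of_smallMask_eq
    (by decide +kernel)) (fun A hA h3 h4 _ _ => ?_) (by decide)
  change A % 3 = 1 at h3
  obtain ⟨z, m, hz, hm, hm8⟩ : ∃ z m : ℕ, z % 3 ≠ 0 ∧ A = m + 3 * z ^ 2 ∧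
      (m % 8 = 2 ∨ m % 8 = 6 ∨ m % 8 = 7) := by
    rcases (by omega : A % 4 = 1 ∨ A % 4 = 2 ∨ A % 8 = 3 ∨ A % 8 = 7) with e | e | e | e
    · exact ⟨1, A - 3, by norm_num, by omega, by omega⟩
    · exact ⟨2, A - 12, by norm_num, by omega, by omega⟩
    · exact ⟨2, A - 12, by norm_num, by omega, by omega⟩
    · exact ⟨4, A - 48, by norm_num, by omega, by omega⟩
  obtain ⟨x, y, w, h⟩ := exists_one_one_five hm8
  have hz3 : ¬ (3 : ℤ) ∣ z := by omega
  have hnsq : ∀ t : ℤ, t ^ 2 ≠ m := by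
    intro t ht
    have := sq_emod_four t
    have h2 : m % 4 ≠ 0 → m % 4 ≠ 1 → False := fun h h' => by split_ifs at this <;> omega
    omega
  have key : ∀ x y w : ℤ, x ^ 2 + y ^ 2 + 5 * w ^ 2 = m → ¬ 3 ∣ y → 3 ∣ x → 3 ∣ w →
      RepSq [(1, true), (1, true), (3, true), (5, true)] A := by
    intro x y w h hy hx hw
    obtain ⟨x', w', e, hx', hw'⟩ := exists_sq_add_five_mul_sq _ le_rfl (fun h0 => hnsq y (by
      rw [h0.1, h0.2] at h
      linarith)) hx hw
    exact .of_four x' y z w' (by simp [sqCoeff, hm]; linear_combination h + e) (fun _ => hx')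
      (fun _ => hy) (fun _ => hz3) (fun _ => hw')
  have hx := sq_emod_three x
  have hy := sq_emod_three y
  have hw := sq_emod_three w
  by_cases hx3 : 3 ∣ x <;> by_cases hy3 : 3 ∣ y <;> by_cases hw3 : 3 ∣ w <;>
    simp only [hx3, hy3, hw3, if_true, if_false] at hx hy hw <;>
    first
    | (exfalso; omega)
    | exact key x y w h hy3 hx3 hw3
    | exact key y x w (by linarith) hx3 hy3 hw3
    | exact .of_four x y z w (by simp [sqCoeff, hm]; linear_combination h) (fun _ => hx3)
        (fun _ => hy3) (fun _ => hz3) (fun _ => hw3)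

theorem repSq_a1_a1_b2 {m : ℕ} (hm : 10000 < m) (h3 : m % 3 = 2) :
    RepSq [(1, false), (1, false), (2, true)] m := by
  refine TernaryFact.sound (f := ⟨(1, false), (1, false), (2, true), 3, 6, 1, 36, 1073745920,
    [⟨6, 1, 1, 0, 1, -1, 0, 0, 0, 3⟩, ⟨12, 2, 1, -3, 2, -1, 3, 0, 3, 3⟩,
    ⟨12, 1, 2, -3, 1, -2, -3, 3, 0, 3⟩, ⟨12, 2, 1, 3, 2, -1, -3, 0, 3, -3⟩,
    ⟨12, 1, 2, 3, 1, -2, 3, 3, 0, -3⟩], 6, 36⟩) (by decide +kernel) m hm ?_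
  change Nat.testBit 36 (m % 6) = true
  rcases (by omega : m % 6 = 2 ∨ m % 6 = 5) with h | h <;> rw [h] <;> rfl

theorem universalTerms_a1_b2_a5_b12 :
    UniversalTerms [(1, false), (2, true), (5, false), (12, true)] := by
  refine universalTerms_of_large 4100 (by decide) (fun n => termsRep_of_smallMask_eq
    (by decide +kernel)) (fun A hA h3 h4 _ _ => ?_) (by decide)
  change A % 3 = 2 at h3
  obtain ⟨b, m, hb, hm, hm0, hm8⟩ : ∃ b m : ℕ, (b : ℤ) % 3 ≠ 0 ∧ A = m + 540 * b ^ 2 ∧ 10000 < m ∧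
      (m % 2 = 1 ∨ m % 8 = 2) := by
    rcases (by omega : A % 2 = 1 ∨ A % 8 = 6 ∨ A % 8 = 2) with e | e | e
    · exact ⟨1, A - 540, by norm_num, by omega, by omega⟩
    · exact ⟨1, A - 540, by norm_num, by omega, by omega⟩
    · exact ⟨2, A - 2160, by norm_num, by omega, by omega⟩
  obtain ⟨x, -, v, -, y, hy, h⟩ := repSq_a1_a1_b2 hm0 (by omega)
  have h : 3 * x ^ 2 + 3 * v ^ 2 + 2 * y ^ 2 = (m : ℤ) := by
    have h' : (m : ℤ) - 3 * x ^ 2 - 3 * v ^ 2 - 2 * y ^ 2 = 0 := by simpa [sqCoeff, RepSq] using h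
    linarith
  obtain ⟨x, w, h⟩ : ∃ x w : ℤ, 3 * x ^ 2 + 12 * w ^ 2 + 2 * y ^ 2 = (m : ℤ) := by
    have key : 2 ∣ x ∨ 2 ∣ v := by
      by_contra hxv
      push Not at hxv
      obtain ⟨a, rfl⟩ : ∃ a, x = 2 * a + 1 := ⟨x / 2, by omega⟩
      obtain ⟨b, rfl⟩ : ∃ b, v = 2 * b + 1 := ⟨v / 2, by omega⟩
      have ha := Int.even_mul_succ_self a
      have hb := Int.even_mul_succ_self b
      obtain ⟨a', ha'⟩ := ha
      obtain ⟨b', hb'⟩ := hb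
      have h' : 24 * a' + 24 * b' + 6 + 2 * y ^ 2 = (m : ℤ) := by
        linear_combination h - 12 * ha' - 12 * hb'
      have := sq_emod_four y
      split_ifs at this <;> omega
    rcases key with ⟨w, rfl⟩ | ⟨w, rfl⟩
    · exact ⟨v, w, by linarith⟩
    · exact ⟨x, w, by linarith⟩
  have hy : ¬ 3 ∣ y := hy rfl
  by_cases hw : 3 ∣ w
  · obtain ⟨a, rfl⟩ := hw
    by_cases ha : 3 ∣ 2 * a - 5 * (b : ℤ)
    · exact .of_four x y (2 * a - 4 * b) (2 * a + 5 * b) (by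
        simp [sqCoeff, hm]
        linear_combination h) (by simp) (fun _ => hy) (by simp) (fun _ => by omega)
    · exact .of_four x y (2 * a + 4 * b) (2 * a - 5 * b) (by
        simp [sqCoeff, hm]
        linear_combination h) (by simp) (fun _ => hy) (by simp) (fun _ => ha)
  · exact .of_four x y (6 * b) w (by
      simp [sqCoeff, hm]
      linear_combination h) (by simp) (fun _ => hy) (by simp) (fun _ => hw)

/-- The bit set of the residues with a given property. -/
def residueMask (P : ℕ) (p : ℕ → Bool) : ℕ := orBelow P fun j => bif p j then 2 ^ j else 0

theorem of_testBit_residueMask {P j : ℕ} {p : ℕ → Bool} (h : (residueMask P p).testBit j) :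
    p j = true := by
  obtain ⟨v, -, hv⟩ := testBit_orBelow h
  cases hp : p v with
  | false => simp [hp] at hv
  | true =>
    rw [hp, cond_true, Nat.testBit_two_pow, decide_eq_true_eq] at hv
    rwa [← hv]

theorem RepSq.exists_three {q₁ q₂ q₃ : MixedTerm} {A : ℤ} (h : RepSq [q₁, q₂, q₃] A) :
    ∃ x y z : ℤ, sqCoeff q₁ * x ^ 2 + sqCoeff q₂ * y ^ 2 + sqCoeff q₃ * z ^ 2 = A := by
  obtain ⟨x, -, y, -, z, -, h⟩ := h
  have h : A - sqCoeff q₁ * x ^ 2 - sqCoeff q₂ * y ^ 2 - sqCoeff q₃ * z ^ 2 = 0 := h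
  exact ⟨x, y, z, by linarith⟩

/-- The entry of the table given by maps that make coordinates prime to `3`. -/
theorem MapFact.sound_of_third {f : MapFact} (hf : f.test = true) {a b c : ℕ} {F : FormCoeffs}
    (hF : F = ⟨3 * a, b, c, 0, 0, 0⟩) (htgt : ∀ g ∈ f.maps, g.tgt = F)
    (h1 : f.mult = 1) (h2 : f.div = 1) (h3 : f.third = true) (h4 : f.primes = [])
    (hrep : ∀ m : ℕ, 10000 < m → f.residues.testBit (m % f.modulus) →
      ∃ x y z, f.src.eval x y z = m) :
    (⟨[(a, false), (b, true), (c, true)], f.modulus, f.residues⟩ : MaskEntry).Sound := by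
  intro m hm hbit
  obtain ⟨x, y, z, he⟩ := hrep m hm hbit
  obtain ⟨g, hg, u, v, w, -, hu, hvw⟩ := MapFact.exists_maps hf he hbit (Or.inl h4)
  rw [h1, h2, htgt g hg, hF] at hu
  refine ⟨u, by simp, v, fun _ => (hvw h3).1, w, fun _ => (hvw h3).2, ?_⟩
  change (m : ℤ) - _ - _ - _ = 0
  simp only [FormCoeffs.eval, ternaryForm] at hu
  simp only [sqCoeff, Bool.false_eq_true, if_true, if_false]
  push_cast at hu ⊢
  linarith

theorem repSq_a1_a1_b1 {m : ℕ} (hm : 10000 < m) (h3 : m % 3 = 1) :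
    RepSq [(1, false), (1, false), (1, true)] m := by
  refine TernaryFact.sound (f := ⟨(1, false), (1, false), (1, true), 3, 3, 1, 9, 8,
    [⟨3, 1, 0, 0, 0, 1, 0, 0, 0, 3⟩], 3, 2⟩) (by decide +kernel) m hm ?_
  change Nat.testBit 2 (m % 3) = true
  rw [h3]; rfl

theorem exists_form313_eq {m : ℕ} (hm : 10000 < m) (h3 : m % 3 = 1) :
    ∃ x y z, form313.eval x y z = m := by
  obtain ⟨x, y, z, h⟩ := (repSq_a1_a1_b1 hm h3).exists_three
  exact ⟨x, z, y, by rw [← h]; simp [FormCoeffs.eval, ternaryForm, sqCoeff]; ring⟩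

theorem exists_form323_eq {m : ℕ} (hm : 10000 < m) (h3 : m % 3 = 2) :
    ∃ x y z, form323.eval x y z = m := by
  obtain ⟨x, y, z, h⟩ := (repSq_a1_a1_b2 hm h3).exists_three
  exact ⟨x, z, y, by rw [← h]; simp [FormCoeffs.eval, ternaryForm, sqCoeff]; ring⟩

/-- The residue class modulo `3` of the elements of a bit set. -/
theorem emod_three_of_testBit {P mask c m : ℕ} (hP : 3 ∣ P) (hP' : 0 < P)
    (h : (allBelow P fun j => !mask.testBit j || j % 3 == c) = true)
    (hm : mask.testBit (m % P)) : m % 3 = c := by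
  have := allBelow_iff.1 h _ (Nat.mod_lt m hP')
  rw [hm, Nat.mod_mod_of_dvd _ hP] at this
  simpa using this

/-- The residue classes obtained by maps of denominator `7`. -/
def septimalEntries : List MaskEntry :=
  [⟨[(1, false), (1, true), (3, true)], form313MapsSeven.modulus, form313MapsSeven.residues⟩,
   ⟨[(1, false), (2, true), (3, true)], form323MapsSeven.modulus, form323MapsSeven.residues⟩,
   ⟨[(1, false), (2, true), (5, true)], 21,
    residueMask 21 fun j => j % 3 == 1 && form11TMapsSeven.residues.testBit (j % 7)⟩]

/-- The residue classes obtained by maps of denominator `11`. -/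
def undecimalEntries : List MaskEntry :=
  [⟨[(1, false), (1, true), (3, true)], form313MapsEleven.modulus, form313MapsEleven.residues⟩,
   ⟨[(1, false), (2, true), (3, true)], form323MapsEleven.modulus, form323MapsEleven.residues⟩]

theorem exists_form325_or_form11T {m : ℕ} (hm : 0 < m) (h3 : m % 3 = 1) :
    (∃ x y z, form325.eval x y z = m) ∨ ∃ x y z, form11T.eval x y z = m := by
  obtain ⟨x, y, z, h, hp⟩ := exists_one_one_three (n := 10 * m) (by omega) (by omega)
  obtain ⟨g, hg, u, v, w, -, he, -⟩ := MapFact.exists_maps form113Maps_test (m := 10 * m)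
    (x := x) (y := y) (z := z) (by
      rw [← h]
      simp [form113Maps, FormCoeffs.eval, ternaryForm]) (by
      change Nat.testBit 1025 (10 * m % 20) = true
      rcases (by omega : 10 * m % 20 = 0 ∨ 10 * m % 20 = 10) with e | e <;> rw [e] <;> rfl)
    (Or.inr hp)
  have he : g.tgt.eval u v w = m := by
    change ((10 : ℕ) : ℤ) * _ = ((1 : ℕ) : ℤ) * _ at he
    push_cast at he
    linarith
  have ht : ∀ g ∈ form113Maps.maps, g.tgt = form325 ∨ g.tgt = form11T := by decide
  rcases ht g hg with e | e <;> rw [e] at he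
  · exact Or.inl ⟨u, v, w, he⟩
  · exact Or.inr ⟨u, v, w, he⟩

theorem repSq_a1_b2_b5_of_eval {m : ℕ} (h3 : m % 3 = 1) {x y z : ℤ}
    (h : form325.eval x y z = m) : RepSq [(1, false), (2, true), (5, true)] m := by
  have h : 3 * x ^ 2 + 2 * y ^ 2 + 5 * z ^ 2 = (m : ℤ) := by
    simpa [FormCoeffs.eval, ternaryForm] using h
  have hy := sq_emod_three y
  have hz := sq_emod_three z
  refine ⟨x, by simp, y, fun _ h' => ?_, z, fun _ h' => ?_, ?_⟩
  · simp only [h', if_true] at hy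
    split_ifs at hz <;> omega
  · simp only [h', if_true] at hz
    split_ifs at hy <;> omega
  · change (m : ℤ) - _ - _ - _ = 0
    simp [sqCoeff]
    linarith

theorem septimalEntries_sound {e : MaskEntry} (he : e ∈ septimalEntries) : e.Sound := by
  simp only [septimalEntries, List.mem_cons, List.not_mem_nil, or_false] at he
  rcases he with rfl | rfl | rfl
  · exact MapFact.sound_of_third form313MapsSeven_test (F := form313) rfl (by decide) rfl rfl rfl
      rfl fun m hm hb => exists_form313_eq hm (emod_three_of_testBit (by decide) (by decide)
        (by decide) hb)
  · exact MapFact.sound_of_third form323MapsSeven_test (F := form323) rfl (by decide) rfl rfl rfl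
      rfl fun m hm hb => exists_form323_eq hm (emod_three_of_testBit (by decide) (by decide)
        (by decide) hb)
  · intro m hm hbit
    have h := of_testBit_residueMask hbit
    simp only [Bool.and_eq_true, beq_iff_eq] at h
    rw [Nat.mod_mod_of_dvd _ (by norm_num), Nat.mod_mod_of_dvd _ (by norm_num)] at h
    obtain ⟨h3, h7⟩ := h
    rcases exists_form325_or_form11T (by omega) h3 with ⟨x, y, z, h⟩ | ⟨x, y, z, h⟩
    · exact repSq_a1_b2_b5_of_eval h3 h
    · obtain ⟨g, hg, u, v, w, -, he, -⟩ := MapFact.exists_maps form11TMapsSeven_test h h7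
        (Or.inl rfl)
      have ht : ∀ g ∈ form11TMapsSeven.maps, g.tgt = form325 := by decide
      rw [ht g hg] at he
      exact repSq_a1_b2_b5_of_eval h3 (by simpa [form11TMapsSeven] using he)

theorem undecimalEntries_sound {e : MaskEntry} (he : e ∈ undecimalEntries) : e.Sound := by
  simp only [undecimalEntries, List.mem_cons, List.not_mem_nil, or_false] at he
  rcases he with rfl | rfl
  · exact MapFact.sound_of_third form313MapsEleven_test (F := form313) rfl (by decide) rfl rfl rfl
      rfl fun m hm hb => exists_form313_eq hm (emod_three_of_testBit (by decide) (by decide)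
        (by decide) hb)
  · exact MapFact.sound_of_third form323MapsEleven_test (F := form323) rfl (by decide) rfl rfl rfl
      rfl fun m hm hb => exists_form323_eq hm (emod_three_of_testBit (by decide) (by decide)
        (by decide) hb)

theorem exists_form325_of_eleven {n m : ℕ} {x y z : ℤ} {X Y Z : ℕ} (hn : n.Coprime 11)
    (h : form11T.eval x y z = m) (hx : (X : ℤ) ≡ n * x [ZMOD 11]) (hy : (Y : ℤ) ≡ n * y [ZMOD 11])
    (hz : (Z : ℤ) ≡ n * z [ZMOD 11])
    (ht : form11TMapsEleven.any (FormMap.testResidue false X Y Z) = true) :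
    ∃ x y z, form325.eval x y z = m := by
  obtain ⟨g, hg, ht⟩ := List.any_eq_true.1 ht
  have hall : ∀ g ∈ form11TMapsEleven, g.den = 11 ∧ g.tgt = form325 ∧
      g.testForm form11T 1 1 = true := by decide +kernel
  obtain ⟨h1, h2, h3⟩ := hall g hg
  obtain ⟨u, v, w, hm, -⟩ := FormMap.exists_maps (Q := 11) (by rwa [h1]) (by simp [h1]) hx hy hz ht
  have := hm.eval_eq h3
  rw [h2, h] at this
  exact ⟨u, v, w, by simpa using this⟩

/-- The residue classes obtained by maps of denominator `11` and `19`. -/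
def mixedEntry : MaskEntry :=
  ⟨[(1, false), (2, true), (5, true)], 627, residueMask 627 fun j => j % 3 == 1 &&
    (form11TMapsNineteen.residues.testBit (j % 19) && Nat.testBit 571 (j % 11))⟩

theorem mixedEntry_sound : mixedEntry.Sound := by
  intro m hm hbit
  simp only [mixedEntry] at hbit
  have h := of_testBit_residueMask hbit
  simp only [Bool.and_eq_true, beq_iff_eq] at h
  rw [Nat.mod_mod_of_dvd _ (by norm_num), Nat.mod_mod_of_dvd _ (by norm_num),
    Nat.mod_mod_of_dvd _ (by norm_num)] at h
  obtain ⟨h3, h19, h11⟩ := h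
  obtain ⟨x, y, z, h⟩ : ∃ x y z, form325.eval x y z = m := by
    rcases exists_form325_or_form11T (by omega) h3 with h | ⟨x, y, z, h⟩
    · exact h
    obtain ⟨g, hg, u, v, w, hmap, he, -⟩ := MapFact.exists_maps form11TMapsNineteen_test h h19
      (Or.inl rfl)
    have he : g.tgt.eval u v w = m := by simpa [form11TMapsNineteen] using he
    have ht : ∀ g ∈ form11TMapsNineteen.maps, g.tgt = form325 ∨ g ∈ form11TSelfMaps := by
      intro g hg
      rcases List.mem_append.1 hg with hg' | hg'
      · left; clear hg; revert g; decide
      · exact Or.inr hg'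
    rcases ht g hg with e | hg'
    · exact ⟨u, v, w, by rwa [e] at he⟩
    have hall := List.all_eq_true.1 form11TSelfMaps_test g hg'
    rw [Bool.and_eq_true] at hall
    have hd : ∀ g ∈ form11TSelfMaps, g.den = 19 ∧ g.tgt = form11T := by decide
    have hscan := test_of_scanResidues (by norm_num) hall.2 h h11
    cases h0 : form11TMapsEleven.any (FormMap.testResidue false (natResidue 11 x)
        (natResidue 11 y) (natResidue 11 z)) with
    | true =>
      exact exists_form325_of_eleven (n := 1) (by norm_num) h
        (by simpa using natResidue_modEq (Q := 11) (by norm_num) x)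
        (by simpa using natResidue_modEq (Q := 11) (by norm_num) y)
        (by simpa using natResidue_modEq (Q := 11) (by norm_num) z) h0
    | false =>
      rw [h0, cond_false] at hscan
      have hrow : ∀ p q r : ℕ, ∀ t : ℤ, g.row p q r x y z = g.den * t →
          ((rowResidue (p + 120 * g.den) (q + 120 * g.den) (r + 120 * g.den) (natResidue 11 x)
            (natResidue 11 y) (natResidue 11 z) : ℕ) : ℤ) ≡ (19 : ℕ) * t [ZMOD 11] := by
        intro p q r t ht
        rw [(hd g hg').1] at ht ⊢
        rw [← ht]
        change (((p + 120 * 19) * natResidue 11 x + ((q + 120 * 19) * natResidue 11 y +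
          (r + 120 * 19) * natResidue 11 z) : ℕ) : ℤ) ≡ _ [ZMOD 11]
        have h12 : ∀ t : ℕ, ((t + 120 * 19 : ℕ) : ℤ) ≡ t - 12 * g.den [ZMOD 11] := by
          intro t
          rw [(hd g hg').1]
          push_cast
          exact Int.modEq_iff_dvd.2 ⟨-228, by ring⟩
        have := ((h12 p).mul (natResidue_modEq (Q := 11) (by norm_num) x)).add
          (((h12 q).mul (natResidue_modEq (Q := 11) (by norm_num) y)).add
          ((h12 r).mul (natResidue_modEq (Q := 11) (by norm_num) z)))
        convert this using 1
        · push_cast; ring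
        · unfold FormMap.row; ring
      rw [(hd g hg').2] at he
      exact exists_form325_of_eleven (n := 19) (by norm_num) he (hrow _ _ _ _ hmap.1)
        (hrow _ _ _ _ hmap.2.1) (hrow _ _ _ _ hmap.2.2) hscan
  exact repSq_a1_b2_b5_of_eval h3 h

/-- The residue classes obtained by maps of denominator `39`. -/
def tridecimalEntry : MaskEntry :=
  ⟨[(1, false), (2, false), (5, true)], 1950, residueMask 1950 fun j => j % 6 == 5 &&
    (form269Maps.residues.testBit (j % 39) &&
      (j % 5 != 0 || (j % 25 == 5 || j % 25 == 20)))⟩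

theorem tridecimalEntry_sound : tridecimalEntry.Sound := by
  intro m hm hbit
  simp only [tridecimalEntry] at hbit
  have h := of_testBit_residueMask hbit
  simp only [Bool.and_eq_true, beq_iff_eq, Bool.or_eq_true, bne_iff_ne] at h
  rw [Nat.mod_mod_of_dvd _ (by norm_num), Nat.mod_mod_of_dvd _ (by norm_num),
    Nat.mod_mod_of_dvd _ (by norm_num), Nat.mod_mod_of_dvd _ (by norm_num)] at h
  obtain ⟨h6, h39, h5⟩ := h
  obtain ⟨x, y, z, h, hp⟩ := exists_halfDisc_five (n := 2 * m) (by omega) (by omega)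
  obtain ⟨g, hg, u, v, w, -, he, -⟩ := MapFact.exists_maps form112Maps_test (m := 2 * m)
    (x := x) (y := y) (z := z) (by
      rw [← h]
      simp [form112Maps, FormCoeffs.eval, ternaryForm]
      ring) (by
      change Nat.testBit 1024 (2 * m % 12) = true
      rw [show 2 * m % 12 = 10 by omega]
      rfl) (Or.inr hp)
  have he : g.tgt.eval u v w = m := by
    change ((2 : ℕ) : ℤ) * _ = ((1 : ℕ) : ℤ) * _ at he
    push_cast at he
    linarith
  have ht : ∀ g ∈ form112Maps.maps, g.tgt = form365 ∨ g.tgt = form269 := by decide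
  obtain ⟨x, y, z, h⟩ : ∃ x y z, form365.eval x y z = m := by
    rcases ht g hg with e | e <;> rw [e] at he
    · exact ⟨u, v, w, he⟩
    · obtain ⟨g, hg, u, v, w, -, he, -⟩ := MapFact.exists_maps form269Maps_test he h39 (Or.inl rfl)
      have ht : ∀ g ∈ form269Maps.maps, g.tgt = form365 := by decide
      rw [ht g hg] at he
      exact ⟨u, v, w, by simpa [form269Maps] using he⟩
  have h : 3 * x ^ 2 + 6 * y ^ 2 + 5 * z ^ 2 = (m : ℤ) := by
    simpa [FormCoeffs.eval, ternaryForm] using h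
  refine ⟨x, by simp, y, by simp, z, fun _ h' => ?_, ?_⟩
  · obtain ⟨t, rfl⟩ := h'
    ring_nf at h
    omega
  · change (m : ℤ) - _ - _ - _ = 0
    simp [sqCoeff]
    linarith

/-- Leaves covered with the help of maps of denominator `7`. -/
def septimalLeaves : List (List MixedTerm) := [
  [(1, false), (1, true), (3, true), (11, false)],
  [(1, false), (1, true), (3, true), (13, false)],
  [(1, false), (1, true), (3, true), (15, false)],
  [(1, false), (1, true), (3, true), (17, false)],
  [(1, false), (1, true), (3, true), (11, true)],
  [(1, false), (1, true), (3, true), (13, true)],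
  [(1, false), (1, true), (3, true), (15, true)],
  [(1, false), (1, true), (3, true), (16, true)],
  [(1, false), (1, true), (3, true), (17, true)],
  [(1, false), (1, true), (3, true), (5, true)],
  [(1, false), (1, true), (3, true), (9, true)],
  [(1, false), (2, true), (3, true), (5, true)],
  [(1, false), (2, true), (5, true), (10, false)],
  [(1, false), (2, true), (5, true), (11, false)],
  [(1, false), (2, true), (5, true), (9, false)],
  [(1, false), (2, true), (5, true), (11, true)],
  [(1, false), (2, true), (5, true), (12, true)],
  [(1, false), (2, true), (5, true), (9, true)]]

/-- Leaves covered with the help of maps of denominator `11`. -/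
def undecimalLeaves : List (List MixedTerm) := [
  [(1, false), (1, true), (3, true), (7, false)],
  [(1, false), (1, true), (3, true), (7, true)],
  [(1, false), (2, true), (3, true), (7, false)],
  [(1, false), (2, true), (3, true), (7, true)]]

theorem septimalLeaves_test : (septimalLeaves.all
    (leafTest 302400 (septimalEntries ++ maskTable) 20)) = true := by
  decide +kernel

theorem undecimalLeaves_test : (undecimalLeaves.all
    (leafTest 475200 (undecimalEntries ++ maskTable) 20)) = true := by
  decide +kernel

theorem universalTerms_a1_a2_b5_a7 :
    UniversalTerms [(1, false), (2, false), (5, true), (7, false)] :=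
  universalTerms_of_leafTest (L := 15600) (B := 65) (es := tridecimalEntry :: maskTable)
    (fun _ he => (List.mem_cons.1 he).elim (fun h => h ▸ tridecimalEntry_sound) maskTable_sound)
    (by norm_num) (by decide +kernel)

theorem universalTerms_a1_a2_b5_b7 :
    UniversalTerms [(1, false), (2, false), (5, true), (7, true)] :=
  universalTerms_of_leafTest (L := 15600) (B := 65) (es := tridecimalEntry :: maskTable)
    (fun _ he => (List.mem_cons.1 he).elim (fun h => h ▸ tridecimalEntry_sound) maskTable_sound)
    (by norm_num) (by decide +kernel)

theorem universalTerms_a1_b2_b5_a7 :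
    UniversalTerms [(1, false), (2, true), (5, true), (7, false)] :=
  universalTerms_of_leafTest (L := 62700) (B := 57) (es := [mixedEntry])
    (fun _ he => List.mem_singleton.1 he ▸ mixedEntry_sound) (by norm_num) (by decide +kernel)

/-- Leaves of the escalator tree that need a separate argument. -/
def specialLeaves : List (List MixedTerm) := septimalLeaves ++ (undecimalLeaves ++ [
  [(1, false), (2, false), (5, true), (7, false)],
  [(1, false), (2, false), (5, true), (7, true)],
  [(1, false), (2, true), (5, false), (12, true)],
  [(1, false), (2, true), (5, true), (7, false)],
  [(1, true), (1, true), (3, true), (5, false)],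
  [(1, true), (1, true), (3, true), (3, true)],
  [(1, true), (1, true), (3, true), (5, true)]])

/-- The test applied to the leaves of the escalator tree. -/
def leafCheck (p : List MixedTerm) : Bool :=
  specialLeaves.contains p || leafTest 43200 maskTable 6 p || leafTest 43200 maskTable 20 p

theorem universalTerms_of_mem_specialLeaves {p : List MixedTerm} (h : p ∈ specialLeaves) :
    UniversalTerms p := by
  rcases List.mem_append.1 h with h | h
  · exact universalTerms_of_leafTest (fun _ he => (List.mem_append.1 he).elim septimalEntries_sound
      maskTable_sound) (by norm_num) (List.all_eq_true.1 septimalLeaves_test p h)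
  rcases List.mem_append.1 h with h | h
  · exact universalTerms_of_leafTest (fun _ he => (List.mem_append.1 he).elim undecimalEntries_sound
      maskTable_sound) (by norm_num) (List.all_eq_true.1 undecimalLeaves_test p h)
  simp only [List.mem_cons, List.not_mem_nil, or_false] at h
  rcases h with rfl | rfl | rfl | rfl | rfl | rfl | rfl
  · exact universalTerms_a1_a2_b5_a7
  · exact universalTerms_a1_a2_b5_b7
  · exact universalTerms_a1_b2_a5_b12
  · exact universalTerms_a1_b2_b5_a7
  · exact universalTerms_b1_b1_b3_a5
  · exact universalTerms_b1_b1_b3_b3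
  · exact universalTerms_b1_b1_b3_b5

theorem universalTerms_of_leafCheck {p : List MixedTerm} (h : leafCheck p = true) :
    UniversalTerms p := by
  simp only [leafCheck, Bool.or_eq_true, List.contains_iff_mem] at h
  rcases h with (h | h) | h
  · exact universalTerms_of_mem_specialLeaves h
  · exact universalTerms_of_leafTest (fun e => maskTable_sound) (by norm_num) h
  · exact universalTerms_of_leafTest (fun e => maskTable_sound) (by norm_num) h

theorem escalate_leafCheck : escalate leafCheck 9 [] = true := by
  decide +kernel

theorem universalTerms_of_criticalNumbers {l : List MixedTerm} (hpos : ∀ q ∈ l, 0 < q.1)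
    (h : ∀ t ∈ criticalNumbers, TermsRep l (t : ℕ)) : UniversalTerms l := by
  have hperm := List.mergeSort_perm l MixedTerm.le
  have hsort : (l.mergeSort MixedTerm.le).Pairwise fun q q' => MixedTerm.le q q' = true := by
    refine List.pairwise_mergeSort ?_ ?_ l
    · rintro ⟨a, i⟩ ⟨b, j⟩ ⟨c, k⟩ h1 h2
      simp only [MixedTerm.le, Bool.or_eq_true, decide_eq_true_eq, Bool.and_eq_true,
        beq_iff_eq, Bool.not_eq_true'] at *
      rcases h1 with h1 | ⟨rfl, h1⟩ <;> rcases h2 with h2 | ⟨rfl, h2⟩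
      · left; omega
      · left; omega
      · left; omega
      · right
        refine ⟨rfl, ?_⟩
        rcases h1 with h1 | h1
        · exact Or.inl h1
        · rcases h2 with h2 | h2
          · rw [h1] at h2; cases h2
          · exact Or.inr h2
    · rintro ⟨a, i⟩ ⟨b, j⟩
      simp only [MixedTerm.le, Bool.or_eq_true, decide_eq_true_eq, Bool.and_eq_true,
        beq_iff_eq, Bool.not_eq_true']
      rcases lt_trichotomy a b with h | rfl | h
      · exact Or.inl (Or.inl h)
      · cases i <;> cases j <;> simp
      · exact Or.inr (Or.inl h)
  have := universalTerms_of_escalate (fun p => universalTerms_of_leafCheck) (p := [])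
    escalate_leafCheck (r := l.mergeSort MixedTerm.le)
    (fun q hq => hpos q (hperm.mem_iff.1 (by simpa using hq))) (by simpa using hsort)
    fun t ht => (h t ht).perm hperm.symm
  exact fun n => (this n).perm (by simpa using hperm)

theorem mixedRepresents_nil_left {b : List ℤ} (hb : ∀ c ∈ b, 0 < c) (n : ℤ) :
    mixedRepresents [] b n ↔ TermsRep (b.map fun c => (c.toNat, true)) n := by
  induction b generalizing n with
  | nil =>
    simp only [mixedRepresents, List.map_nil, TermsRep]
    constructor
    · rintro ⟨x, y, -, -, h⟩
      simpa using h.symm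
    · rintro rfl
      exact ⟨[], [], rfl, rfl, by simp⟩
  | cons c b ih =>
    have hc := hb c (by simp)
    simp only [List.map_cons, TermsRep, ← ih fun d hd => hb d (by simp [hd]), polyVal, if_true,
      Int.toNat_of_nonneg hc.le]
    constructor
    · rintro ⟨x, y, hx, hy, h⟩
      cases y with
      | nil => simp at hy
      | cons t y =>
        refine ⟨t, x, y, hx, by simpa using hy, ?_⟩
        simp only [List.zipWith_cons_cons, List.sum_cons] at h
        linarith
    · rintro ⟨t, x, y, hx, hy, h⟩
      refine ⟨x, t :: y, hx, by simpa using hy, ?_⟩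
      simp only [List.zipWith_cons_cons, List.sum_cons]
      linarith

theorem mixedRepresents_iff {a b : List ℤ} (ha : ∀ c ∈ a, 0 < c) (hb : ∀ c ∈ b, 0 < c) (n : ℤ) :
    mixedRepresents a b n ↔
      TermsRep ((a.map fun c => (c.toNat, false)) ++ b.map fun c => (c.toNat, true)) n := by
  induction a generalizing n with
  | nil => simpa using mixedRepresents_nil_left hb n
  | cons c a ih =>
    have hc := ha c (by simp)
    simp only [List.map_cons, List.cons_append, TermsRep, ← ih fun d hd => ha d (by simp [hd]),
      polyVal, Bool.false_eq_true, if_false, Int.toNat_of_nonneg hc.le]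
    constructor
    · rintro ⟨x, y, hx, hy, h⟩
      cases x with
      | nil => simp at hx
      | cons t x =>
        refine ⟨t, x, y, by simpa using hx, hy, ?_⟩
        simp only [List.zipWith_cons_cons, List.sum_cons] at h
        linarith
    · rintro ⟨t, x, y, hx, hy, h⟩
      refine ⟨t :: x, y, by simpa using hx, hy, ?_⟩
      simp only [List.zipWith_cons_cons, List.sum_cons]
      linarith

/-- The 61-theorem for mixed sums of generalized 4- and 8-gonal numbers. -/
theorem sixtyOne_theorem (a b : List ℤ)
    (ha : ∀ c ∈ a, 0 < c) (hb : ∀ c ∈ b, 0 < c) :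
    mixedUniversal a b ↔
      ∀ n ∈ ([1, 2, 3, 4, 5, 6, 7, 8, 9, 10, 12, 13, 14, 15, 18, 20, 30, 60,
        61] : List ℤ), mixedRepresents a b n := by
  constructor
  · intro h n hn
    exact h n ((by decide : ∀ n ∈ ([1, 2, 3, 4, 5, 6, 7, 8, 9, 10, 12, 13, 14, 15, 18, 20, 30, 60,
      61] : List ℤ), 0 ≤ n) n hn)
  · intro h N hN
    rw [mixedRepresents_iff ha hb]
    have := universalTerms_of_criticalNumbers
      (l := (a.map fun c => (c.toNat, false)) ++ b.map fun c => (c.toNat, true)) (by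
        intro q hq
        simp only [List.mem_append, List.mem_map] at hq
        rcases hq with ⟨c, hc, rfl⟩ | ⟨c, hc, rfl⟩
        · have := ha c hc; simpa using this
        · have := hb c hc; simpa using this) (fun t ht => (mixedRepresents_iff ha hb _).1
          (h t ((by decide : ∀ t ∈ criticalNumbers, (t : ℤ) ∈ ([1, 2, 3, 4, 5, 6, 7, 8, 9, 10, 12,
            13, 14, 15, 18, 20, 30, 60, 61] : List ℤ)) t ht))) N.toNat
    rwa [Int.toNat_of_nonneg hN] at this
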